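/- Let D₁ ⊆ B(H₁) and D₂ ⊆ B(H₂) be masas on separable Hilbert spaces, let B₁, …, B_r ⊆ B(H₁,H₂) be masa-bimodules of finite width, let U, U₁, …, U_r ⊆ B(K₁,K₂) be weak* closed subspaces, and set W = B₁ ⊗̄ U₁ + ⋯ + B_r ⊗̄ U_r. Let M ⊆ B(H₁,H₂) be a ternary masa-bimodule and C ⊆ B(H₁,H₂) be a masa-bimodule that is also a nest algebra bimodule. Then cl(M ⊗̄ U + W) ∩ cl(C ⊗̄ U + W) = cl((M ∩ C) ⊗̄ U + W), where cl denotes weak* closure. -/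

import Mathlib

open scoped ComplexInnerProductSpace Pointwise
open Set MeasureTheory

noncomputable section

namespace OpSynth

/-! ### The σ-weak (weak*) topology on `B(H,K)` -/

/-- The σ-weak (weak*) topology on the space of bounded operators between Hilbert
spaces: the initial topology with respect to the functionals
`T ↦ ∑' n, ⟪η n, T (ξ n)⟫` associated to square-summable sequences `ξ`, `η`.
This is the weak* topology arising from the identification of `B(H,K)` with the
dual of the trace class operators. -/
def sigmaWeak (H K : Type*) [NormedAddCommGroup H] [InnerProductSpace ℂ H]
    [NormedAddCommGroup K] [InnerProductSpace ℂ K] :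
    TopologicalSpace (H →L[ℂ] K) :=
  ⨅ (ξ : ℕ → H) (η : ℕ → K) (_ : Summable fun n => ‖ξ n‖ ^ 2)
    (_ : Summable fun n => ‖η n‖ ^ 2),
    TopologicalSpace.induced
      (fun T : H →L[ℂ] K => ∑' n, ⟪η n, T (ξ n)⟫) inferInstance

section Basic

variable {H K H₁ H₂ H₃ K₁ K₂ T₁ T₂ : Type*}
  [NormedAddCommGroup H] [InnerProductSpace ℂ H]
  [NormedAddCommGroup K] [InnerProductSpace ℂ K]
  [NormedAddCommGroup H₁] [InnerProductSpace ℂ H₁]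
  [NormedAddCommGroup H₂] [InnerProductSpace ℂ H₂]
  [NormedAddCommGroup H₃] [InnerProductSpace ℂ H₃]
  [NormedAddCommGroup K₁] [InnerProductSpace ℂ K₁]
  [NormedAddCommGroup K₂] [InnerProductSpace ℂ K₂]
  [NormedAddCommGroup T₁] [InnerProductSpace ℂ T₁]
  [NormedAddCommGroup T₂] [InnerProductSpace ℂ T₂]

/-- A set of operators is weak* closed if it is closed in the σ-weak topology. -/
def WkClosed (S : Set (H →L[ℂ] K)) : Prop :=
  @IsClosed _ (sigmaWeak H K) S

/-- The weak* closure of a set of operators. -/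
def wkClosure (S : Set (H →L[ℂ] K)) : Set (H →L[ℂ] K) :=
  @closure _ (sigmaWeak H K) S

/-- A weak* closed (linear) subspace of `B(H,K)`. -/
def IsWkClosedSubspace (S : Set (H →L[ℂ] K)) : Prop :=
  (∃ M : Submodule ℂ (H →L[ℂ] K), (M : Set (H →L[ℂ] K)) = S) ∧ WkClosed S

/-- A map between operator spaces is weak* continuous if it is continuous with
respect to the σ-weak topologies. -/
def WkContinuous (φ : (H₁ →L[ℂ] H₂) → (K₁ →L[ℂ] K₂)) : Prop :=
  @Continuous _ _ (sigmaWeak H₁ H₂) (sigmaWeak K₁ K₂) φ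

/-- The norm of an `n × n` matrix of operators, viewed as an operator on the
column Hilbert space `ℓ²(Fin n, H)`: the supremum over the unit ball of the
ℓ²-norm of the image. -/
def blockNorm {n : ℕ} (M : Matrix (Fin n) (Fin n) (H →L[ℂ] K)) : ℝ :=
  sSup { r | ∃ v : Fin n → H, (∑ j, ‖v j‖ ^ 2) ≤ 1 ∧
    r = Real.sqrt (∑ i, ‖∑ j, M i j (v j)‖ ^ 2) }

/-- A map `φ : B(H₁,H₂) → B(K₁,K₂)` is completely bounded if its matrix
amplifications are uniformly bounded. -/
def CompletelyBounded (φ : (H₁ →L[ℂ] H₂) → (K₁ →L[ℂ] K₂)) : Prop :=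
  ∃ C : ℝ, 0 ≤ C ∧ ∀ (n : ℕ) (M : Matrix (Fin n) (Fin n) (H₁ →L[ℂ] H₂)),
    blockNorm (M.map φ) ≤ C * blockNorm M

/-- `t : H → K → T₁` realizes `T₁` as the Hilbertian tensor product `H ⊗ K`:
`t` is bilinear, multiplicative for inner products, and has total range. -/
def IsTensorEmbedding (t : H → K → T₁) : Prop :=
  (∀ x x' y, t (x + x') y = t x y + t x' y) ∧
  (∀ x y y', t x (y + y') = t x y + t x y') ∧
  (∀ (c : ℂ) x y, t (c • x) y = c • t x y) ∧
  (∀ (c : ℂ) x y, t x (c • y) = c • t x y) ∧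
  (∀ x x' y y', ⟪t x y, t x' y'⟫ = ⟪x, x'⟫ * ⟪y, y'⟫) ∧
  (Submodule.span ℂ { z | ∃ x y, z = t x y }).topologicalClosure = ⊤

/-- `W` is the elementary tensor `S ⊗ R` of the operators `S` and `R`, relative
to the tensor product realizations `t₁`, `t₂`. -/
def IsElemTensor (t₁ : H₁ → K₁ → T₁) (t₂ : H₂ → K₂ → T₂)
    (W : T₁ →L[ℂ] T₂) (S : H₁ →L[ℂ] H₂) (R : K₁ →L[ℂ] K₂) : Prop :=
  ∀ x y, W (t₁ x y) = t₂ (S x) (R y)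

/-- The weak* closed tensor product `V ⊗̄ U`: the weak* closed subspace generated
by the elementary tensors `S ⊗ R` with `S ∈ V`, `R ∈ U`. -/
def wTensor (t₁ : H₁ → K₁ → T₁) (t₂ : H₂ → K₂ → T₂)
    (V : Set (H₁ →L[ℂ] H₂)) (U : Set (K₁ →L[ℂ] K₂)) : Set (T₁ →L[ℂ] T₂) :=
  wkClosure ↑(Submodule.span ℂ
    { W : T₁ →L[ℂ] T₂ | ∃ S ∈ V, ∃ R ∈ U, IsElemTensor t₁ t₂ W S R })

/-- The Fubini product `F(V,U) = (V ⊗̄ B(K₁,K₂)) ∩ (B(H₁,H₂) ⊗̄ U)`. -/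
def Fubini (t₁ : H₁ → K₁ → T₁) (t₂ : H₂ → K₂ → T₂)
    (V : Set (H₁ →L[ℂ] H₂)) (U : Set (K₁ →L[ℂ] K₂)) : Set (T₁ →L[ℂ] T₂) :=
  wTensor t₁ t₂ V univ ∩ wTensor t₁ t₂ univ U

/-- Sum of finitely many subsets of an additive monoid. -/
def setSum {α : Type*} [AddCommMonoid α] {n : ℕ} (S : Fin n → Set α) : Set α :=
  { x | ∃ f : Fin n → α, (∀ i, f i ∈ S i) ∧ x = ∑ i, f i }

/-- The reflexive hull `Ref W = {T : Tx ∈ closure (W x) for all x}`. -/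
def RefHull (W : Set (H →L[ℂ] K)) : Set (H →L[ℂ] K) :=
  { T | ∀ x : H, T x ∈ closure ((fun S : H →L[ℂ] K => S x) '' W) }

end Basic

/-- Property `S_σ`: `F(V,U) = V ⊗̄ U` for every weak* closed subspace `U` of
`B(K₁,K₂)`, all Hilbert spaces `K₁`, `K₂`, and all realizations of the
corresponding Hilbertian tensor products. -/
def HasSsigma {H₁ H₂ : Type*}
    [NormedAddCommGroup H₁] [InnerProductSpace ℂ H₁]
    [NormedAddCommGroup H₂] [InnerProductSpace ℂ H₂]
    (V : Set (H₁ →L[ℂ] H₂)) : Prop :=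
  ∀ (K₁ K₂ T₁ T₂ : Type)
    [NormedAddCommGroup K₁] [InnerProductSpace ℂ K₁] [CompleteSpace K₁]
    [NormedAddCommGroup K₂] [InnerProductSpace ℂ K₂] [CompleteSpace K₂]
    [NormedAddCommGroup T₁] [InnerProductSpace ℂ T₁] [CompleteSpace T₁]
    [NormedAddCommGroup T₂] [InnerProductSpace ℂ T₂] [CompleteSpace T₂]
    (t₁ : H₁ → K₁ → T₁) (t₂ : H₂ → K₂ → T₂),
    IsTensorEmbedding t₁ → IsTensorEmbedding t₂ →
    ∀ U : Set (K₁ →L[ℂ] K₂), IsWkClosedSubspace U →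
      Fubini t₁ t₂ V U = wTensor t₁ t₂ V U

section Masa

variable {H H₁ H₂ H₃ : Type*}
  [NormedAddCommGroup H] [InnerProductSpace ℂ H] [CompleteSpace H]
  [NormedAddCommGroup H₁] [InnerProductSpace ℂ H₁] [CompleteSpace H₁]
  [NormedAddCommGroup H₂] [InnerProductSpace ℂ H₂] [CompleteSpace H₂]
  [NormedAddCommGroup H₃] [InnerProductSpace ℂ H₃] [CompleteSpace H₃]

/-- A masa: a maximal abelian selfadjoint subalgebra of `B(H)`. -/
def IsMasa (D : StarSubalgebra ℂ (H →L[ℂ] H)) : Prop :=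
  (∀ a ∈ D, ∀ b ∈ D, a * b = b * a) ∧
  ∀ E : StarSubalgebra ℂ (H →L[ℂ] H),
    (∀ a ∈ E, ∀ b ∈ E, a * b = b * a) → D ≤ E → E = D

/-- A (weak* closed) `D₂,D₁`-masa-bimodule. -/
def IsMasaBimodule (D₁ : StarSubalgebra ℂ (H₁ →L[ℂ] H₁))
    (D₂ : StarSubalgebra ℂ (H₂ →L[ℂ] H₂)) (V : Set (H₁ →L[ℂ] H₂)) : Prop :=
  IsWkClosedSubspace V ∧
  ∀ X ∈ V, ∀ A ∈ D₁, ∀ B ∈ D₂, B ∘L X ∘L A ∈ V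

/-- A ternary set of operators: closed under the triple product `T S* R`. -/
def IsTernary (M : Set (H₁ →L[ℂ] H₂)) : Prop :=
  ∀ T ∈ M, ∀ S ∈ M, ∀ R ∈ M, T ∘L (ContinuousLinearMap.adjoint S) ∘L R ∈ M

/-- An orthogonal projection. -/
def IsProj (p : H →L[ℂ] H) : Prop := p ∘L p = p ∧ IsSelfAdjoint p

/-- A minimal non-zero projection of a masa. -/
def IsMinimalProjOf (D : StarSubalgebra ℂ (H →L[ℂ] H)) (p : H →L[ℂ] H) : Prop :=
  p ∈ D ∧ IsProj p ∧ p ≠ 0 ∧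
    ∀ q ∈ D, IsProj q → p ∘L q = q → q = 0 ∨ q = p

/-- A projection in a masa is non-atomic if it dominates no minimal non-zero
projection of the masa. -/
def IsNonAtomicProj (D : StarSubalgebra ℂ (H →L[ℂ] H)) (E : H →L[ℂ] H) : Prop :=
  ∀ p, IsMinimalProjOf D p → ¬ (E ∘L p = p)

/-- A `D₂,D₁`-masa-bimodule map. -/
def IsMasaBimoduleMap (D₁ : StarSubalgebra ℂ (H₁ →L[ℂ] H₁))
    (D₂ : StarSubalgebra ℂ (H₂ →L[ℂ] H₂))
    (φ : (H₁ →L[ℂ] H₂) → (H₁ →L[ℂ] H₂)) : Prop :=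
  ∀ (X : H₁ →L[ℂ] H₂), ∀ A ∈ D₁, ∀ B ∈ D₂,
    φ (B ∘L X ∘L A) = B ∘L (φ X) ∘L A

/-- A Schur idempotent: a weak* continuous completely bounded idempotent
masa-bimodule map. -/
def IsSchurIdempotent (D₁ : StarSubalgebra ℂ (H₁ →L[ℂ] H₁))
    (D₂ : StarSubalgebra ℂ (H₂ →L[ℂ] H₂))
    (φ : (H₁ →L[ℂ] H₂) → (H₁ →L[ℂ] H₂)) : Prop :=
  IsLinearMap ℂ φ ∧ WkContinuous φ ∧ CompletelyBounded φ ∧ φ ∘ φ = φ ∧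
    IsMasaBimoduleMap D₁ D₂ φ

/-- A nest: a totally ordered family of closed subspaces containing the
intersection and the closed linear span of any of its subsets. -/
def IsNest (N : Set (Submodule ℂ H)) : Prop :=
  (∀ p ∈ N, IsClosed (p : Set H)) ∧ IsChain (· ≤ ·) N ∧
  ∀ S : Set (Submodule ℂ H), S ⊆ N →
    sInf S ∈ N ∧ (sSup S).topologicalClosure ∈ N

/-- The nest algebra of a nest: all operators leaving each subspace invariant. -/
def nestAlg (N : Set (Submodule ℂ H)) : Set (H →L[ℂ] H) :=
  { T | ∀ p ∈ N, ∀ x ∈ p, T x ∈ p }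

/-- A (weak* closed) nest algebra bimodule. -/
def IsNestBimodule (V : Set (H₁ →L[ℂ] H₂)) : Prop :=
  IsWkClosedSubspace V ∧
  ∃ (N₁ : Set (Submodule ℂ H₁)) (N₂ : Set (Submodule ℂ H₂)),
    IsNest N₁ ∧ IsNest N₂ ∧
    ∀ X ∈ V, ∀ A ∈ nestAlg N₁, ∀ B ∈ nestAlg N₂, B ∘L X ∘L A ∈ V

/-- A masa-bimodule of finite width: a finite intersection of masa-bimodules
each of which is a nest algebra bimodule. -/
def HasFiniteWidth (D₁ : StarSubalgebra ℂ (H₁ →L[ℂ] H₁))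
    (D₂ : StarSubalgebra ℂ (H₂ →L[ℂ] H₂)) (V : Set (H₁ →L[ℂ] H₂)) : Prop :=
  ∃ (k : ℕ) (Vs : Fin k → Set (H₁ →L[ℂ] H₂)),
    (∀ j, IsMasaBimodule D₁ D₂ (Vs j) ∧ IsNestBimodule (Vs j)) ∧
    V = ⋂ j, Vs j

end Masa

section Algebras

variable {H H₁ H₂ H₃ K : Type*}
  [NormedAddCommGroup H] [InnerProductSpace ℂ H] [CompleteSpace H]
  [NormedAddCommGroup H₁] [InnerProductSpace ℂ H₁] [CompleteSpace H₁]
  [NormedAddCommGroup H₂] [InnerProductSpace ℂ H₂] [CompleteSpace H₂]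
  [NormedAddCommGroup H₃] [InnerProductSpace ℂ H₃] [CompleteSpace H₃]

/-- A weak* closed unital operator algebra in `B(H)`. -/
def IsWkClosedUnitalAlg (A : Set (H →L[ℂ] H)) : Prop :=
  IsWkClosedSubspace A ∧ (1 : H →L[ℂ] H) ∈ A ∧ ∀ a ∈ A, ∀ b ∈ A, a ∘L b ∈ A

/-- `[X Y]`: the weak* closed linear span of the products `x ∘ y`. -/
def mulSpan (X : Set (H₂ →L[ℂ] H₃)) (Y : Set (H₁ →L[ℂ] H₂)) :
    Set (H₁ →L[ℂ] H₃) :=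
  wkClosure ↑(Submodule.span ℂ { T : H₁ →L[ℂ] H₃ | ∃ x ∈ X, ∃ y ∈ Y, T = x ∘L y })

/-- The data witnessing a spatial embedding of `A` into `B`. -/
def SpatialPair (A : Set (H₁ →L[ℂ] H₁)) (B : Set (H₂ →L[ℂ] H₂))
    (X : Set (H₁ →L[ℂ] H₂)) (Y : Set (H₂ →L[ℂ] H₁)) : Prop :=
  IsWkClosedSubspace X ∧ IsWkClosedSubspace Y ∧
  (∀ x ∈ X, ∀ b ∈ B, ∀ a ∈ A, b ∘L x ∘L a ∈ X) ∧
  (∀ y ∈ Y, ∀ a ∈ A, ∀ b ∈ B, a ∘L y ∘L b ∈ Y) ∧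
  mulSpan X Y ⊆ B ∧ mulSpan Y X = A

/-- `A` is spatially embedded in `B`. -/
def SpatiallyEmbedded (A : Set (H₁ →L[ℂ] H₁)) (B : Set (H₂ →L[ℂ] H₂)) : Prop :=
  ∃ X Y, SpatialPair A B X Y

/-- `A` and `B` are spatially Morita equivalent. -/
def SpatiallyMorita (A : Set (H₁ →L[ℂ] H₁)) (B : Set (H₂ →L[ℂ] H₂)) : Prop :=
  ∃ X Y, SpatialPair A B X Y ∧ mulSpan X Y = B

/-- The strong operator topology on `B(H,K)`. -/
def sot (H K : Type*) [NormedAddCommGroup H] [InnerProductSpace ℂ H]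
    [NormedAddCommGroup K] [InnerProductSpace ℂ K] :
    TopologicalSpace (H →L[ℂ] K) :=
  TopologicalSpace.induced (fun T : H →L[ℂ] K => (T : H → K)) Pi.topologicalSpace

/-- A commutative subspace lattice (CSL): a strongly closed lattice of mutually
commuting orthogonal projections containing `0` and `1`. -/
def IsCSL (L : Set (H →L[ℂ] H)) : Prop :=
  (∀ P ∈ L, IsProj P) ∧
  (∀ P ∈ L, ∀ Q ∈ L, P ∘L Q = Q ∘L P) ∧
  (0 : H →L[ℂ] H) ∈ L ∧ (1 : H →L[ℂ] H) ∈ L ∧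
  (∀ P ∈ L, ∀ Q ∈ L, P ∘L Q ∈ L ∧ P + Q - P ∘L Q ∈ L) ∧
  @IsClosed _ (sot H H) L

/-- The CSL algebra `Alg L = {T : (1 - P) T P = 0 for all P ∈ L}`. -/
def cslAlg (L : Set (H →L[ℂ] H)) : Set (H →L[ℂ] H) :=
  { T | ∀ P ∈ L, (1 - P) ∘L T ∘L P = 0 }

/-- A lattice homomorphism between CSLs (preserving meets and joins). -/
def IsLatticeHom (L₁ : Set (H₁ →L[ℂ] H₁)) (L₂ : Set (H₂ →L[ℂ] H₂))
    (φ : (H₁ →L[ℂ] H₁) → (H₂ →L[ℂ] H₂)) : Prop :=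
  MapsTo φ L₁ L₂ ∧
  (∀ P ∈ L₁, ∀ Q ∈ L₁, φ (P ∘L Q) = φ P ∘L φ Q) ∧
  (∀ P ∈ L₁, ∀ Q ∈ L₁, φ (P + Q - P ∘L Q) = φ P + φ Q - φ P ∘L φ Q)

end Algebras

section MeasurePart

variable {X X₁ X₂ : Type*} [MeasurableSpace X] [MeasurableSpace X₁] [MeasurableSpace X₂]

/-- A subset of a product of measure spaces is marginally null if it is
contained in `(M₁ × X₂) ∪ (X₁ × M₂)` with `μ₁ M₁ = μ₂ M₂ = 0`. -/
def MargNull (μ₁ : Measure X₁) (μ₂ : Measure X₂) (E : Set (X₁ × X₂)) : Prop :=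
  ∃ (M₁ : Set X₁) (M₂ : Set X₂), MeasurableSet M₁ ∧ MeasurableSet M₂ ∧
    μ₁ M₁ = 0 ∧ μ₂ M₂ = 0 ∧
    E ⊆ (M₁ ×ˢ (univ : Set X₂)) ∪ ((univ : Set X₁) ×ˢ M₂)

/-- Marginal equivalence: the symmetric difference is marginally null. -/
def MargEquiv (μ₁ : Measure X₁) (μ₂ : Measure X₂) (E F : Set (X₁ × X₂)) : Prop :=
  MargNull μ₁ μ₂ ((E \ F) ∪ (F \ E))

/-- ω-open sets: marginally equivalent to a countable union of measurable
rectangles. -/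
def OmegaOpen (μ₁ : Measure X₁) (μ₂ : Measure X₂) (E : Set (X₁ × X₂)) : Prop :=
  ∃ (α : ℕ → Set X₁) (β : ℕ → Set X₂),
    (∀ n, MeasurableSet (α n)) ∧ (∀ n, MeasurableSet (β n)) ∧
    MargEquiv μ₁ μ₂ E (⋃ n, (α n) ×ˢ (β n))

/-- ω-closed sets: complements of ω-open sets. -/
def OmegaClosed (μ₁ : Measure X₁) (μ₂ : Measure X₂) (E : Set (X₁ × X₂)) : Prop :=
  OmegaOpen μ₁ μ₂ Eᶜ

/-- `A` is a multiplication operator on `L²(X,μ)`: `A f = φ · f` for some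
essentially bounded function `φ`.  The collection `{A | IsMultOp μ A}` is the
multiplication masa of `L^∞(X,μ)`. -/
def IsMultOp (μ : Measure X) (A : Lp ℂ 2 μ →L[ℂ] Lp ℂ 2 μ) : Prop :=
  ∃ φ : X → ℂ, AEStronglyMeasurable φ μ ∧ (∃ C, ∀ᵐ x ∂μ, ‖φ x‖ ≤ C) ∧
    ∀ f : Lp ℂ 2 μ, ⇑(A f) =ᵐ[μ] fun x => φ x * f x

/-- A (weak* closed) masa-bimodule over the multiplication masas. -/
def IsMultBimodule (μ₁ : Measure X₁) (μ₂ : Measure X₂)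
    (V : Set (Lp ℂ 2 μ₁ →L[ℂ] Lp ℂ 2 μ₂)) : Prop :=
  IsWkClosedSubspace V ∧
  ∀ X ∈ V, ∀ (A : Lp ℂ 2 μ₁ →L[ℂ] Lp ℂ 2 μ₁) (B : Lp ℂ 2 μ₂ →L[ℂ] Lp ℂ 2 μ₂),
    IsMultOp μ₁ A → IsMultOp μ₂ B → B ∘L X ∘L A ∈ V

/-- `T` is supported on `κ`: `M_{χ_β} T M_{χ_α} = 0` (equivalently,
`⟪T f, g⟫ = 0` whenever `f` vanishes off `α` and `g` vanishes off `β`)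
whenever the rectangle `α × β` intersects `κ` marginally nullly. -/
def SupportedOn (μ₁ : Measure X₁) (μ₂ : Measure X₂) (κ : Set (X₁ × X₂))
    (T : Lp ℂ 2 μ₁ →L[ℂ] Lp ℂ 2 μ₂) : Prop :=
  ∀ (α : Set X₁) (β : Set X₂), MeasurableSet α → MeasurableSet β →
    MargNull μ₁ μ₂ ((α ×ˢ β) ∩ κ) →
    ∀ (f : Lp ℂ 2 μ₁) (g : Lp ℂ 2 μ₂),
      (∀ᵐ x ∂μ₁, x ∉ α → f x = 0) → (∀ᵐ y ∂μ₂, y ∉ β → g y = 0) →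
      ⟪T f, g⟫ = (0 : ℂ)

/-- `M_max κ`: the space of all operators supported on `κ` — the largest
masa-bimodule with support `κ`. -/
def Mmax (μ₁ : Measure X₁) (μ₂ : Measure X₂) (κ : Set (X₁ × X₂)) :
    Set (Lp ℂ 2 μ₁ →L[ℂ] Lp ℂ 2 μ₂) :=
  { T | SupportedOn μ₁ μ₂ κ T }

/-- `U` has support `κ`: `κ` is ω-closed and `Ref U = M_max κ`. -/
def HasSupport (μ₁ : Measure X₁) (μ₂ : Measure X₂)
    (U : Set (Lp ℂ 2 μ₁ →L[ℂ] Lp ℂ 2 μ₂)) (κ : Set (X₁ × X₂)) : Prop :=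
  OmegaClosed μ₁ μ₂ κ ∧ RefHull U = Mmax μ₁ μ₂ κ

/-- `M_min κ`: the smallest weak* closed masa-bimodule with support `κ`,
realized as the intersection of all weak* closed masa-bimodules with support `κ`. -/
def Mmin (μ₁ : Measure X₁) (μ₂ : Measure X₂) (κ : Set (X₁ × X₂)) :
    Set (Lp ℂ 2 μ₁ →L[ℂ] Lp ℂ 2 μ₂) :=
  ⋂₀ { U | IsMultBimodule μ₁ μ₂ U ∧ HasSupport μ₁ μ₂ U κ }

/-- `κ` is operator synthetic if it is ω-closed and `M_min κ = M_max κ`. -/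
def OperatorSynthetic (μ₁ : Measure X₁) (μ₂ : Measure X₂)
    (κ : Set (X₁ × X₂)) : Prop :=
  OmegaClosed μ₁ μ₂ κ ∧ Mmin μ₁ μ₂ κ = Mmax μ₁ μ₂ κ

/-- A masa-bimodule of finite width over the multiplication masas. -/
def MultFiniteWidth (μ₁ : Measure X₁) (μ₂ : Measure X₂)
    (V : Set (Lp ℂ 2 μ₁ →L[ℂ] Lp ℂ 2 μ₂)) : Prop :=
  ∃ (k : ℕ) (Vs : Fin k → Set (Lp ℂ 2 μ₁ →L[ℂ] Lp ℂ 2 μ₂)),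
    (∀ j, IsMultBimodule μ₁ μ₂ (Vs j) ∧ IsNestBimodule (Vs j)) ∧
    V = ⋂ j, Vs j

/-- A set of finite width: the support of a masa-bimodule of finite width. -/
def FiniteWidthSet (μ₁ : Measure X₁) (μ₂ : Measure X₂)
    (κ : Set (X₁ × X₂)) : Prop :=
  ∃ V, MultFiniteWidth μ₁ μ₂ V ∧ HasSupport μ₁ μ₂ V κ

end MeasurePart

/-- The flip `ρ : (X₁ × X₂) × (Y₁ × Y₂) → (X₁ × Y₁) × (X₂ × Y₂)`. -/
def flipProd {X₁ X₂ Y₁ Y₂ : Type*} :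
    (X₁ × X₂) × (Y₁ × Y₂) → (X₁ × Y₁) × (X₂ × Y₂) :=
  fun q => ((q.1.1, q.2.1), (q.1.2, q.2.2))

end OpSynth

open scoped ComplexInnerProductSpace Pointwise
open Set OpSynth

namespace OS

open ContinuousLinearMap Filter Topology

set_option linter.unusedSectionVars false

section P1
variable {H K L : Type*}
  [NormedAddCommGroup H] [InnerProductSpace ℂ H]
  [NormedAddCommGroup K] [InnerProductSpace ℂ K]
  [NormedAddCommGroup L] [InnerProductSpace ℂ L]

abbrev L2 (H : Type*) [NormedAddCommGroup H] := lp (fun _ : ℕ => H) 2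

def amp (X : H →L[ℂ] K) : L2 H →L[ℂ] L2 K :=
  lp.mapCLM 2 (fun _ => X) (norm_nonneg X) (fun _ => le_rfl)

@[simp] lemma amp_apply (X : H →L[ℂ] K) (ξ : L2 H) (n : ℕ) : (amp X ξ) n = X (ξ n) := rfl

lemma L2ext {ξ η : L2 H} (h : ∀ n, ξ n = η n) : ξ = η := lp.ext (funext h)

lemma amp_comp (X : K →L[ℂ] L) (Y : H →L[ℂ] K) (ξ : L2 H) : amp (X ∘L Y) ξ = amp X (amp Y ξ) :=
  rfl

def om (ξ : L2 H) (η : L2 K) : (H →L[ℂ] K) →ₗ[ℂ] ℂ where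
  toFun X := ⟪η, amp X ξ⟫
  map_add' X Y := by
    rw [← inner_add_right]; congr 1
  map_smul' c X := by
    rw [RingHom.id_apply, smul_eq_mul, ← inner_smul_right]; congr 1

lemma om_def (ξ : L2 H) (η : L2 K) (X : H →L[ℂ] K) : om ξ η X = ⟪η, amp X ξ⟫ := rfl

lemma om_eq (ξ : L2 H) (η : L2 K) (X : H →L[ℂ] K) : om ξ η X = ∑' n, ⟪η n, X (ξ n)⟫ :=
  lp.inner_eq_tsum _ _

lemma inner_amp [CompleteSpace H] [CompleteSpace K] (X : H →L[ℂ] K) (ξ : L2 H) (η : L2 K) :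
    ⟪η, amp X ξ⟫ = ⟪amp (adjoint X) η, ξ⟫ := by
  rw [lp.inner_eq_tsum, lp.inner_eq_tsum]
  simp [adjoint_inner_left]

lemma om_comp_left [CompleteSpace L] [CompleteSpace K] (ξ : L2 H) (η : L2 L) (B : K →L[ℂ] L)
    (X : H →L[ℂ] K) : om ξ η (B ∘L X) = om ξ (amp (adjoint B) η) X := by
  rw [om_def, amp_comp, inner_amp]; rfl

lemma om_comp_right (ξ : L2 H) (η : L2 L) (B : K →L[ℂ] L)
    (X : H →L[ℂ] K) : om ξ η (B ∘L X) = om (amp X ξ) η B := rfl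

/-- bipolar -/
def bicl (G : Set (H →L[ℂ] K)) : Submodule ℂ (H →L[ℂ] K) where
  carrier := {T | ∀ ξ η, (∀ X ∈ G, om ξ η X = 0) → om ξ η T = 0}
  add_mem' := by
    intro a b ha hb ξ η h
    rw [map_add, ha ξ η h, hb ξ η h, add_zero]
  zero_mem' := by intro ξ η _; simp
  smul_mem' := by
    intro c a ha ξ η h
    rw [map_smul, ha ξ η h, smul_zero]

lemma mem_bicl {G : Set (H →L[ℂ] K)} {T} :
    T ∈ bicl G ↔ ∀ ξ η, (∀ X ∈ G, om ξ η X = 0) → om ξ η T = 0 := Iff.rfl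

lemma subset_bicl {G : Set (H →L[ℂ] K)} {X} (h : X ∈ G) : X ∈ bicl G := fun _ _ hh => hh X h

lemma bicl_le {G G' : Set (H →L[ℂ] K)} (h : ∀ X ∈ G, X ∈ bicl G') {T} (hT : T ∈ bicl G) :
    T ∈ bicl G' := fun ξ η hh => hT ξ η fun X hX => h X hX ξ η hh

lemma bicl_mono {G G' : Set (H →L[ℂ] K)} (h : G ⊆ G') {T} (hT : T ∈ bicl G) :
    T ∈ bicl G' := bicl_le (fun _ hX => subset_bicl (h hX)) hT

/-- images under two-sided multiplications -/
lemma bicl_comp {H' K' : Type*} [NormedAddCommGroup H'] [InnerProductSpace ℂ H']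
    [NormedAddCommGroup K'] [InnerProductSpace ℂ K'] [CompleteSpace K] [CompleteSpace K']
    {G : Set (H →L[ℂ] K)} {G' : Set (H' →L[ℂ] K')} (B : K →L[ℂ] K') (A : H' →L[ℂ] H)
    (h : ∀ X ∈ G, B ∘L X ∘L A ∈ bicl G') {T} (hT : T ∈ bicl G) : B ∘L T ∘L A ∈ bicl G' := by
  intro ξ η hh
  rw [om_comp_left, om_comp_right]
  refine hT _ _ fun X hX => ?_
  have := h X hX ξ η hh
  rwa [om_comp_left, om_comp_right] at this

lemma memlp_extend {ι E : Type*} [NormedAddCommGroup E] {f : ι → ℕ} (hf : Function.Injective f)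
    (v : ι → E) (hv : Summable fun i => ‖v i‖ ^ 2) : Memℓp (Function.extend f v 0) 2 := by
  apply memℓp_gen
  have : (fun n => ‖Function.extend f v 0 n‖ ^ (2 : ENNReal).toReal)
      = Function.extend f (fun i => ‖v i‖ ^ 2) 0 := by
    ext n
    by_cases hn : ∃ i, f i = n
    · obtain ⟨i, rfl⟩ := hn
      rw [hf.extend_apply, hf.extend_apply]; simp
    · rw [Function.extend_apply' _ _ _ hn, Function.extend_apply' _ _ _ hn]; simp
  rw [this]
  exact (summable_extend_zero hf).2 hv

/-- general countable index functional -/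
lemma exists_om {ι : Type*} [Countable ι] (ξ : ι → H) (η : ι → K)
    (hξ : Summable fun i => ‖ξ i‖ ^ 2) (hη : Summable fun i => ‖η i‖ ^ 2) :
    ∃ (ξ' : L2 H) (η' : L2 K), ∀ X : H →L[ℂ] K, om ξ' η' X = ∑' i, ⟪η i, X (ξ i)⟫ := by
  obtain ⟨f, hf⟩ := exists_injective_nat ι
  refine ⟨⟨_, memlp_extend hf ξ hξ⟩, ⟨_, memlp_extend hf η hη⟩, fun X => ?_⟩
  rw [om_eq, ← tsum_extend_zero hf]
  congr 1
  ext n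
  by_cases hn : ∃ i, f i = n
  · obtain ⟨i, rfl⟩ := hn
    simp only [hf.extend_apply]
  · simp [Function.extend_apply' _ _ _ hn]

lemma summable_sq (ξ : L2 H) : Summable fun n => ‖ξ n‖ ^ 2 := by
  have := (lp.memℓp ξ).summable (by simp)
  simpa using this

lemma om_summable (ξ : L2 H) (η : L2 K) (X : H →L[ℂ] K) : Summable fun n => ⟪η n, X (ξ n)⟫ :=
  lp.summable_inner η (amp X ξ)

lemma om_add (ξ ξ' : L2 H) (η η' : L2 K) : ∃ (ξ₁ : L2 H) (η₁ : L2 K),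
    om ξ₁ η₁ = om ξ η + om ξ' η' := by
  obtain ⟨a, b, h⟩ := exists_om (ι := ℕ ⊕ ℕ) (Sum.elim (fun n => ξ n) (fun n => ξ' n))
    (Sum.elim (fun n => η n) (fun n => η' n))
    (Summable.sum _ (summable_sq ξ) (summable_sq ξ'))
    (Summable.sum _ (summable_sq η) (summable_sq η'))
  refine ⟨a, b, LinearMap.ext fun X => ?_⟩
  rw [h X, LinearMap.add_apply, om_eq, om_eq]
  exact Summable.tsum_sum (f := fun i : ℕ ⊕ ℕ => ⟪(Sum.elim (fun n => η n) (fun n => η' n)) i,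
    X ((Sum.elim (fun n => ξ n) (fun n => ξ' n)) i)⟫) (om_summable ξ η X) (om_summable ξ' η' X)

lemma om_sum {ι : Type*} (s : Finset ι) (ξ : ι → L2 H) (η : ι → L2 K) (c : ι → ℂ) :
    ∃ (ξ₁ : L2 H) (η₁ : L2 K), om ξ₁ η₁ = ∑ i ∈ s, c i • om (ξ i) (η i) := by
  classical
  induction s using Finset.induction_on with
  | empty => exact ⟨0, 0, LinearMap.ext fun X => by simp [om_def]⟩
  | insert i s hi ih =>
    obtain ⟨a, b, h⟩ := ih
    obtain ⟨a', b', h'⟩ := om_add (c i • ξ i) a (η i) b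
    refine ⟨a', b', ?_⟩
    rw [h', h, Finset.sum_insert hi]
    congr 1
    exact LinearMap.ext fun X => by simp [om_def]
end P1
end OS

namespace OS

open ContinuousLinearMap Filter Topology

set_option linter.unusedSectionVars false
set_option linter.style.haveILetI false
section P2
variable {H K L : Type*}
  [NormedAddCommGroup H] [InnerProductSpace ℂ H]
  [NormedAddCommGroup K] [InnerProductSpace ℂ K]
  [NormedAddCommGroup L] [InnerProductSpace ℂ L]

lemma memlp_two (ξ : ℕ → H) (h : Summable fun n => ‖ξ n‖ ^ 2) : Memℓp ξ 2 := by
  apply memℓp_gen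
  simpa using h

def omFam (H K : Type*) [NormedAddCommGroup H] [InnerProductSpace ℂ H]
    [NormedAddCommGroup K] [InnerProductSpace ℂ K] :
    (H →L[ℂ] K) → (L2 H × L2 K → ℂ) := fun T q => om q.1 q.2 T

lemma sigmaWeak_eq : sigmaWeak H K =
    TopologicalSpace.induced (omFam H K) Pi.topologicalSpace := by
  unfold sigmaWeak Pi.topologicalSpace
  rw [induced_iInf]
  simp only [induced_compose]
  apply le_antisymm
  · refine le_iInf fun q => ?_
    refine (iInf_le_of_le (fun n => q.1 n) (iInf_le_of_le (fun n => q.2 n)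
      (iInf_le_of_le (summable_sq q.1) (iInf_le_of_le (summable_sq q.2) ?_))))
    apply le_of_eq
    congr 1
  · refine le_iInf fun ξ => le_iInf fun η => le_iInf fun hξ => le_iInf fun hη => ?_
    refine iInf_le_of_le (⟨ξ, memlp_two ξ hξ⟩, ⟨η, memlp_two η hη⟩) ?_
    apply le_of_eq
    congr 1

lemma wkClosure_eq (p : Submodule ℂ (H →L[ℂ] K)) :
    wkClosure (p : Set (H →L[ℂ] K)) = bicl (p : Set (H →L[ℂ] K)) := by
  ext T
  have e : T ∈ wkClosure (p : Set (H →L[ℂ] K)) ↔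
      omFam H K T ∈ closure (omFam H K '' (p : Set (H →L[ℂ] K))) := by
    unfold wkClosure
    rw [sigmaWeak_eq]
    exact closure_induced
  rw [e]
  constructor
  · intro h
    intro ξ η hh
    have hc : IsClosed {f : L2 H × L2 K → ℂ | f (ξ, η) = 0} :=
      isClosed_eq (continuous_apply _) continuous_const
    have : closure (omFam H K '' (p : Set (H →L[ℂ] K))) ⊆ {f : L2 H × L2 K → ℂ | f (ξ, η) = 0} := by
      refine closure_minimal ?_ hc
      rintro _ ⟨X, hX, rfl⟩
      exact hh X hX
    exact this h
  · intro h
    rw [mem_closure_iff_nhds]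
    intro U hU
    rw [nhds_pi, Filter.mem_pi] at hU
    obtain ⟨I, hI, t, ht, htU⟩ := hU
    suffices ∃ X ∈ p, ∀ i ∈ I, om i.1 i.2 X = om i.1 i.2 T by
      obtain ⟨X, hX, hXi⟩ := this
      refine ⟨omFam H K X, htU ?_, X, hX, rfl⟩
      intro i hi
      have : omFam H K X i = omFam H K T i := hXi i hi
      rw [this]
      exact mem_of_mem_nhds (ht i)
    have := hI.fintype
    let Ω : (H →L[ℂ] K) →ₗ[ℂ] (I → ℂ) := LinearMap.pi fun i => om i.1.1 i.1.2
    by_contra hcon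
    have hT : Ω T ∉ p.map Ω := by
      rintro ⟨X, hX, hXT⟩
      refine hcon ⟨X, hX, fun i hi => ?_⟩
      exact congrFun hXT ⟨i, hi⟩
    obtain ⟨g, hg, hgp⟩ := Submodule.exists_le_ker_of_notMem hT
    classical
    obtain ⟨ξ, η, hω⟩ := om_sum Finset.univ (fun i : I => i.1.1) (fun i : I => i.1.2)
      (fun i => g (Pi.single i 1))
    have hgΩ : ∀ X, g (Ω X) = om ξ η X := by
      intro X
      rw [hω]
      have : Ω X = ∑ i, (Ω X i) • (Pi.single i (1 : ℂ) : I → ℂ) := by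
        ext j
        simp [Finset.sum_apply, Pi.single_apply]
      rw [this, map_sum]
      simp only [map_smul, LinearMap.sum_apply, LinearMap.smul_apply, smul_eq_mul]
      refine Finset.sum_congr rfl fun i _ => mul_comm _ _
    apply hg
    rw [hgΩ]
    refine h ξ η fun X hX => ?_
    rw [← hgΩ]
    exact hgp ⟨X, hX, rfl⟩

lemma bicl_span (G : Set (H →L[ℂ] K)) : bicl (Submodule.span ℂ G : Set (H →L[ℂ] K)) = bicl G := by
  apply le_antisymm
  · intro T hT
    refine bicl_le (fun X hX => ?_) hT
    exact (Submodule.span_le (p := bicl G)).2 (fun Y hY => subset_bicl hY) hX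
  · intro T hT
    exact bicl_mono Submodule.subset_span hT

lemma bicl_closed {C : Set (H →L[ℂ] K)} (hC : IsWkClosedSubspace C) {T} (hT : T ∈ bicl C) :
    T ∈ C := by
  obtain ⟨⟨p, rfl⟩, h⟩ := hC
  have h2 := wkClosure_eq p
  have : wkClosure (p : Set (H →L[ℂ] K)) = p := @IsClosed.closure_eq _ (sigmaWeak H K) _ h
  rw [this] at h2
  rw [h2]; exact hT

/-- convergence lemma -/
lemma om_tendsto {ι : Type*} {l : Filter ι} {Ti : ι → H →L[ℂ] K} {T : H →L[ℂ] K} {c : ℝ}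
    (hc : ∀ i, ‖Ti i‖ ≤ c) (h : ∀ x y, Tendsto (fun i => ⟪y, Ti i x⟫) l (𝓝 ⟪y, T x⟫))
    (ξ : L2 H) (η : L2 K) : Tendsto (fun i => om ξ η (Ti i)) l (𝓝 (om ξ η T)) := by
  simp only [om_eq]
  refine tendsto_tsum_of_dominated_convergence (bound := fun n => c * (‖ξ n‖ ^ 2 + ‖η n‖ ^ 2))
    (((summable_sq ξ).add (summable_sq η)).mul_left c) (fun n => h _ _) ?_
  refine Eventually.of_forall fun i n => ?_
  have h0 : 0 ≤ c := (norm_nonneg _).trans (hc i)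
  calc ‖⟪η n, Ti i (ξ n)⟫‖ ≤ ‖η n‖ * ‖Ti i (ξ n)‖ := norm_inner_le_norm _ _
    _ ≤ ‖η n‖ * (c * ‖ξ n‖) := by gcongr; exact (Ti i).le_of_opNorm_le (hc i) _
    _ ≤ c * (‖ξ n‖ ^ 2 + ‖η n‖ ^ 2) := by
      nlinarith [sq_nonneg (‖ξ n‖ - ‖η n‖), mul_nonneg h0 (sq_nonneg (‖ξ n‖ - ‖η n‖)),
        mul_nonneg h0 (mul_nonneg (norm_nonneg (ξ n)) (norm_nonneg (η n)))]

lemma exists_limit [CompleteSpace K] {ι : Type*} (u : Ultrafilter ι) {Ti : ι → H →L[ℂ] K} {c : ℝ}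
    (hc : ∀ i, ‖Ti i‖ ≤ c) : ∃ T : H →L[ℂ] K, ‖T‖ ≤ c ∧
      (∀ x y, Tendsto (fun i => ⟪y, Ti i x⟫) u (𝓝 ⟪y, T x⟫)) := by
  have hne : Nonempty ι := by
    obtain ⟨x⟩ := (inferInstance : (u : Filter ι).NeBot).nonempty_of_mem univ_mem
    exact ⟨x⟩
  have h0 : 0 ≤ c := (norm_nonneg _).trans (hc hne.some)
  have bd : ∀ i x y, ‖⟪Ti i x, y⟫‖ ≤ c * ‖x‖ * ‖y‖ := fun i x y =>
    (norm_inner_le_norm _ _).trans (by gcongr; exact (Ti i).le_of_opNorm_le (hc i) _)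
  have hl : ∀ x y, ∃ z, Tendsto (fun i => ⟪Ti i x, y⟫) u (𝓝 z) ∧ ‖z‖ ≤ c * ‖x‖ * ‖y‖ := by
    intro x y
    have hcpt := isCompact_closedBall (0 : ℂ) (c * ‖x‖ * ‖y‖)
    obtain ⟨z, hz, hz'⟩ := hcpt.ultrafilter_le_nhds (u.map (fun i => ⟪Ti i x, y⟫)) (by
      rw [Ultrafilter.coe_map]
      refine tendsto_principal.2 (Eventually.of_forall fun i => ?_)
      rw [mem_closedBall_zero_iff]
      exact bd i x y)
    exact ⟨z, hz', by simpa using hz⟩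
  choose B hB hBn using hl
  have uniq : ∀ {f : ι → ℂ} {a b : ℂ}, Tendsto f u (𝓝 a) → Tendsto f u (𝓝 b) → a = b :=
    fun ha hb => tendsto_nhds_unique ha hb
  let F : H → StrongDual ℂ K := fun x => LinearMap.mkContinuous
    { toFun := B x
      map_add' := fun y y' => uniq (hB x (y + y'))
        (by simpa only [inner_add_right] using (hB x y).add (hB x y'))
      map_smul' := fun a y => uniq (hB x (a • y))
        (by simpa only [inner_smul_right, RingHom.id_apply, smul_eq_mul] using (hB x y).const_mul a) } (c * ‖x‖) (hBn x)
  have hF : ∀ x y, ⟪(InnerProductSpace.toDual ℂ K).symm (F x), y⟫ = B x y := by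
    intro x y
    rw [InnerProductSpace.toDual_symm_apply]; rfl
  let T : H →L[ℂ] K := LinearMap.mkContinuous
    { toFun := fun x => (InnerProductSpace.toDual ℂ K).symm (F x)
      map_add' := fun x x' => by
        refine ext_inner_right ℂ fun y => ?_
        rw [inner_add_left, hF, hF, hF]
        exact uniq (hB (x + x') y)
          (by simpa only [map_add, inner_add_left] using (hB x y).add (hB x' y))
      map_smul' := fun a x => by
        refine ext_inner_right ℂ fun y => ?_
        rw [RingHom.id_apply, inner_smul_left, hF, hF]
        exact uniq (hB (a • x) y)
          (by simpa only [map_smul, inner_smul_left] using (hB x y).const_mul _) } c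
    (fun x => by
      simp only [LinearMap.coe_mk, AddHom.coe_mk, LinearIsometryEquiv.norm_map]
      exact LinearMap.mkContinuous_norm_le _ (by positivity) _)
  refine ⟨T, LinearMap.mkContinuous_norm_le _ h0 _, fun x y => ?_⟩
  have h1 : ⟪T x, y⟫ = B x y := hF x y
  have h2 := (Complex.continuous_conj.tendsto _).comp (hB x y)
  rw [← h1] at h2
  simpa only [Function.comp_def, inner_conj_symm] using h2

lemma bicl_limit {G : Set (H →L[ℂ] K)} {ι : Type*} {l : Filter ι} [l.NeBot] {Ti : ι → H →L[ℂ] K}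
    {T : H →L[ℂ] K} {c : ℝ}
    (hc : ∀ i, ‖Ti i‖ ≤ c) (h : ∀ x y, Tendsto (fun i => ⟪y, Ti i x⟫) l (𝓝 ⟪y, T x⟫))
    (hG : ∀ i, Ti i ∈ bicl G) : T ∈ bicl G := by
  intro ξ η hh
  have := om_tendsto hc h ξ η
  simp only [fun i => hG i ξ η hh] at this
  exact (tendsto_nhds_unique this tendsto_const_nhds)

/-- J-lemma -/
lemma Jlemma [CompleteSpace H] (J : Set (H →L[ℂ] H)) (hmul : ∀ a ∈ J, ∀ b ∈ J, a ∘L b ∈ J)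
    (hstar : ∀ a ∈ J, adjoint a ∈ J) (ζ η : L2 H)
    (hζ : ∀ n, ζ n ∈ (Submodule.span ℂ {z | ∃ a ∈ J, ∃ x, z = a x}).topologicalClosure)
    (h : ∀ a ∈ J, ⟪η, amp a ζ⟫ = 0) : ⟪η, ζ⟫ = 0 := by
  set R := (Submodule.span ℂ {z | ∃ a ∈ J, ∃ x, z = a x}).topologicalClosure with hR
  let V := (Submodule.span ℂ {z | ∃ a ∈ J, z = amp a ζ}).topologicalClosure
  have hVc : IsClosed (V : Set (L2 H)) := Submodule.isClosed_topologicalClosure _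
  have : CompleteSpace V := hVc.completeSpace_coe
  -- invariance
  have hVinv : ∀ a ∈ J, ∀ v ∈ V, amp a v ∈ V := by
    intro a ha v hv
    have : V ≤ V.comap (amp a).toLinearMap := by
      apply Submodule.topologicalClosure_minimal
      · rw [Submodule.span_le]
        rintro _ ⟨b, hb, rfl⟩
        apply Submodule.le_topologicalClosure
        apply Submodule.subset_span
        exact ⟨a ∘L b, hmul a ha b hb, rfl⟩
      · exact hVc.preimage (amp a).continuous
    exact this hv
  obtain ⟨v, hv, w, hw, hvw⟩ := V.exists_add_mem_mem_orthogonal ζ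
  have hζV : ∀ a ∈ J, amp a ζ ∈ V := fun a ha =>
    Submodule.le_topologicalClosure _ (Submodule.subset_span ⟨a, ha, rfl⟩)
  have haw : ∀ a ∈ J, amp a w = 0 := by
    intro a ha
    have h1 : amp a w ∈ V := by
      have : amp a w = amp a ζ - amp a v := by rw [hvw]; simp
      rw [this]
      exact V.sub_mem (hζV a ha) (hVinv a ha v hv)
    have h2 : amp a w ∈ Vᗮ := by
      rw [Submodule.mem_orthogonal]
      intro u hu
      rw [inner_amp]
      exact (Submodule.mem_orthogonal _ _).1 hw _ (hVinv _ (hstar a ha) u hu)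
    have := Submodule.inner_right_of_mem_orthogonal h1 h2
    exact inner_self_eq_zero.1 this
  have hvR : ∀ n, v n ∈ R := by
    intro n
    have : V ≤ R.comap (lp.evalCLM ℂ (fun _ : ℕ => H) 2 n).toLinearMap := by
      apply Submodule.topologicalClosure_minimal
      · rw [Submodule.span_le]
        rintro _ ⟨b, hb, rfl⟩
        apply Submodule.le_topologicalClosure
        apply Submodule.subset_span
        exact ⟨b, hb, ζ n, rfl⟩
      · exact (Submodule.isClosed_topologicalClosure _).preimage (lp.evalCLM ℂ (fun _ : ℕ => H) 2 n).continuous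
    exact this hv
  have hw0 : w = 0 := by
    refine L2ext fun n => ?_
    have h1 : w n ∈ R := by
      have : w n = ζ n - v n := by rw [hvw]; simp
      rw [this]; exact R.sub_mem (hζ n) (hvR n)
    have h2 : R ≤ (LinearMap.ker (innerSL ℂ (w n)).toLinearMap) := by
      apply Submodule.topologicalClosure_minimal
      · rw [Submodule.span_le]
        rintro _ ⟨b, hb, x, rfl⟩
        have : (adjoint b) (w n) = 0 := by
          have := haw _ (hstar b hb)
          rw [← amp_apply, this]; rfl
        show ⟪w n, b x⟫ = 0
        rw [← adjoint_inner_left, this, inner_zero_left]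
      · exact isClosed_eq (innerSL ℂ (w n)).continuous continuous_const
    exact inner_self_eq_zero.1 (h2 h1)
  have hηV : V ≤ (LinearMap.ker (innerSL ℂ η).toLinearMap) := by
    apply Submodule.topologicalClosure_minimal
    · rw [Submodule.span_le]
      rintro _ ⟨b, hb, rfl⟩
      exact h b hb
    · exact isClosed_eq (innerSL ℂ η).continuous continuous_const
  rw [hvw, hw0, add_zero]
  exact hηV hv

lemma JR [CompleteSpace H] [CompleteSpace K] {G : Set (H →L[ℂ] K)} {T : H →L[ℂ] K}
    (J : Set (H →L[ℂ] H)) (hmul : ∀ a ∈ J, ∀ b ∈ J, a ∘L b ∈ J)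
    (hstar : ∀ a ∈ J, adjoint a ∈ J)
    (hJ : ∀ z, z ∈ (Submodule.span ℂ {z | ∃ a ∈ J, ∃ x, z = a x}).topologicalClosure)
    (h : ∀ a ∈ J, T ∘L a ∈ bicl G) : T ∈ bicl G := by
  intro ξ η hh
  rw [om_def, inner_amp]
  refine Jlemma J hmul hstar ξ _ (fun n => hJ _) fun a ha => ?_
  rw [← inner_amp]
  exact h a ha ξ η hh

lemma JL [CompleteSpace K] {G : Set (H →L[ℂ] K)} {T : H →L[ℂ] K}
    (J : Set (K →L[ℂ] K)) (hmul : ∀ a ∈ J, ∀ b ∈ J, a ∘L b ∈ J)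
    (hstar : ∀ a ∈ J, adjoint a ∈ J)
    (hJ : ∀ z, T z ∈ (Submodule.span ℂ {z | ∃ a ∈ J, ∃ x, z = a x}).topologicalClosure)
    (h : ∀ a ∈ J, a ∘L T ∈ bicl G) : T ∈ bicl G := by
  intro ξ η hh
  refine Jlemma J hmul hstar _ _ (fun n => hJ _) fun a ha => ?_
  exact h a ha ξ η hh

open InnerProductSpace in
lemma bicl_rankOne [CompleteSpace H] [CompleteSpace K] (Y : H →L[ℂ] K) :
    Y ∈ bicl {X : H →L[ℂ] K | ∃ a b, X = rankOne ℂ a b} := by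
  refine JR {X | ∃ a b, X = rankOne ℂ a b} ?_ ?_ ?_ ?_
  · rintro _ ⟨a, b, rfl⟩ _ ⟨c, d, rfl⟩
    exact ⟨⟪b, c⟫ • a, d, by ext x; simp [smul_smul, mul_comm]⟩
  · rintro _ ⟨a, b, rfl⟩
    exact ⟨b, a, by simp⟩
  · intro z
    apply Submodule.le_topologicalClosure
    apply Submodule.subset_span
    by_cases hz : z = 0
    · exact ⟨rankOne ℂ 0 0, ⟨0, 0, rfl⟩, 0, by simp [hz]⟩
    · refine ⟨rankOne ℂ z z, ⟨z, z, rfl⟩, (⟪z, z⟫)⁻¹ • z, ?_⟩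
      have : ⟪z, z⟫ ≠ 0 := fun h => hz (inner_self_eq_zero.1 h)
      rw [rankOne_apply, inner_smul_right, inv_mul_cancel₀ this, one_smul]
  · rintro _ ⟨a, b, rfl⟩
    exact subset_bicl ⟨Y a, b, by ext; simp⟩

end P2
end OS

namespace OS

open ContinuousLinearMap Filter Topology

set_option linter.unusedSectionVars false
set_option linter.style.haveILetI false
section P3
open scoped TensorProduct
open InnerProductSpace

section alg
variable {E F G : Type*}
  [NormedAddCommGroup E] [InnerProductSpace ℂ E]
  [NormedAddCommGroup F] [InnerProductSpace ℂ F]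
  [NormedAddCommGroup G] [InnerProductSpace ℂ G]

lemma exists_orth_rep (z : E ⊗[ℂ] F) : ∃ (n : ℕ) (b : Fin n → F) (X : Fin n → E),
    Orthonormal ℂ b ∧ z = ∑ j, X j ⊗ₜ[ℂ] b j := by
  obtain ⟨E', F', iE', iF', hz⟩ :=
    TensorProduct.exists_finite_submodule_of_setFinite {z} (Set.finite_singleton z)
  obtain ⟨y, rfl⟩ := Set.singleton_subset_iff.mp hz
  let f := stdOrthonormalBasis ℂ F'
  have : ∀ y : E' ⊗[ℂ] F', ∃ X : Fin (Module.finrank ℂ F') → E',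
      y = ∑ j, X j ⊗ₜ[ℂ] f j := by
    intro y
    induction y using TensorProduct.induction_on with
    | zero => exact ⟨0, by simp⟩
    | tmul x k =>
      refine ⟨fun j => ⟪f j, k⟫ • x, ?_⟩
      conv_lhs => rw [← f.sum_repr' k]
      rw [TensorProduct.tmul_sum]
      simp [TensorProduct.smul_tmul]
    | add a b ha hb =>
      obtain ⟨X, hX⟩ := ha
      obtain ⟨Y, hY⟩ := hb
      refine ⟨X + Y, ?_⟩
      rw [hX, hY, ← Finset.sum_add_distrib]
      simp [TensorProduct.add_tmul]
  obtain ⟨X, hX⟩ := this y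
  refine ⟨_, fun j => (f j : F), fun j => (X j : E), ?_, ?_⟩
  · exact f.orthonormal.comp_linearIsometry F'.subtypeₗᵢ
  · conv_lhs => rw [hX]
    simp [TensorProduct.mapIncl]

lemma norm_sq_orth {n : ℕ} {b : Fin n → F} (hb : Orthonormal ℂ b) (X : Fin n → E) :
    ‖∑ j, X j ⊗ₜ[ℂ] b j‖ ^ 2 = ∑ j, ‖X j‖ ^ 2 := by
  have : (⟪∑ j, X j ⊗ₜ[ℂ] b j, ∑ j, X j ⊗ₜ[ℂ] b j⟫ : ℂ) = ∑ j, (‖X j‖ : ℂ) ^ 2 := by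
    rw [sum_inner]
    refine Finset.sum_congr rfl fun i _ => ?_
    rw [inner_sum]
    simp only [TensorProduct.inner_tmul, orthonormal_iff_ite.1 hb]
    simp [inner_self_eq_norm_sq_to_K]
  have h := (inner_self_eq_norm_sq_to_K (𝕜 := ℂ) (∑ j, X j ⊗ₜ[ℂ] b j)).symm.trans this
  apply Complex.ofReal_injective
  push_cast
  exact h

lemma norm_map_left (S : E →L[ℂ] G) (z : E ⊗[ℂ] F) :
    ‖TensorProduct.map S.toLinearMap LinearMap.id z‖ ≤ ‖S‖ * ‖z‖ := by
  obtain ⟨n, b, X, hb, rfl⟩ := exists_orth_rep z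
  rw [map_sum]
  simp only [TensorProduct.map_tmul, LinearMap.id_apply, ContinuousLinearMap.coe_coe]
  refine le_of_sq_le_sq ?_ (by positivity)
  rw [norm_sq_orth hb, mul_pow, norm_sq_orth hb, Finset.mul_sum]
  refine Finset.sum_le_sum fun j _ => ?_
  rw [← mul_pow]
  gcongr
  exact S.le_opNorm _

lemma norm_map_right (R : F →L[ℂ] G) (z : E ⊗[ℂ] F) :
    ‖TensorProduct.map LinearMap.id R.toLinearMap z‖ ≤ ‖R‖ * ‖z‖ := by
  have h := norm_map_left (F := E) R (TensorProduct.comm ℂ E F z)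
  have e1 : ‖TensorProduct.comm ℂ E F z‖ = ‖z‖ := (TensorProduct.commIsometry ℂ E F).norm_map z
  have e2 : TensorProduct.map R.toLinearMap LinearMap.id (TensorProduct.comm ℂ E F z)
      = TensorProduct.comm ℂ E G (TensorProduct.map LinearMap.id R.toLinearMap z) := by
    rw [TensorProduct.map_comm]
  have e3 : ∀ w, ‖TensorProduct.comm ℂ E G w‖ = ‖w‖ := (TensorProduct.commIsometry ℂ E G).norm_map
  rwa [e1, e2, e3] at h
end alg

variable {H₁ H₂ K₁ K₂ T₁ T₂ H K T : Type*}
    [NormedAddCommGroup H₁] [InnerProductSpace ℂ H₁] [CompleteSpace H₁]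
    [NormedAddCommGroup H₂] [InnerProductSpace ℂ H₂] [CompleteSpace H₂]
    [NormedAddCommGroup K₁] [InnerProductSpace ℂ K₁] [CompleteSpace K₁]
    [NormedAddCommGroup K₂] [InnerProductSpace ℂ K₂] [CompleteSpace K₂]
    [NormedAddCommGroup T₁] [InnerProductSpace ℂ T₁] [CompleteSpace T₁]
    [NormedAddCommGroup T₂] [InnerProductSpace ℂ T₂] [CompleteSpace T₂]
    [NormedAddCommGroup H] [InnerProductSpace ℂ H] [CompleteSpace H]
    [NormedAddCommGroup K] [InnerProductSpace ℂ K] [CompleteSpace K]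
    [NormedAddCommGroup T] [InnerProductSpace ℂ T] [CompleteSpace T]
    {t : H → K → T} {t₁ : H₁ → K₁ → T₁} {t₂ : H₂ → K₂ → T₂}

lemma t_inner (ht : IsTensorEmbedding t) (x x' y y') : ⟪t x y, t x' y'⟫ = ⟪x, x'⟫ * ⟪y, y'⟫ :=
  ht.2.2.2.2.1 x x' y y'

lemma t_norm (ht : IsTensorEmbedding t) (x y) : ‖t x y‖ = ‖x‖ * ‖y‖ := by
  have := t_inner ht x x y y
  rw [inner_self_eq_norm_sq_to_K, inner_self_eq_norm_sq_to_K, inner_self_eq_norm_sq_to_K,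
    ← mul_pow] at this
  have h2 : ‖t x y‖ ^ 2 = (‖x‖ * ‖y‖) ^ 2 := by exact_mod_cast this
  exact (sq_eq_sq₀ (norm_nonneg _) (by positivity)).1 h2

def tL (ht : IsTensorEmbedding t) : H ⊗[ℂ] K →ₗ[ℂ] T :=
  TensorProduct.lift (LinearMap.mk₂ ℂ t ht.1 (fun c x y => ht.2.2.1 c x y) ht.2.1
    (fun c x y => ht.2.2.2.1 c x y))

@[simp] lemma tL_tmul (ht : IsTensorEmbedding t) (x : H) (y : K) : tL ht (x ⊗ₜ y) = t x y := rfl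

lemma tL_inner (ht : IsTensorEmbedding t) (z w : H ⊗[ℂ] K) : ⟪tL ht z, tL ht w⟫ = ⟪z, w⟫ := by
  induction z using TensorProduct.induction_on with
  | zero => simp
  | add a b ha hb => rw [map_add, inner_add_left, inner_add_left, ha, hb]
  | tmul x k =>
    induction w using TensorProduct.induction_on with
    | zero => simp
    | add a b ha hb => rw [map_add, inner_add_right, inner_add_right, ha, hb]
    | tmul y l => simp [t_inner ht]

lemma tL_norm (ht : IsTensorEmbedding t) (z : H ⊗[ℂ] K) : ‖tL ht z‖ = ‖z‖ := by
  rw [@norm_eq_sqrt_re_inner ℂ, @norm_eq_sqrt_re_inner ℂ, tL_inner]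

lemma t_ext (ht : IsTensorEmbedding t) {A B : T →L[ℂ] T₁} (h : ∀ x y, A (t x y) = B (t x y)) :
    A = B := by
  have hs : (Submodule.span ℂ { z | ∃ x y, z = t x y }).topologicalClosure = ⊤ := ht.2.2.2.2.2
  have : (Submodule.span ℂ { z | ∃ x y, z = t x y }).topologicalClosure ≤
      LinearMap.ker (A - B).toLinearMap := by
    apply Submodule.topologicalClosure_minimal
    · rw [Submodule.span_le]
      rintro _ ⟨x, y, rfl⟩
      show (A - B) _ = 0
      simp [h]
    · exact isClosed_eq (A - B).continuous continuous_const
  rw [hs] at this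
  ext z
  have h1 : (A - B) z = 0 := this (Submodule.mem_top (x := z))
  simpa [sub_eq_zero] using h1

lemma tL_dense (ht : IsTensorEmbedding t) : DenseRange (tL ht) := by
  have hs : (Submodule.span ℂ { z | ∃ x y, z = t x y }).topologicalClosure = ⊤ := ht.2.2.2.2.2
  have h2 : Submodule.span ℂ { z | ∃ x y, z = t x y } ≤ LinearMap.range (tL ht) := by
    rw [Submodule.span_le]
    rintro _ ⟨x, y, rfl⟩
    exact ⟨x ⊗ₜ y, rfl⟩
  have h3 := Submodule.dense_iff_topologicalClosure_eq_top.2 hs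
  exact h3.mono h2

lemma exists_tens (ht₁ : IsTensorEmbedding t₁) (ht₂ : IsTensorEmbedding t₂) (S : H₁ →L[ℂ] H₂)
    (R : K₁ →L[ℂ] K₂) : ∃ W : T₁ →L[ℂ] T₂, IsElemTensor t₁ t₂ W S R := by
  let f := (tL ht₂).comp (TensorProduct.map S.toLinearMap R.toLinearMap)
  have hf : ∃ C, ∀ x, ‖f x‖ ≤ C * ‖tL ht₁ x‖ := by
    refine ⟨‖S‖ * ‖R‖, fun x => ?_⟩
    rw [tL_norm]
    show ‖tL ht₂ (TensorProduct.map S.toLinearMap R.toLinearMap x)‖ ≤ _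
    rw [tL_norm]
    have : TensorProduct.map S.toLinearMap R.toLinearMap x =
      TensorProduct.map S.toLinearMap LinearMap.id
        (TensorProduct.map LinearMap.id R.toLinearMap x) := by
      rw [← LinearMap.comp_apply, ← TensorProduct.map_comp]; rfl
    rw [this, mul_assoc]
    exact (norm_map_left _ _).trans (by gcongr; exact norm_map_right _ _)
  refine ⟨f.extendOfNorm (tL ht₁), fun x y => ?_⟩
  exact LinearMap.extendOfNorm_eq (tL_dense ht₁) hf (x ⊗ₜ y)

def tens (ht₁ : IsTensorEmbedding t₁) (ht₂ : IsTensorEmbedding t₂) (S : H₁ →L[ℂ] H₂)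
    (R : K₁ →L[ℂ] K₂) : T₁ →L[ℂ] T₂ := (exists_tens ht₁ ht₂ S R).choose

@[simp] lemma tens_apply (ht₁ : IsTensorEmbedding t₁) (ht₂ : IsTensorEmbedding t₂) (S : H₁ →L[ℂ] H₂)
    (R : K₁ →L[ℂ] K₂) (x : H₁) (y : K₁) : tens ht₁ ht₂ S R (t₁ x y) = t₂ (S x) (R y) :=
  (exists_tens ht₁ ht₂ S R).choose_spec x y

lemma elem_eq (ht₁ : IsTensorEmbedding t₁) (ht₂ : IsTensorEmbedding t₂) {S : H₁ →L[ℂ] H₂}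
    {R : K₁ →L[ℂ] K₂} {W : T₁ →L[ℂ] T₂} (h : IsElemTensor t₁ t₂ W S R) : W = tens ht₁ ht₂ S R :=
  t_ext ht₁ fun x y => by rw [h x y, tens_apply]

/-- amplification `A ⊗ 1` -/
def aT (ht : IsTensorEmbedding t) (A : H →L[ℂ] H) : T →L[ℂ] T := tens ht ht A 1

@[simp] lemma aT_apply (ht : IsTensorEmbedding t) (A : H →L[ℂ] H) (x : H) (y : K) :
    aT ht A (t x y) = t (A x) y := by simp [aT]

lemma aT_comp (ht : IsTensorEmbedding t) (A B : H →L[ℂ] H) : aT ht (A ∘L B) = aT ht A ∘L aT ht B :=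
  t_ext ht fun x y => by simp

lemma aT_one (ht : IsTensorEmbedding t) : aT ht 1 = 1 := t_ext ht fun x y => by simp

lemma t_add_left (ht : IsTensorEmbedding t) (x x' y) : t (x + x') y = t x y + t x' y := ht.1 _ _ _
lemma t_add_right (ht : IsTensorEmbedding t) (x y y') : t x (y + y') = t x y + t x y' := ht.2.1 _ _ _
lemma t_smul_left (ht : IsTensorEmbedding t) (c : ℂ) (x y) : t (c • x) y = c • t x y :=
  ht.2.2.1 _ _ _
lemma t_smul_right (ht : IsTensorEmbedding t) (c : ℂ) (x y) : t x (c • y) = c • t x y :=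
  ht.2.2.2.1 _ _ _

lemma aT_add (ht : IsTensorEmbedding t) (A B : H →L[ℂ] H) : aT ht (A + B) = aT ht A + aT ht B :=
  t_ext ht fun x y => by simp [t_add_left ht]

lemma aT_smul (ht : IsTensorEmbedding t) (c : ℂ) (A : H →L[ℂ] H) : aT ht (c • A) = c • aT ht A :=
  t_ext ht fun x y => by simp [t_smul_left ht]

lemma aT_sub (ht : IsTensorEmbedding t) (A B : H →L[ℂ] H) : aT ht (A - B) = aT ht A - aT ht B := by
  rw [eq_sub_iff_add_eq, ← aT_add, sub_add_cancel]

lemma aT_zero (ht : IsTensorEmbedding t) : aT ht 0 = 0 := by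
  have := aT_sub ht 0 0
  simpa using this

lemma t_inner_ext (ht : IsTensorEmbedding t) {z w : T} (h : ∀ x y, ⟪t x y, z⟫ = ⟪t x y, w⟫) :
    z = w := by
  have : innerSL ℂ z = innerSL ℂ w := t_ext ht fun x y => by
    have := h x y
    rw [← inner_conj_symm, ← inner_conj_symm (t x y) w] at this
    exact (starRingEnd ℂ).injective this
  exact (innerSL_inj (𝕜 := ℂ)).1 this

lemma aT_adjoint (ht : IsTensorEmbedding t) (A : H →L[ℂ] H) :
    adjoint (aT ht A) = aT ht (adjoint A) :=
  t_ext ht fun x y => t_inner_ext ht fun x' y' => by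
    rw [adjoint_inner_right, aT_apply, aT_apply, t_inner ht, t_inner ht, adjoint_inner_right]

def Lx (ht : IsTensorEmbedding t) (x : H) : K →L[ℂ] T := LinearMap.mkContinuous
  { toFun := t x
    map_add' := ht.2.1 x
    map_smul' := fun c y => ht.2.2.2.1 c x y } ‖x‖ (fun y => by
      simp [t_norm ht])

@[simp] lemma Lx_apply (ht : IsTensorEmbedding t) (x : H) (y : K) : Lx ht x y = t x y := rfl

def Rk (ht : IsTensorEmbedding t) (y : K) : H →L[ℂ] T := LinearMap.mkContinuous
  { toFun := fun x => t x y
    map_add' := fun x x' => ht.1 x x' y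
    map_smul' := fun c x => ht.2.2.1 c x y } ‖y‖ (fun x => by
      simp [t_norm ht, mul_comm])

@[simp] lemma Rk_apply (ht : IsTensorEmbedding t) (x : H) (y : K) : Rk ht y x = t x y := rfl

end P3
end OS

namespace OS
open ContinuousLinearMap Filter Topology
set_option linter.unusedSectionVars false
set_option linter.style.haveILetI false
section P4
open scoped TensorProduct
variable {H₁ H₂ K₁ K₂ T₁ T₂ : Type*}
    [NormedAddCommGroup H₁] [InnerProductSpace ℂ H₁] [CompleteSpace H₁]
    [NormedAddCommGroup H₂] [InnerProductSpace ℂ H₂] [CompleteSpace H₂]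
    [NormedAddCommGroup K₁] [InnerProductSpace ℂ K₁] [CompleteSpace K₁]
    [NormedAddCommGroup K₂] [InnerProductSpace ℂ K₂] [CompleteSpace K₂]
    [NormedAddCommGroup T₁] [InnerProductSpace ℂ T₁] [CompleteSpace T₁]
    [NormedAddCommGroup T₂] [InnerProductSpace ℂ T₂] [CompleteSpace T₂]
    {t₁ : H₁ → K₁ → T₁} {t₂ : H₂ → K₂ → T₂}

lemma orth_countable [TopologicalSpace.SeparableSpace H₁] {ι : Type*} (b : ι → H₁)
    (hb : Orthonormal ℂ b) : Countable ι := by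
  have h : (Set.univ : Set ι).PairwiseDisjoint (fun i => Metric.ball (b i) (1/2)) := by
    intro i _ j _ hij
    apply Metric.ball_disjoint_ball
    have h2 : ‖b i - b j‖ ^ 2 = 2 := by
      rw [@norm_sub_sq ℂ, hb.1 i, hb.1 j, hb.2 hij]; norm_num
    rw [dist_eq_norm]
    nlinarith [norm_nonneg (b i - b j)]
  have := h.countable_of_isOpen (fun i _ => Metric.isOpen_ball)
    (fun i _ => ⟨b i, Metric.mem_ball_self (by norm_num)⟩)
  exact countable_univ_iff.1 this

lemma bessel_A (ht₁ : IsTensorEmbedding t₁) (ht₂ : IsTensorEmbedding t₂) (A : H₁ →L[ℂ] H₂)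
    {ι : Type*} {b : ι → H₁} (hb : Orthonormal ℂ b) (F : Finset ι) (η : T₂) :
    ∑ j ∈ F, ‖adjoint (Lx ht₂ (A (b j))) η‖ ^ 2 ≤ ‖A‖ ^ 2 * ‖η‖ ^ 2 := by
  classical
  set k : ι → K₂ := fun j => adjoint (Lx ht₂ (A (b j))) η with hk
  set s := ∑ j ∈ F, ‖k j‖ ^ 2 with hs
  have hs0 : 0 ≤ s := Finset.sum_nonneg fun _ _ => by positivity
  have e1 : (s : ℂ) = ⟪∑ j ∈ F, t₂ (A (b j)) (k j), η⟫ := by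
    rw [sum_inner, hs]; push_cast
    refine Finset.sum_congr rfl fun i hi => ?_
    rw [← Lx_apply ht₂, ← adjoint_inner_right]
    exact (inner_self_eq_norm_sq_to_K (𝕜 := ℂ) (k i)).symm
  have e2 : ‖∑ j ∈ F, t₂ (A (b j)) (k j)‖ ≤ ‖A‖ * Real.sqrt s := by
    have h1 : ∑ j ∈ F, t₂ (A (b j)) (k j) =
        tL ht₂ (TensorProduct.map A.toLinearMap LinearMap.id (∑ j ∈ F, b j ⊗ₜ[ℂ] k j)) := by
      simp [map_sum]
    rw [h1, tL_norm]
    refine (norm_map_left _ _).trans ?_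
    gcongr
    apply Real.le_sqrt_of_sq_le
    have hg : ∀ i j, ⟪b i ⊗ₜ[ℂ] k i, b j ⊗ₜ[ℂ] k j⟫ = if i = j then ((‖k i‖ ^ 2 : ℝ) : ℂ) else 0 := by
      intro i j
      rw [TensorProduct.inner_tmul, orthonormal_iff_ite.1 hb i j]
      split_ifs with hij
      · subst hij; rw [one_mul, inner_self_eq_norm_sq_to_K]; push_cast; rfl
      · simp
    apply le_of_eq
    have : ((‖∑ j ∈ F, b j ⊗ₜ[ℂ] k j‖ ^ 2 : ℝ) : ℂ) = ((∑ j ∈ F, ‖k j‖ ^ 2 : ℝ) : ℂ) := by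
      push_cast
      refine ((inner_self_eq_norm_sq_to_K (𝕜 := ℂ) (∑ j ∈ F, b j ⊗ₜ[ℂ] k j)).symm.trans ?_)
      rw [sum_inner]
      refine Finset.sum_congr rfl fun i hi => ?_
      rw [inner_sum]
      simp only [hg]
      simp [hi]
    exact Complex.ofReal_injective this
  have e3 : s ≤ ‖A‖ * Real.sqrt s * ‖η‖ := by
    have h1 : ‖(s : ℂ)‖ = s := by simp [abs_of_nonneg hs0]
    rw [← h1, e1]
    refine (norm_inner_le_norm _ _).trans ?_
    rw [← e1, h1]
    gcongr
  have h4 := Real.sq_sqrt hs0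
  have h5 := Real.sqrt_nonneg s
  by_cases h0 : Real.sqrt s = 0
  · rw [h0] at h4; have h8 : s = 0 := by linarith
    rw [h8]; positivity
  · have h6 : 0 < Real.sqrt s := lt_of_le_of_ne h5 (Ne.symm h0)
    have h7 : Real.sqrt s ≤ ‖A‖ * ‖η‖ := by
      by_contra hh; push Not at hh; nlinarith
    calc s = Real.sqrt s ^ 2 := h4.symm
      _ ≤ (‖A‖ * ‖η‖) ^ 2 := by gcongr
      _ = _ := by ring

lemma expand (ht₁ : IsTensorEmbedding t₁) {ι : Type*} (b : HilbertBasis ι ℂ H₁) (ξ : T₁) :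
    ∃ w : ι → K₁, HasSum (fun j => t₁ (b j) (w j)) ξ ∧ ∀ F : Finset ι, ∑ j ∈ F, ‖w j‖ ^ 2 ≤ ‖ξ‖ ^ 2 := by
  classical
  let V : ι → K₁ →ₗᵢ[ℂ] T₁ := fun j =>
    { toLinearMap := (Lx ht₁ (b j)).toLinearMap
      norm_map' := fun y => by
        show ‖t₁ (b j) y‖ = _
        rw [t_norm ht₁, b.orthonormal.1 j, one_mul] }
  have hV : OrthogonalFamily ℂ (fun _ : ι => K₁) V := by
    intro i j hij x y
    show ⟪t₁ (b i) x, t₁ (b j) y⟫ = 0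
    rw [t_inner ht₁, b.orthonormal.2 hij, zero_mul]
  have hS : IsHilbertSum ℂ (fun _ : ι => K₁) V := by
    refine IsHilbertSum.mk hV ?_
    have hs : (Submodule.span ℂ { z | ∃ x y, z = t₁ x y }).topologicalClosure = ⊤ :=
      ht₁.2.2.2.2.2
    rw [← hs]
    apply Submodule.topologicalClosure_minimal
    · rw [Submodule.span_le]
      rintro _ ⟨x, y, rfl⟩
      have h1 := (b.hasSum_repr x).mapL (Rk ht₁ y)
      refine mem_closure_of_tendsto h1 (Eventually.of_forall fun F => ?_)
      refine Submodule.sum_mem _ fun i _ => ?_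
      refine Submodule.mem_iSup_of_mem i ?_
      rw [map_smul]
      exact Submodule.smul_mem _ _ ⟨y, rfl⟩
    · exact Submodule.isClosed_topologicalClosure _
  set e := hS.linearIsometryEquiv
  have h1 := hS.hasSum_linearIsometryEquiv_symm (e ξ)
  rw [e.symm_apply_apply] at h1
  refine ⟨fun j => e ξ j, h1, fun F => ?_⟩
  have h2 := lp.sum_rpow_le_norm_rpow (p := 2) (by norm_num) (e ξ) F
  rw [e.norm_map] at h2
  simpa using h2

lemma prod_gen {ι E : Type*} [NormedAddCommGroup E] (f : ℕ → ι → E) (g : ℕ → ℝ) (hg : Summable g)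
    (hf : ∀ n (F : Finset ι), ∑ j ∈ F, ‖f n j‖ ^ 2 ≤ g n) :
      Summable fun p : ℕ × ι => ‖f p.1 p.2‖ ^ 2 := by
  have hs : ∀ n, Summable fun j => ‖f n j‖ ^ 2 := fun n =>
    summable_of_sum_le (fun _ => by positivity) (hf n)
  rw [summable_prod_of_nonneg (fun _ => by positivity)]
  refine ⟨hs, hg.of_nonneg_of_le (fun n => tsum_nonneg fun _ => by positivity) fun n => ?_⟩
  exact (hs n).tsum_le_of_sum_le (hf n)

lemma normality [TopologicalSpace.SeparableSpace H₁] (ht₁ : IsTensorEmbedding t₁)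
    (ht₂ : IsTensorEmbedding t₂) (A : H₁ →L[ℂ] H₂) (ξ : L2 T₁) (η : L2 T₂) :
    ∃ (ξ' : L2 K₁) (η' : L2 K₂), ∀ u, om ξ η (tens ht₁ ht₂ A u) = om ξ' η' u := by
  obtain ⟨ι, b, hb⟩ := exists_hilbertBasis ℂ H₁
  haveI : Countable ι := orth_countable _ b.orthonormal
  choose w hw hw2 using fun n => expand ht₁ b (ξ n)
  let v : ℕ → ι → K₂ := fun n j => adjoint (Lx ht₂ (A (b j))) (η n)
  have hv : ∀ n (F : Finset ι), ∑ j ∈ F, ‖v n j‖ ^ 2 ≤ ‖A‖ ^ 2 * ‖η n‖ ^ 2 :=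
    fun n F => bessel_A ht₁ ht₂ A b.orthonormal F (η n)
  have s1 := prod_gen w _ (summable_sq ξ) hw2
  have s2 := prod_gen v _ ((summable_sq η).mul_left (‖A‖ ^ 2)) hv
  obtain ⟨ξ', η', h⟩ := exists_om (fun p : ℕ × ι => w p.1 p.2) (fun p => v p.1 p.2) s1 s2
  refine ⟨ξ', η', fun u => ?_⟩
  rw [h, om_eq]
  have hs : Summable fun p : ℕ × ι => ⟪v p.1 p.2, u (w p.1 p.2)⟫ := by
    refine Summable.of_norm_bounded ((s2.add (s1.mul_left (‖u‖ ^ 2)))) fun p => ?_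
    refine (norm_inner_le_norm _ _).trans ?_
    have := u.le_opNorm (w p.1 p.2)
    nlinarith [sq_nonneg (‖v p.1 p.2‖ - ‖u‖ * ‖w p.1 p.2‖), norm_nonneg (v p.1 p.2),
      mul_le_mul_of_nonneg_left this (norm_nonneg (v p.1 p.2))]
  rw [hs.tsum_prod]
  refine tsum_congr fun n => ?_
  have h3 := ((hw n).mapL (tens ht₁ ht₂ A u)).mapL (innerSL ℂ (η n))
  rw [← innerSL_apply_apply ℂ, ← h3.tsum_eq]
  refine tsum_congr fun j => ?_
  rw [tens_apply, innerSL_apply_apply, adjoint_inner_left, Lx_apply]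

/-- elementary tensors -/
def Es (ht₁ : IsTensorEmbedding t₁) (ht₂ : IsTensorEmbedding t₂) (V : Set (H₁ →L[ℂ] H₂))
    (U : Set (K₁ →L[ℂ] K₂)) : Set (T₁ →L[ℂ] T₂) := {W | ∃ S ∈ V, ∃ R ∈ U, W = tens ht₁ ht₂ S R}

lemma tens_isElem (ht₁ : IsTensorEmbedding t₁) (ht₂ : IsTensorEmbedding t₂) (S : H₁ →L[ℂ] H₂)
    (R : K₁ →L[ℂ] K₂) : IsElemTensor t₁ t₂ (tens ht₁ ht₂ S R) S R := fun x y => by simp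

lemma wTensor_eq (ht₁ : IsTensorEmbedding t₁) (ht₂ : IsTensorEmbedding t₂) (V : Set (H₁ →L[ℂ] H₂))
    (U : Set (K₁ →L[ℂ] K₂)) : wTensor t₁ t₂ V U = bicl (Es ht₁ ht₂ V U) := by
  have : { W : T₁ →L[ℂ] T₂ | ∃ S ∈ V, ∃ R ∈ U, IsElemTensor t₁ t₂ W S R } = Es ht₁ ht₂ V U := by
    ext W
    constructor
    · rintro ⟨S, hS, R, hR, h⟩; exact ⟨S, hS, R, hR, elem_eq ht₁ ht₂ h⟩
    · rintro ⟨S, hS, R, hR, rfl⟩; exact ⟨S, hS, R, hR, tens_isElem ht₁ ht₂ S R⟩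
  rw [wTensor, wkClosure_eq, this, bicl_span]

lemma sum_eq (ht₁ : IsTensorEmbedding t₁) (ht₂ : IsTensorEmbedding t₂) (V : Set (H₁ →L[ℂ] H₂))
    (U : Set (K₁ →L[ℂ] K₂)) {r : ℕ} (Bs : Fin r → Set (H₁ →L[ℂ] H₂))
    (Us : Fin r → Set (K₁ →L[ℂ] K₂)) :
    wkClosure (wTensor t₁ t₂ V U + setSum fun j => wTensor t₁ t₂ (Bs j) (Us j)) =
      bicl (Es ht₁ ht₂ V U ∪ ⋃ j, Es ht₁ ht₂ (Bs j) (Us j)) := by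
  have h1 : (setSum fun j => wTensor t₁ t₂ (Bs j) (Us j)) =
      ((⨆ j, bicl (Es ht₁ ht₂ (Bs j) (Us j)) : Submodule ℂ (T₁ →L[ℂ] T₂)) : Set _) := by
    ext X
    simp only [wTensor_eq ht₁ ht₂]
    constructor
    · rintro ⟨f, hf, rfl⟩
      exact Submodule.sum_mem _ fun i _ => Submodule.mem_iSup_of_mem i (hf i)
    · intro h
      rw [SetLike.mem_coe, Submodule.mem_iSup_iff_exists_finsupp] at h
      obtain ⟨f, hf, rfl⟩ := h
      exact ⟨f, hf, Finsupp.sum_fintype _ _ (fun _ => rfl)⟩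
  rw [h1, wTensor_eq ht₁ ht₂, ← Submodule.coe_sup, wkClosure_eq]
  ext T
  constructor
  · refine bicl_le ?_
    intro X hX
    have : bicl (Es ht₁ ht₂ V U) ⊔ ⨆ j, bicl (Es ht₁ ht₂ (Bs j) (Us j)) ≤
        bicl (Es ht₁ ht₂ V U ∪ ⋃ j, Es ht₁ ht₂ (Bs j) (Us j)) := by
      refine sup_le (fun Y hY => bicl_mono subset_union_left hY) (iSup_le fun j Y hY => ?_)
      exact bicl_mono ((subset_iUnion (fun j => Es ht₁ ht₂ (Bs j) (Us j)) j).trans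
        subset_union_right) hY
    exact this hX
  · refine bicl_le ?_
    rintro X (hX | hX)
    · exact subset_bicl ((le_sup_left : _ ≤ bicl (Es ht₁ ht₂ V U) ⊔ _) (subset_bicl hX))
    · obtain ⟨j, hj⟩ := mem_iUnion.1 hX
      refine subset_bicl ((le_sup_right : _ ≤ bicl (Es ht₁ ht₂ V U) ⊔ _) ?_)
      exact Submodule.mem_iSup_of_mem j (subset_bicl hj)

/-- slice -/
def sl (ht₁ : IsTensorEmbedding t₁) (ht₂ : IsTensorEmbedding t₂) (x : H₁) (y : H₂)
    (T : T₁ →L[ℂ] T₂) : K₁ →L[ℂ] K₂ := adjoint (Lx ht₂ y) ∘L T ∘L Lx ht₁ x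

lemma sl_inner (ht₁ : IsTensorEmbedding t₁) (ht₂ : IsTensorEmbedding t₂) (x : H₁) (y : H₂)
    (T : T₁ →L[ℂ] T₂) (k l) : ⟪l, sl ht₁ ht₂ x y T k⟫ = ⟪t₂ y l, T (t₁ x k)⟫ := by
  simp [sl, adjoint_inner_right]

lemma sl_tens (ht₁ : IsTensorEmbedding t₁) (ht₂ : IsTensorEmbedding t₂) (x : H₁) (y : H₂)
    (S : H₁ →L[ℂ] H₂) (R : K₁ →L[ℂ] K₂) : sl ht₁ ht₂ x y (tens ht₁ ht₂ S R) = ⟪y, S x⟫ • R := by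
  ext k
  refine ext_inner_left ℂ fun l => ?_
  rw [sl_inner, tens_apply, t_inner ht₂]; simp [inner_smul_right]

lemma slice_mem [TopologicalSpace.SeparableSpace H₁] (ht₁ : IsTensorEmbedding t₁)
    (ht₂ : IsTensorEmbedding t₂) {G : Set (T₁ →L[ℂ] T₂)} {G' : Set (T₁ →L[ℂ] T₂)}
    (A : H₁ →L[ℂ] H₂) (x y)
    (hG : ∀ W ∈ G, ∃ S R, W = tens ht₁ ht₂ S R ∧ tens ht₁ ht₂ A R ∈ bicl G')
    {T} (hT : T ∈ bicl G) : tens ht₁ ht₂ A (sl ht₁ ht₂ x y T) ∈ bicl G' := by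
  have h1 : sl ht₁ ht₂ x y T ∈ bicl {R | tens ht₁ ht₂ A R ∈ bicl G'} := by
    refine bicl_comp _ _ (fun X hX => ?_) hT
    obtain ⟨S, R, rfl, hR⟩ := hG X hX
    have := sl_tens ht₁ ht₂ x y S R
    rw [sl] at this; rw [this]
    exact Submodule.smul_mem _ _ (subset_bicl hR)
  rw [mem_bicl]
  intro ξ η hh
  obtain ⟨ξ', η', h⟩ := normality ht₁ ht₂ A ξ η
  rw [h]
  refine (mem_bicl.1 h1) ξ' η' fun R hR => ?_
  rw [← h]
  exact (mem_bicl.1 hR) ξ η hh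

end P4
end OS

namespace OS
open ContinuousLinearMap Filter Topology
set_option linter.unusedSectionVars false
set_option linter.unusedVariables false
set_option linter.style.haveILetI false
section P5
variable {H H₁ H₂ : Type*}
    [NormedAddCommGroup H] [InnerProductSpace ℂ H] [CompleteSpace H]
    [NormedAddCommGroup H₁] [InnerProductSpace ℂ H₁] [CompleteSpace H₁]
    [NormedAddCommGroup H₂] [InnerProductSpace ℂ H₂] [CompleteSpace H₂]

/-- projection onto the closure -/
def pr (V : Submodule ℂ H) : H →L[ℂ] H := V.topologicalClosure.starProjection

lemma pr_mem (V : Submodule ℂ H) (x : H) : pr V x ∈ V.topologicalClosure :=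
  Submodule.starProjection_apply_mem _ _

lemma pr_of_mem {V : Submodule ℂ H} {x : H} (h : x ∈ V.topologicalClosure) : pr V x = x :=
  Submodule.starProjection_eq_self_iff.2 h

lemma pr_of_mem' {V : Submodule ℂ H} {x : H} (h : x ∈ V) : pr V x = x :=
  pr_of_mem (Submodule.le_topologicalClosure _ h)

lemma isProj_pr (V : Submodule ℂ H) : IsProj (pr V) :=
  ⟨Submodule.isIdempotentElem_starProjection _, isSelfAdjoint_starProjection _⟩

lemma sa_inner {p : H →L[ℂ] H} (hp : IsSelfAdjoint p) (x y : H) : ⟪p x, y⟫ = ⟪x, p y⟫ := by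
  rw [← adjoint_inner_right, isSelfAdjoint_iff'.1 hp]

lemma pr_zero {V : Submodule ℂ H} {x : H} (h : ∀ v ∈ V, ⟪v, x⟫ = 0) : pr V x = 0 := by
  rw [pr, Submodule.starProjection_apply_eq_zero_iff, Submodule.orthogonal_closure]
  exact (Submodule.mem_orthogonal _ _).2 h

lemma _root_.OpSynth.IsProj.idem {p : H →L[ℂ] H} (hp : IsProj p) (x : H) : p (p x) = p x :=
  congrArg (fun q : H →L[ℂ] H => q x) hp.1

lemma _root_.OpSynth.IsProj.norm_le {p : H →L[ℂ] H} (hp : IsProj p) (x : H) : ‖p x‖ ≤ ‖x‖ := by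
  have h1 : ((‖p x‖ ^ 2 : ℝ) : ℂ) = ⟪x, p x⟫ := by
    push_cast
    refine (inner_self_eq_norm_sq_to_K (𝕜 := ℂ) (p x)).symm.trans ?_
    rw [sa_inner hp.2, hp.idem]
  have h2 : ‖p x‖ ^ 2 ≤ ‖x‖ * ‖p x‖ := by
    have := norm_inner_le_norm (𝕜 := ℂ) x (p x)
    rw [← h1, Complex.norm_real, Real.norm_of_nonneg (by positivity)] at this
    exact this
  by_contra h; push Not at h
  nlinarith [norm_nonneg x, norm_nonneg (p x)]

lemma _root_.OpSynth.IsProj.compl {p : H →L[ℂ] H} (hp : IsProj p) : IsProj (1 - p) := by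
  refine ⟨?_, (IsSelfAdjoint.one _).sub hp.2⟩
  ext x; simp [hp.idem]

lemma isProj_one : IsProj (1 : H →L[ℂ] H) := ⟨rfl, IsSelfAdjoint.one _⟩

lemma _root_.OpSynth.IsProj.comp {p q : H →L[ℂ] H} (hp : IsProj p) (hq : IsProj q) (h : p ∘L q = q ∘L p) :
    IsProj (p ∘L q) := by
  refine ⟨?_, ?_⟩
  · rw [← comp_assoc, comp_assoc p q p, ← h, ← comp_assoc, hp.1, comp_assoc, hq.1]
  · rw [isSelfAdjoint_iff', adjoint_comp, isSelfAdjoint_iff'.1 hp.2, isSelfAdjoint_iff'.1 hq.2, h]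

lemma cl_map (m : H₁ →L[ℂ] H₂) {V : Submodule ℂ H₁} {W : Submodule ℂ H₂}
    (h : ∀ v ∈ V, m v ∈ W.topologicalClosure) {v} (hv : v ∈ V.topologicalClosure) :
    m v ∈ W.topologicalClosure := by
  have : V.topologicalClosure ≤ W.topologicalClosure.comap m.toLinearMap :=
    Submodule.topologicalClosure_minimal _ h
      (IsClosed.preimage m.continuous (Submodule.isClosed_topologicalClosure _))
  exact this hv

lemma pr_intertwine (m : H₁ →L[ℂ] H₂) (V : Submodule ℂ H₁) (W : Submodule ℂ H₂)
    (h : ∀ v ∈ V, m v ∈ W.topologicalClosure)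
    (h' : ∀ w ∈ W, adjoint m w ∈ V.topologicalClosure) : pr W ∘L m = m ∘L pr V := by
  ext x
  have e : x = pr V x + (x - pr V x) := by abel
  show pr W (m x) = m (pr V x)
  conv_lhs => rw [e]
  rw [map_add, map_add, pr_of_mem (cl_map m h (pr_mem V x)), pr_zero (x := m (x - pr V x)), add_zero]
  intro w hw
  rw [← adjoint_inner_left, ← pr_of_mem (h' w hw), sa_inner (isProj_pr V).2, map_sub,
    (isProj_pr V).idem, sub_self, inner_zero_right]

lemma masa_comm {D : StarSubalgebra ℂ (H →L[ℂ] H)} (hD : IsMasa D) {A : H →L[ℂ] H}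
    (h : ∀ d ∈ D, A * d = d * A) : A ∈ D := by
  have sa : ∀ A : H →L[ℂ] H, IsSelfAdjoint A → (∀ d ∈ D, A * d = d * A) → A ∈ D := by
    intro A hA h
    have hc : ∀ a ∈ insert A (D : Set (H →L[ℂ] H)), ∀ b ∈ insert A (D : Set (H →L[ℂ] H)),
        a * b = b * a := by
      rintro a (rfl | ha) b (rfl | hb)
      · rfl
      · exact h b hb
      · exact (h a ha).symm
      · exact hD.1 a ha b hb
    have hc2 : ∀ a ∈ insert A (D : Set (H →L[ℂ] H)), ∀ b ∈ insert A (D : Set (H →L[ℂ] H)),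
        a * star b = star b * a := by
      intro a ha b hb
      refine hc a ha _ ?_
      rcases hb with rfl | hb
      · rw [hA.star_eq]; exact mem_insert _ _
      · exact Or.inr (star_mem (S := StarSubalgebra ℂ (H →L[ℂ] H)) hb)
    have key := hD.2 (StarAlgebra.adjoin ℂ (insert A (D : Set (H →L[ℂ] H)))) ?_ ?_
    · rw [← key]; exact StarAlgebra.subset_adjoin _ _ (mem_insert _ _)
    · intro a ha b hb
      haveI := StarAlgebra.isMulCommutative_adjoin ℂ hc hc2
      exact congrArg Subtype.val (mul_comm' (⟨a, ha⟩ : StarAlgebra.adjoin ℂ _) ⟨b, hb⟩)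
    · intro d hd
      exact StarAlgebra.subset_adjoin _ _ (mem_insert_of_mem _ hd)
  have hs : ∀ d ∈ D, star A * d = d * star A := by
    intro d hd
    have := congrArg star (h (star d) (star_mem hd))
    simpa using this.symm
  have h1 : (1 / 2 : ℂ) • (A + star A) ∈ D := by
    refine D.smul_mem (sa _ (IsSelfAdjoint.add_star_self A) fun d hd => ?_) _
    rw [add_mul, mul_add, h d hd, hs d hd]
  have h2 : Complex.I • (A - star A) ∈ D := by
    refine sa _ ?_ fun d hd => ?_
    · rw [IsSelfAdjoint, star_smul, star_sub, star_star]
      simp only [Complex.star_def, Complex.conj_I]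
      rw [neg_smul, ← smul_neg, neg_sub]
    · rw [smul_mul_assoc, mul_smul_comm, sub_mul, mul_sub, h d hd, hs d hd]
  have h3 : A = (1 / 2 : ℂ) • (A + star A) + (-Complex.I / 2) • (Complex.I • (A - star A)) := by
    rw [smul_smul, show -Complex.I / 2 * Complex.I = (1 / 2 : ℂ) by
      rw [div_mul_eq_mul_div, neg_mul, Complex.I_mul_I, neg_neg], ← smul_add, add_add_sub_cancel,
      ← two_smul ℂ A, smul_smul]
    norm_num
  rw [h3]
  exact add_mem h1 (D.smul_mem h2 _)

lemma adj_mem {D : StarSubalgebra ℂ (H →L[ℂ] H)} {d} (hd : d ∈ D) : adjoint d ∈ D := star_mem hd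

lemma pr_mem_masa {D : StarSubalgebra ℂ (H →L[ℂ] H)} (hD : IsMasa D) {V : Submodule ℂ H}
    (h : ∀ d ∈ D, ∀ v ∈ V, d v ∈ V.topologicalClosure) : pr V ∈ D :=
  masa_comm hD fun d hd => pr_intertwine d V V (h d hd) (h _ (adj_mem hd))

/-! binary spectral lemma -/

lemma cfc_intertwine (m : H₁ →L[ℂ] H₂) {c : H₁ →L[ℂ] H₁} {d : H₂ →L[ℂ] H₂} (hc : IsSelfAdjoint c)
    (hd : IsSelfAdjoint d) (h : d ∘L m = m ∘L c) (f : ℝ → ℝ) (hf : Continuous f) :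
    cfc f d ∘L m = m ∘L cfc f c := by
  obtain ⟨R, hR⟩ : ∃ R, R = ‖c‖ + ‖d‖ := ⟨_, rfl⟩
  set s : Set ℝ := Icc (-R) R
  have hs1 : spectrum ℝ c ⊆ s := fun x hx => by
    have := spectrum.norm_le_norm_mul_of_mem hx
    have h1 : ‖(1 : H₁ →L[ℂ] H₁)‖ ≤ 1 := norm_id_le
    have h2 : |x| ≤ R := by
      rw [← Real.norm_eq_abs]; nlinarith [norm_nonneg c, norm_nonneg d]
    exact abs_le.1 h2
  have hs2 : spectrum ℝ d ⊆ s := fun x hx => by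
    have := spectrum.norm_le_norm_mul_of_mem hx
    have h1 : ‖(1 : H₂ →L[ℂ] H₂)‖ ≤ 1 := norm_id_le
    have h2 : |x| ≤ R := by
      rw [← Real.norm_eq_abs]; nlinarith [norm_nonneg c, norm_nonneg d]
    exact abs_le.1 h2
  let φ := cfcHomSuperset hc hs1
  let ψ := cfcHomSuperset hd hs2
  have key : ∀ g : C(s, ℝ), ψ g ∘L m = m ∘L φ g := by
    let S : Subalgebra ℝ C(s, ℝ) :=
      { carrier := {g | ψ g ∘L m = m ∘L φ g}
        mul_mem' := fun {a b} ha hb => by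
          simp only [mem_ofPred_eq, map_mul] at *
          show (ψ a ∘L ψ b) ∘L m = m ∘L (φ a ∘L φ b)
          rw [comp_assoc, hb, ← comp_assoc, ha, comp_assoc]
        add_mem' := fun {a b} ha hb => by
          simp only [mem_ofPred_eq, map_add] at *
          rw [add_comp, comp_add, ha, hb]
        algebraMap_mem' := fun r => by
          simp only [mem_ofPred_eq, AlgHomClass.commutes]
          ext x; simp [Algebra.algebraMap_eq_smul_one] }
    have hS : IsClosed (S : Set C(s, ℝ)) := by
      refine isClosed_eq ?_ ?_
      · exact ((compL ℂ H₁ H₂ H₂).flip m).continuous.comp (cfcHomSuperset_continuous hd hs2)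
      · exact ((compL ℂ H₁ H₁ H₂) m).continuous.comp (cfcHomSuperset_continuous hc hs1)
    have hle : polynomialFunctions s ≤ S := by
      rw [polynomialFunctions.eq_adjoin_X]
      refine Algebra.adjoin_le ?_
      rintro _ rfl
      have e : Polynomial.toContinuousMapOnAlgHom s Polynomial.X =
          (ContinuousMap.restrict s (ContinuousMap.id ℝ)) := by
        ext x; simp
      show ψ _ ∘L m = m ∘L φ _
      rw [e]
      show cfcHomSuperset hd hs2 _ ∘L m = m ∘L cfcHomSuperset hc hs1 _
      rw [cfcHomSuperset_id, cfcHomSuperset_id, h]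
    have := (polynomialFunctions s).topologicalClosure_minimal hle hS
    rw [polynomialFunctions_closure_eq_top] at this
    exact fun g => this (Algebra.mem_top (x := g))
  have e1 : φ ⟨fun x => f x, by fun_prop⟩ = cfc f c := by
    rw [cfc_apply f c hc (hf.continuousOn)]
    rfl
  have e2 : ψ ⟨fun x => f x, by fun_prop⟩ = cfc f d := by
    rw [cfc_apply f d hd (hf.continuousOn)]
    rfl
  rw [← e1, ← e2]
  exact key _

/-- positive spectral projection -/
def sp (c : H →L[ℂ] H) : H →L[ℂ] H := pr (LinearMap.range (cfc (fun x : ℝ => max x 0) c).toLinearMap)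

lemma sp_intertwine (m : H₁ →L[ℂ] H₂) {c : H₁ →L[ℂ] H₁} {d : H₂ →L[ℂ] H₂} (hc : IsSelfAdjoint c)
    (hd : IsSelfAdjoint d) (h : d ∘L m = m ∘L c) : sp d ∘L m = m ∘L sp c := by
  have hf : Continuous (fun x : ℝ => max x 0) := by fun_prop
  refine pr_intertwine _ _ _ ?_ ?_
  · rintro _ ⟨x, rfl⟩
    refine Submodule.le_topologicalClosure _ ⟨m x, ?_⟩
    exact congrArg (fun q : H₁ →L[ℂ] H₂ => q x) (cfc_intertwine m hc hd h _ hf)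
  · rintro _ ⟨x, rfl⟩
    refine Submodule.le_topologicalClosure _ ⟨adjoint m x, ?_⟩
    have h2 : c ∘L adjoint m = adjoint m ∘L d := by
      have := congrArg adjoint h
      rw [adjoint_comp, adjoint_comp, isSelfAdjoint_iff'.1 hc, isSelfAdjoint_iff'.1 hd] at this
      exact this.symm
    exact congrArg (fun q : H₂ →L[ℂ] H₁ => q x) (cfc_intertwine (adjoint m) hd hc h2 _ hf)

lemma sp_masa {D : StarSubalgebra ℂ (H →L[ℂ] H)} (hD : IsMasa D) {c} (hc : IsSelfAdjoint c)
    (hcD : c ∈ D) : sp c ∈ D :=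
  masa_comm hD fun d hd => sp_intertwine d hc hc (hD.1 c hcD d hd)

lemma sp_norm {c : H →L[ℂ] H} (hc : IsSelfAdjoint c) (h1 : ‖c‖ ≤ 1) :
    ‖(2 : ℂ) • c - ((2 : ℂ) • sp c - 1)‖ ≤ 1 := by
  have hp : Continuous (fun x : ℝ => max x 0) := by fun_prop
  set a := cfc (fun x : ℝ => max x 0) c with ha
  set b := cfc (fun x : ℝ => max (-x) 0) c with hb
  have e1 : c = a - b := by
    rw [ha, hb, ← cfc_sub ..]
    conv_lhs => rw [← cfc_id ℝ c]
    congr 1; ext x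
    rcases le_total x 0 with h | h
    · simp [h]
    · simp [h]
  have hab : b ∘L a = 0 := by
    show b * a = 0
    rw [ha, hb, ← cfc_mul ..]
    rw [show (fun x : ℝ => max (-x) 0 * max x 0) = fun _ => 0 by
      ext x; rcases le_total x 0 with h | h <;> simp [h], cfc_const_zero ℝ c]
  have hEa : sp c ∘L a = a := by
    ext x; exact pr_of_mem' ⟨x, rfl⟩
  have hEb : sp c ∘L b = 0 := by
    ext x
    refine pr_zero ?_
    rintro _ ⟨y, rfl⟩
    have hbs : IsSelfAdjoint b := cfc_predicate _ _
    show ⟪a y, b x⟫ = 0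
    rw [← sa_inner hbs, show b (a y) = 0 from congrArg (fun q : H →L[ℂ] H => q y) hab]
    simp
  set g := cfc (fun x : ℝ => 2 * |x| - 1) c with hg
  have e2 : g = (2 : ℂ) • (a + b) - 1 := by
    have e3 : (1 : H →L[ℂ] H) = cfc (fun _ : ℝ => (1 : ℝ)) c := (cfc_const_one ℝ c).symm
    have e4 : (2 : ℂ) • (a + b) = (a + b) + (a + b) := two_smul _ _
    rw [e4, e3, ha, hb, hg, ← cfc_add .., ← cfc_add .., ← cfc_sub ..]
    congr 1; ext x
    rcases le_total x 0 with h | h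
    · simp [h, abs_of_nonpos h]; ring
    · simp [h, abs_of_nonneg h]; ring
  have hgn : ‖g‖ ≤ 1 := by
    refine norm_cfc_le (by norm_num) fun x hx => ?_
    have := spectrum.norm_le_norm_mul_of_mem hx
    have h1' : ‖(1 : H →L[ℂ] H)‖ ≤ 1 := norm_id_le
    have h2 : |x| ≤ 1 := by
      rw [← Real.norm_eq_abs]; nlinarith [norm_nonneg c, norm_nonneg (1 : H →L[ℂ] H)]
    rw [Real.norm_eq_abs, abs_le]
    constructor <;> linarith [abs_nonneg x]
  have hE := isProj_pr (LinearMap.range a.toLinearMap)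
  have e5 : (2 : ℂ) • c - ((2 : ℂ) • sp c - 1) = ((2 : ℂ) • sp c - 1) ∘L g := by
    rw [e2]
    ext x
    have q1 : sp c (a x) = a x := congrArg (fun q : H →L[ℂ] H => q x) hEa
    have q2 : sp c (b x) = 0 := congrArg (fun q : H →L[ℂ] H => q x) hEb
    have q3 : c x = a x - b x := congrArg (fun q : H →L[ℂ] H => q x) e1
    simp only [sub_apply, smul_apply, comp_apply, add_apply, map_sub, map_smul, map_add, q1, q2,
      show ∀ x, (1 : H →L[ℂ] H) x = x from fun _ => rfl, q3]
    module
  rw [e5]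
  have hsn : ‖(2 : ℂ) • sp c - 1‖ ≤ 1 := by
    refine opNorm_le_bound _ (by norm_num) fun x => ?_
    rw [one_mul]
    have hE' : IsProj (sp c) := hE
    have : ((‖((2 : ℂ) • sp c - 1) x‖ ^ 2 : ℝ) : ℂ) = ((‖x‖ ^ 2 : ℝ) : ℂ) := by
      push_cast
      refine (inner_self_eq_norm_sq_to_K (𝕜 := ℂ) (((2 : ℂ) • sp c - 1) x)).symm.trans ?_
      refine Eq.trans ?_ (inner_self_eq_norm_sq_to_K (𝕜 := ℂ) x)
      simp only [sub_apply, smul_apply, show (1 : H →L[ℂ] H) x = x from rfl, inner_sub_left, inner_sub_right,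
        inner_smul_left, inner_smul_right, sa_inner hE'.2, hE'.idem]
      simp only [map_ofNat]; ring
    have := Complex.ofReal_injective this
    exact le_of_eq ((sq_eq_sq₀ (norm_nonneg _) (norm_nonneg _)).1 this)
  calc _ ≤ _ := opNorm_comp_le _ _
    _ ≤ 1 * 1 := by gcongr
    _ = 1 := by norm_num

end P5
end OS

namespace OS
open ContinuousLinearMap Filter Topology
set_option linter.unusedSectionVars false
set_option linter.unusedVariables false
set_option linter.style.haveILetI false
section P6
variable {H H₁ H₂ : Type*}
    [NormedAddCommGroup H] [InnerProductSpace ℂ H] [CompleteSpace H]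
    [NormedAddCommGroup H₁] [InnerProductSpace ℂ H₁] [CompleteSpace H₁]
    [NormedAddCommGroup H₂] [InnerProductSpace ℂ H₂] [CompleteSpace H₂]
    {D₁ : StarSubalgebra ℂ (H₁ →L[ℂ] H₁)} {D₂ : StarSubalgebra ℂ (H₂ →L[ℂ] H₂)}

/-- pair of projections in the masas -/
def PP (D₁ : StarSubalgebra ℂ (H₁ →L[ℂ] H₁)) (D₂ : StarSubalgebra ℂ (H₂ →L[ℂ] H₂)) :
    Set ((H₁ →L[ℂ] H₁) × (H₂ →L[ℂ] H₂)) :=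
  {p | p.1 ∈ D₁ ∧ p.2 ∈ D₂ ∧ IsProj p.1 ∧ IsProj p.2}

/-- operators intertwining all pairs -/
def Itw (Λ : Set ((H₁ →L[ℂ] H₁) × (H₂ →L[ℂ] H₂))) : Set (H₁ →L[ℂ] H₂) :=
  {X | ∀ p ∈ Λ, p.2 ∘L X = X ∘L p.1}

/-- pairs intertwined by all of `M` -/
def LM (D₁ : StarSubalgebra ℂ (H₁ →L[ℂ] H₁)) (D₂ : StarSubalgebra ℂ (H₂ →L[ℂ] H₂))
    (M : Set (H₁ →L[ℂ] H₂)) : Set ((H₁ →L[ℂ] H₁) × (H₂ →L[ℂ] H₂)) :=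
  {p | p ∈ PP D₁ D₂ ∧ ∀ X ∈ M, p.2 ∘L X = X ∘L p.1}

lemma bin_iter (hD₁ : IsMasa D₁) (hD₂ : IsMasa D₂) {M : Set (H₁ →L[ℂ] H₂)} {X : H₁ →L[ℂ] H₂}
    (hX : X ∈ Itw (LM D₁ D₂ M)) (n : ℕ) : ∀ c d, IsSelfAdjoint c → IsSelfAdjoint d → ‖c‖ ≤ 1 →
    ‖d‖ ≤ 1 → c ∈ D₁ → d ∈ D₂ → (∀ m ∈ M, d ∘L m = m ∘L c) →
    ‖d ∘L X - X ∘L c‖ ≤ 2 * ‖X‖ / 2 ^ n := by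
  induction n with
  | zero =>
    intro c d _ _ hc hd _ _ _
    calc ‖d ∘L X - X ∘L c‖ ≤ ‖d ∘L X‖ + ‖X ∘L c‖ := norm_sub_le _ _
      _ ≤ ‖d‖ * ‖X‖ + ‖X‖ * ‖c‖ := by gcongr <;> exact opNorm_comp_le _ _
      _ ≤ 1 * ‖X‖ + ‖X‖ * 1 := by gcongr
      _ = _ := by ring
  | succ n ih =>
    intro c d hc hd hc1 hd1 hcD hdD h
    set s := (2 : ℂ) • sp c - 1 with hs
    set s' := (2 : ℂ) • sp d - 1 with hs'
    have spX : sp d ∘L X = X ∘L sp c :=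
      hX (sp c, sp d) ⟨⟨sp_masa hD₁ hc hcD, sp_masa hD₂ hd hdD, isProj_pr _, isProj_pr _⟩,
        fun m hm => sp_intertwine m hc hd (h m hm)⟩
    have two_sa2 : ∀ a : H₂ →L[ℂ] H₂, IsSelfAdjoint a → IsSelfAdjoint ((2 : ℂ) • a) :=
      fun a ha => IsSelfAdjoint.smul (by simp [IsSelfAdjoint]) ha
    have two_sa1 : ∀ a : H₁ →L[ℂ] H₁, IsSelfAdjoint a → IsSelfAdjoint ((2 : ℂ) • a) :=
      fun a ha => IsSelfAdjoint.smul (by simp [IsSelfAdjoint]) ha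
    have := ih ((2 : ℂ) • c - s) ((2 : ℂ) • d - s')
      ((two_sa1 _ hc).sub ((two_sa1 _ (isProj_pr _).2).sub (IsSelfAdjoint.one _)))
      ((two_sa2 _ hd).sub ((two_sa2 _ (isProj_pr _).2).sub (IsSelfAdjoint.one _)))
      (sp_norm hc hc1) (sp_norm hd hd1)
      (sub_mem (D₁.smul_mem hcD _) (sub_mem (D₁.smul_mem (sp_masa hD₁ hc hcD) _) (one_mem _)))
      (sub_mem (D₂.smul_mem hdD _) (sub_mem (D₂.smul_mem (sp_masa hD₂ hd hdD) _) (one_mem _)))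
      (fun m hm => by
        have h1 := sp_intertwine m hc hd (h m hm)
        have h2 := h m hm
        ext x
        have h1' : sp d (m x) = m (sp c x) := congrArg (fun q : H₁ →L[ℂ] H₂ => q x) h1
        have h2' : d (m x) = m (c x) := congrArg (fun q : H₁ →L[ℂ] H₂ => q x) h2
        simp [hs, hs', h1', h2'])
    have e : ((2 : ℂ) • d - s') ∘L X - X ∘L ((2 : ℂ) • c - s) = (2 : ℂ) • (d ∘L X - X ∘L c) := by
      ext x
      have h1' : sp d (X x) = X (sp c x) := congrArg (fun q : H₁ →L[ℂ] H₂ => q x) spX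
      simp [hs, hs', h1']
      module
    rw [e, norm_smul] at this
    have h2 : ‖(2 : ℂ)‖ = 2 := by simp
    rw [h2] at this
    rw [pow_succ, ← div_div, le_div_iff₀ (by norm_num)]
    linarith

lemma bin_sa (hD₁ : IsMasa D₁) (hD₂ : IsMasa D₂) {M : Set (H₁ →L[ℂ] H₂)} {X : H₁ →L[ℂ] H₂}
    (hX : X ∈ Itw (LM D₁ D₂ M)) {a b} (ha : IsSelfAdjoint a) (hb : IsSelfAdjoint b)
    (haD : a ∈ D₁) (hbD : b ∈ D₂) (h : ∀ m ∈ M, b ∘L m = m ∘L a) : b ∘L X = X ∘L a := by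
  obtain ⟨R, hR⟩ : ∃ R : ℝ, R = ‖a‖ + ‖b‖ + 1 := ⟨_, rfl⟩
  have hR0 : 0 < R := by rw [hR]; positivity
  have hRn : ‖((R⁻¹ : ℝ) : ℂ)‖ = R⁻¹ := by simp [hR0.le]
  have hsa : IsSelfAdjoint ((R⁻¹ : ℝ) : ℂ) := Complex.conj_ofReal _
  have key : ‖(((R⁻¹ : ℝ) : ℂ) • b) ∘L X - X ∘L (((R⁻¹ : ℝ) : ℂ) • a)‖ ≤ 0 := by
    have h1 : ∀ n : ℕ, ‖(((R⁻¹ : ℝ) : ℂ) • b) ∘L X - X ∘L (((R⁻¹ : ℝ) : ℂ) • a)‖ ≤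
        2 * ‖X‖ / 2 ^ n := fun n => by
      refine bin_iter hD₁ hD₂ hX n _ _ (hsa.smul ha) (hsa.smul hb) ?_ ?_
        (D₁.smul_mem haD _) (D₂.smul_mem hbD _) fun m hm => ?_
      · rw [norm_smul, hRn, inv_mul_le_iff₀ hR0, hR]; linarith [norm_nonneg b]
      · rw [norm_smul, hRn, inv_mul_le_iff₀ hR0, hR]; linarith [norm_nonneg a]
      · rw [smul_comp, comp_smul, h m hm]
    have h2 : Tendsto (fun n : ℕ => 2 * ‖X‖ / 2 ^ n) atTop (𝓝 0) := by
      refine Tendsto.div_atTop tendsto_const_nhds (tendsto_pow_atTop_atTop_of_one_lt (by norm_num))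
    exact ge_of_tendsto h2 (Eventually.of_forall h1)
  rw [smul_comp, comp_smul, ← smul_sub, norm_smul, hRn] at key
  have h3 : ‖b ∘L X - X ∘L a‖ ≤ 0 := by
    by_contra hh; push Not at hh
    have : 0 < R⁻¹ * ‖b ∘L X - X ∘L a‖ := by positivity
    linarith
  exact sub_eq_zero.1 (norm_le_zero_iff.1 h3)

lemma bin_gen (hD₁ : IsMasa D₁) (hD₂ : IsMasa D₂) {M : Set (H₁ →L[ℂ] H₂)} {X : H₁ →L[ℂ] H₂}
    (hX : X ∈ Itw (LM D₁ D₂ M)) {a b} (haD : a ∈ D₁) (hbD : b ∈ D₂)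
    (h : ∀ m ∈ M, b ∘L m = m ∘L a) (h' : ∀ m ∈ M, star b ∘L m = m ∘L star a) :
    b ∘L X = X ∘L a := by
  have e1 := bin_sa hD₁ hD₂ hX (IsSelfAdjoint.add_star_self a) (IsSelfAdjoint.add_star_self b)
    (add_mem haD (star_mem haD)) (add_mem hbD (star_mem hbD))
    (fun m hm => by rw [add_comp, comp_add, h m hm, h' m hm])
  have Isa : ∀ A : H₁ →L[ℂ] H₁, IsSelfAdjoint (Complex.I • (A - star A)) := by
    intro A
    rw [IsSelfAdjoint, star_smul, star_sub, star_star]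
    simp only [Complex.star_def, Complex.conj_I]
    rw [neg_smul, ← smul_neg, neg_sub]
  have Isa2 : ∀ A : H₂ →L[ℂ] H₂, IsSelfAdjoint (Complex.I • (A - star A)) := by
    intro A
    rw [IsSelfAdjoint, star_smul, star_sub, star_star]
    simp only [Complex.star_def, Complex.conj_I]
    rw [neg_smul, ← smul_neg, neg_sub]
  have e2 := bin_sa hD₁ hD₂ hX (Isa a) (Isa2 b)
    (D₁.smul_mem (sub_mem haD (star_mem haD)) _) (D₂.smul_mem (sub_mem hbD (star_mem hbD)) _)
    (fun m hm => by rw [smul_comp, comp_smul, sub_comp, comp_sub, h m hm, h' m hm])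
  rw [smul_comp, comp_smul] at e2
  have e3 := smul_right_injective _ Complex.I_ne_zero e2
  rw [sub_comp, comp_sub] at e3
  rw [add_comp, comp_add] at e1
  have : (2 : ℂ) • (b ∘L X) = (2 : ℂ) • (X ∘L a) := by
    rw [two_smul, two_smul]
    calc b ∘L X + b ∘L X = (b ∘L X + star b ∘L X) + (b ∘L X - star b ∘L X) := by abel
      _ = (X ∘L a + X ∘L star a) + (X ∘L a - X ∘L star a) := by rw [e1, e3]
      _ = _ := by abel
  exact smul_right_injective _ (two_ne_zero) this

lemma norm_sg (j : ℕ) (x : H) : ‖(lp.single 2 j x : L2 H)‖ = ‖x‖ :=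
  lp.norm_single (E := fun _ : ℕ => H) (p := 2) (by norm_num) j x

lemma sg_add (j : ℕ) (x y : H) :
    (lp.single 2 j (x + y) : L2 H) = lp.single 2 j x + lp.single 2 j y :=
  map_add (lp.lsingle (𝕜 := ℂ) (E := fun _ : ℕ => H) 2 j) x y

lemma sg_smul (j : ℕ) (c : ℂ) (x : H) :
    (lp.single 2 j (c • x) : L2 H) = c • lp.single 2 j x :=
  map_smul (lp.lsingle (𝕜 := ℂ) (E := fun _ : ℕ => H) 2 j) c x

/-- coordinate embedding -/
def io (j : ℕ) : H →L[ℂ] L2 H := LinearMap.mkContinuous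
  { toFun := fun x => lp.single 2 j x
    map_add' := sg_add j
    map_smul' := sg_smul j } 1 (fun x => by
  rw [one_mul]; exact le_of_eq (norm_sg j x))

lemma io_apply (j : ℕ) (x : H) : io j x = lp.single 2 j x := rfl

/-- evaluation -/
def ev (j : ℕ) : L2 H →L[ℂ] H := lp.evalCLM ℂ (fun _ : ℕ => H) 2 j

lemma amp_io (X : H₁ →L[ℂ] H₂) (j : ℕ) (x : H₁) : amp X (io j x) = io j (X x) := by
  refine L2ext fun n => ?_
  rw [amp_apply, io_apply, io_apply, lp.single_apply, lp.single_apply]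
  rcases eq_or_ne n j with rfl | h
  · simp
  · simp [h]

lemma ev_io_inner (j : ℕ) (ξ : L2 H) (x : H) : ⟪x, ev j ξ⟫ = ⟪io j x, ξ⟫ := by
  rw [io_apply, lp.inner_single_left]; rfl

lemma ev_adj (j : ℕ) : adjoint (ev j : L2 H →L[ℂ] H) = io j := by
  ext1 x
  refine ext_inner_right ℂ fun ξ => ?_
  rw [adjoint_inner_left, ev_io_inner]

lemma io_adj (j : ℕ) : adjoint (io j : H →L[ℂ] L2 H) = ev j := by
  rw [← ev_adj, adjoint_adjoint]

lemma M_structure (hD₁ : IsMasa D₁) (hD₂ : IsMasa D₂) {M : Set (H₁ →L[ℂ] H₂)}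
    (hM : IsMasaBimodule D₁ D₂ M) (hT : IsTernary M) : Itw (LM D₁ D₂ M) ⊆ M := by
  intro X hX
  refine bicl_closed hM.1 ?_
  rw [mem_bicl]
  intro ξ η hω
  have hMl : ∀ m ∈ M, ∀ b ∈ D₂, b ∘L m ∈ M := fun m hm b hb => hM.2 m hm 1 (one_mem _) b hb
  have hMr : ∀ m ∈ M, ∀ a ∈ D₁, m ∘L a ∈ M := fun m hm a ha => hM.2 m hm a ha 1 (one_mem _)
  let V₂ : Submodule ℂ (L2 H₂) := Submodule.span ℂ {z | ∃ m ∈ M, z = amp m ξ}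
  let V₁ : Submodule ℂ (L2 H₁) := Submodule.span ℂ
    ({z | ∃ m ∈ M, ∃ m' ∈ M, z = amp (adjoint m ∘L m') ξ} ∪ {z | ∃ d ∈ D₁, z = amp d ξ})
  have hm12 : ∀ m ∈ M, ∀ v ∈ V₁, amp m v ∈ V₂.topologicalClosure := by
    intro m hm v hv
    refine cl_map (V := V₁) (amp m) (fun v hv => ?_) (Submodule.le_topologicalClosure _ hv)
    refine Submodule.le_topologicalClosure _ ?_
    have : V₁ ≤ V₂.comap (amp m).toLinearMap := by
      refine Submodule.span_le.2 ?_
      rintro _ (⟨m1, h1, m2, h2, rfl⟩ | ⟨d, hd, rfl⟩)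
      · exact Submodule.subset_span ⟨_, hT m hm m1 h1 m2 h2, rfl⟩
      · exact Submodule.subset_span ⟨_, hMr m hm d hd, rfl⟩
    exact this hv
  have amp_adj : ∀ m : H₁ →L[ℂ] H₂, adjoint (amp m) = amp (adjoint m) := by
    intro m
    ext1 z
    refine ext_inner_right ℂ fun w => ?_
    rw [adjoint_inner_left, inner_amp]
  have amp_adj1 : ∀ m : H₁ →L[ℂ] H₁, adjoint (amp m) = amp (adjoint m) := by
    intro m
    ext1 z
    refine ext_inner_right ℂ fun w => ?_
    rw [adjoint_inner_left, inner_amp]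
  have amp_adj2 : ∀ m : H₂ →L[ℂ] H₂, adjoint (amp m) = amp (adjoint m) := by
    intro m
    ext1 z
    refine ext_inner_right ℂ fun w => ?_
    rw [adjoint_inner_left, inner_amp]
  have hm21 : ∀ m ∈ M, ∀ v ∈ V₂, adjoint (amp m) v ∈ V₁.topologicalClosure := by
    intro m hm v hv
    rw [amp_adj]
    refine Submodule.le_topologicalClosure _ ?_
    have : V₂ ≤ V₁.comap (amp (adjoint m)).toLinearMap := by
      refine Submodule.span_le.2 ?_
      rintro _ ⟨m1, h1, rfl⟩
      exact Submodule.subset_span (Or.inl ⟨m, hm, m1, h1, rfl⟩)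
    exact this hv
  have hd1 : ∀ d ∈ D₁, ∀ v ∈ V₁, amp d v ∈ V₁.topologicalClosure := by
    intro m hm v hv
    refine Submodule.le_topologicalClosure _ ?_
    have : V₁ ≤ V₁.comap (amp m).toLinearMap := by
      refine Submodule.span_le.2 ?_
      rintro _ (⟨m1, h1, m2, h2, rfl⟩ | ⟨d, hd, rfl⟩)
      · refine Submodule.subset_span (Or.inl ⟨m1 ∘L adjoint m, hMr _ h1 _ (adj_mem hm), m2, h2, ?_⟩)
        rw [adjoint_comp, adjoint_adjoint]; rfl
      · exact Submodule.subset_span (Or.inr ⟨m ∘L d, mul_mem hm hd, rfl⟩)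
    exact this hv
  have hd2 : ∀ d ∈ D₂, ∀ v ∈ V₂, amp d v ∈ V₂.topologicalClosure := by
    intro m hm v hv
    refine Submodule.le_topologicalClosure _ ?_
    have : V₂ ≤ V₂.comap (amp m).toLinearMap := by
      refine Submodule.span_le.2 ?_
      rintro _ ⟨m1, h1, rfl⟩
      exact Submodule.subset_span ⟨_, hMl m1 h1 m hm, rfl⟩
    exact this hv
  let p1 := pr V₁
  let p2 := pr V₂
  have q12 : ∀ m ∈ M, ∀ z, p2 (amp m z) = amp m (p1 z) := fun m hm z =>
    congrArg (fun q : L2 H₁ →L[ℂ] L2 H₂ => q z)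
      (pr_intertwine (amp m) V₁ V₂ (hm12 m hm) (hm21 m hm))
  have q1 : ∀ d ∈ D₁, ∀ z, p1 (amp d z) = amp d (p1 z) := fun d hd z =>
    congrArg (fun q : L2 H₁ →L[ℂ] L2 H₁ => q z)
      (pr_intertwine (amp d) V₁ V₁ (hd1 d hd) (by rw [amp_adj1]; exact hd1 _ (adj_mem hd)))
  have q2 : ∀ d ∈ D₂, ∀ z, p2 (amp d z) = amp d (p2 z) := fun d hd z =>
    congrArg (fun q : L2 H₂ →L[ℂ] L2 H₂ => q z)
      (pr_intertwine (amp d) V₂ V₂ (hd2 d hd) (by rw [amp_adj2]; exact hd2 _ (adj_mem hd)))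
  let a : ℕ → ℕ → H₁ →L[ℂ] H₁ := fun i j => ev i ∘L p1 ∘L io j
  let b : ℕ → ℕ → H₂ →L[ℂ] H₂ := fun i j => ev i ∘L p2 ∘L io j
  have ev_amp1 : ∀ i (d : H₁ →L[ℂ] H₁) z, ev i (amp d z) = d (ev i z) := fun i d z => rfl
  have haD : ∀ i j, a i j ∈ D₁ := fun i j => masa_comm hD₁ fun d hd => by
    ext x
    show ev i (p1 (io j (d x))) = d (ev i (p1 (io j x)))
    rw [← amp_io, q1 d hd]; rfl
  have hbD : ∀ i j, b i j ∈ D₂ := fun i j => masa_comm hD₂ fun d hd => by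
    ext x
    show ev i (p2 (io j (d x))) = d (ev i (p2 (io j x)))
    rw [← amp_io, q2 d hd]; rfl
  have hab : ∀ i j, ∀ m ∈ M, b i j ∘L m = m ∘L a i j := fun i j m hm => by
    ext x
    show ev i (p2 (io j (m x))) = m (ev i (p1 (io j x)))
    rw [← amp_io, q12 m hm]; rfl
  have has : ∀ i j, star (a i j) = a j i := fun i j => by
    show adjoint (ev i ∘L p1 ∘L io j) = _
    rw [adjoint_comp, adjoint_comp, ev_adj, io_adj, isSelfAdjoint_iff'.1 (isProj_pr V₁).2]; rfl
  have hbs : ∀ i j, star (b i j) = b j i := fun i j => by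
    show adjoint (ev i ∘L p2 ∘L io j) = _
    rw [adjoint_comp, adjoint_comp, ev_adj, io_adj, isSelfAdjoint_iff'.1 (isProj_pr V₂).2]; rfl
  have key : ∀ i j, b i j ∘L X = X ∘L a i j := fun i j =>
    bin_gen hD₁ hD₂ hX (haD i j) (hbD i j) (hab i j)
      (by rw [has, hbs]; exact hab j i)
  have fin : ∀ z, p2 (amp X z) = amp X (p1 z) := by
    intro z
    have hz := lp.hasSum_single (p := 2) (by norm_num) z
    have h1 := hz.mapL (p2 ∘L amp X)
    have h2 := hz.mapL (amp X ∘L p1)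
    have e : (fun b => (p2 ∘L amp X) (lp.single 2 b (z b))) =
      fun b => (amp X ∘L p1) (lp.single 2 b (z b)) := ?_
    · rw [e] at h1
      exact h1.unique h2
    ext1 j
    refine L2ext fun i => ?_
    have := congrArg (fun q : H₁ →L[ℂ] H₂ => q (z j)) (key i j)
    show ev i (p2 (amp X (io j (z j)))) = X (ev i (p1 (io j (z j))))
    rw [amp_io]
    exact this
  have hξ : ξ ∈ V₁ := Submodule.subset_span (Or.inr ⟨1, one_mem _, rfl⟩)
  have h1 : amp X ξ = p2 (amp X ξ) := by
    rw [fin, show p1 ξ = ξ from pr_of_mem' hξ]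
  rw [om_def, h1, ← sa_inner (isProj_pr V₂).2, show pr V₂ η = 0 from pr_zero ?_, inner_zero_left]
  intro v hv
  have : V₂ ≤ LinearMap.ker (innerSL ℂ η).toLinearMap := by
    refine Submodule.span_le.2 ?_
    rintro _ ⟨m, hm, rfl⟩
    exact hω m hm
  exact inner_eq_zero_symm.1 (this hv)

end P6
end OS

namespace OS
open ContinuousLinearMap Filter Topology
set_option linter.unusedSectionVars false
set_option linter.unusedVariables false
set_option linter.style.haveILetI false
section P7
variable {H : Type*}
    [NormedAddCommGroup H] [InnerProductSpace ℂ H] [CompleteSpace H]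
    {N : Set (Submodule ℂ H)}

/-- rank one operators in the nest algebra -/
def RN (N : Set (Submodule ℂ H)) : Set (H →L[ℂ] H) :=
  {X | X ∈ nestAlg N ∧ ∃ a b, X = InnerProductSpace.rankOne ℂ a b}

lemma mem_RN {a b : H} (h : ∀ Q ∈ N, a ∈ Q ∨ ∀ x ∈ Q, ⟪b, x⟫ = 0) :
    InnerProductSpace.rankOne ℂ a b ∈ RN N := by
  refine ⟨fun Q hQ x hx => ?_, a, b, rfl⟩
  rw [InnerProductSpace.rankOne_apply]
  rcases h Q hQ with h1 | h1
  · exact Q.smul_mem _ h1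
  · rw [h1 x hx, zero_smul]; exact Q.zero_mem

lemma cl_eq (hN : IsNest N) {L} (hL : L ∈ N) : L.topologicalClosure = L :=
  (hN.1 L hL).submodule_topologicalClosure_eq

lemma prN_mem (hN : IsNest N) {L} (hL : L ∈ N) (x : H) : pr L x ∈ L := by
  have := pr_mem L x
  rwa [cl_eq hN hL] at this

lemma pr_big (hN : IsNest N) {L L'} (hL : L ∈ N) (h : L ≤ L') (x : H) :
    pr L' (pr L x) = pr L x := pr_of_mem' (h (prN_mem hN hL x))

lemma pr_small (hN : IsNest N) {L L'} (hL : L ∈ N) (h : L ≤ L') (x : H) :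
    pr L (pr L' x) = pr L x := by
  refine ext_inner_right ℂ fun y => ?_
  rw [sa_inner (isProj_pr L).2, sa_inner (isProj_pr L').2, pr_big hN hL h,
    sa_inner (isProj_pr L).2]

lemma pr_orth {L : Submodule ℂ H} {x y : H} (hx : x ∈ L) (hy : pr L y = 0) : ⟪y, x⟫ = 0 := by
  rw [← pr_of_mem' hx, ← sa_inner (isProj_pr L).2, hy, inner_zero_left]

/-- interval projection -/
def iv (P R : Submodule ℂ H) : H →L[ℂ] H := pr R - pr P

lemma iv_apply (P R : Submodule ℂ H) (x : H) : iv P R x = pr R x - pr P x := rfl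

lemma iv_proj (hN : IsNest N) {P R} (hP : P ∈ N) (h : P ≤ R) : IsProj (iv P R) := by
  refine ⟨?_, (isProj_pr R).2.sub (isProj_pr P).2⟩
  ext x
  simp only [comp_apply, iv_apply, map_sub, (isProj_pr R).idem, (isProj_pr P).idem,
    pr_big hN hP h, pr_small hN hP h]
  abel

lemma iv_mul0 (hN : IsNest N) {P R S} (hP : P ∈ N) (hR : R ∈ N) (h : P ≤ R) (h' : R ≤ S) (x : H) :
    iv P R (iv R S x) = 0 := by
  simp only [iv_apply, map_sub, (isProj_pr R).idem, pr_small hN hP h, pr_small hN hP (h.trans h'),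
    pr_small hN hR h']
  abel

lemma iv_mul0' (hN : IsNest N) {P R S} (hP : P ∈ N) (hR : R ∈ N) (h : P ≤ R) (h' : R ≤ S) (x : H) :
    iv R S (iv P R x) = 0 := by
  simp only [iv_apply, map_sub, (isProj_pr R).idem, pr_big hN hP h, pr_big hN hP (h.trans h'),
    pr_big hN hR h']
  abel

lemma iv_add (P R S : Submodule ℂ H) (x : H) : iv P R x + iv R S x = iv P S x := by
  simp only [iv_apply]; abel

lemma iv_rank (hN : IsNest N) {P R S} (hP : P ∈ N) (hR : R ∈ N) (h : P ≤ R) (h' : R ≤ S) (e : H) :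
    InnerProductSpace.rankOne ℂ (iv P R e) (iv R S e) ∈ RN N := by
  refine mem_RN fun Q hQ => ?_
  rcases hN.2.1.total hQ hR with h1 | h1
  · right
    intro x hx
    refine pr_orth (h1 hx) ?_
    simp only [iv_apply, map_sub, (isProj_pr R).idem, pr_small hN hR h']
    abel
  · left
    exact h1 (R.sub_mem (prN_mem hN hR e) (h (prN_mem hN hP e)))

/-- good intervals -/
def Good (N : Set (Submodule ℂ H)) (ε : ℝ) (e : H) (P R : Submodule ℂ H) : Prop :=
  ∃ V ∈ Submodule.span ℂ (RN N), (∀ x, V x = iv P R (V (iv P R x))) ∧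
    (∀ x, ‖V x‖ ^ 2 ≤ 2 * (‖iv P R e‖ ^ 2) ^ 2 * ‖x‖ ^ 2) ∧
    (‖iv P R e‖ ^ 2) ^ 2 ≤ (⟪e, V e⟫).re + ε * ‖iv P R e‖ ^ 2

lemma good_small {ε : ℝ} {e : H} {P R : Submodule ℂ H} (h : ‖iv P R e‖ ^ 2 ≤ ε) :
    Good N ε e P R := by
  refine ⟨0, zero_mem _, by simp, fun x => by simp; positivity, ?_⟩
  simp only [zero_apply, inner_zero_right, Complex.zero_re, zero_add]
  rw [pow_two]
  gcongr

lemma good_atom (hN : IsNest N) {ε : ℝ} (hε : 0 ≤ ε) {e : H} {P R : Submodule ℂ H} (hP : P ∈ N)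
    (hR : R ∈ N) (hPR : P ≤ R)
    (h : ∀ Q ∈ N, Q ≤ P ∨ R ≤ Q) : Good N ε e P R := by
  have hg := iv_proj hN hP hPR
  refine ⟨InnerProductSpace.rankOne ℂ (iv P R e) (iv P R e), Submodule.subset_span ?_, ?_, ?_, ?_⟩
  · refine mem_RN fun Q hQ => ?_
    rcases h Q hQ with h1 | h1
    · right
      intro x hx
      refine pr_orth (h1 hx) ?_
      simp only [iv_apply, map_sub, (isProj_pr P).idem, pr_small hN hP hPR]
      abel
    · left
      exact h1 (R.sub_mem (prN_mem hN hR e) (hPR (prN_mem hN hP e)))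
  · intro x
    rw [InnerProductSpace.rankOne_apply, InnerProductSpace.rankOne_apply, map_smul, hg.idem,
      sa_inner hg.2 e (iv P R x), hg.idem, ← sa_inner hg.2]
  · intro x
    rw [InnerProductSpace.rankOne_apply, norm_smul]
    have h1 : ‖⟪iv P R e, x⟫‖ ≤ ‖iv P R e‖ * ‖x‖ := norm_inner_le_norm _ _
    calc (‖⟪iv P R e, x⟫‖ * ‖iv P R e‖) ^ 2 ≤ (‖iv P R e‖ * ‖x‖ * ‖iv P R e‖) ^ 2 := by gcongr
      _ = 1 * (‖iv P R e‖ ^ 2) ^ 2 * ‖x‖ ^ 2 := by ring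
      _ ≤ _ := by gcongr; norm_num
  · rw [InnerProductSpace.rankOne_apply, inner_smul_right]
    have h1 : ⟪e, iv P R e⟫ = ((‖iv P R e‖ ^ 2 : ℝ) : ℂ) := by
      rw [← hg.idem, ← sa_inner hg.2, hg.idem, inner_self_eq_norm_sq_to_K]; norm_cast
    have h2 : ⟪iv P R e, e⟫ = ((‖iv P R e‖ ^ 2 : ℝ) : ℂ) := by
      rw [sa_inner hg.2, h1]
    rw [h1, h2, ← Complex.ofReal_mul, Complex.ofReal_re, ← pow_two]
    have : 0 ≤ ε * ‖iv P R e‖ ^ 2 := by positivity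
    linarith

lemma uw_ineq {u w A B a b : ℝ} (hA : 0 ≤ A) (hB : 0 ≤ B)
    (hu : u ^ 2 ≤ A * a ^ 2) (hw : w ^ 2 ≤ B * b ^ 2) :
    (u + w) ^ 2 ≤ (A + B) * (a ^ 2 + b ^ 2) := by
  have h1 : 2 * (u * w) ≤ A * b ^ 2 + B * a ^ 2 := by
    have h0 : 0 ≤ A * b ^ 2 + B * a ^ 2 := by positivity
    refine le_of_sq_le_sq ?_ h0 |> id
    have h2 : u ^ 2 * w ^ 2 ≤ (A * a ^ 2) * (B * b ^ 2) := by gcongr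
    nlinarith [sq_nonneg (A * b ^ 2 - B * a ^ 2)]
  nlinarith

lemma good_glue (hN : IsNest N) {ε : ℝ} {e : H} {P R S : Submodule ℂ H} (hP : P ∈ N)
    (hR : R ∈ N) (hPR : P ≤ R) (hRS : R ≤ S) (h1 : Good N ε e P R) (h2 : Good N ε e R S) :
    Good N ε e P S := by
  obtain ⟨V, hV, hVs, hVb, hVd⟩ := h1
  obtain ⟨V', hV', hVs', hVb', hVd'⟩ := h2
  have g1 := iv_proj hN hP hPR
  have g2 := iv_proj hN hR hRS
  have hadd := iv_add P R S
  have z1 := iv_mul0 hN hP hR hPR hRS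
  have z2 := iv_mul0' hN hP hR hPR hRS
  have g12 : ∀ x y, ⟪iv P R x, iv R S y⟫ = 0 := fun x y => by
    rw [sa_inner g1.2, z1, inner_zero_right]
  have g21 : ∀ x y, ⟪iv R S x, iv P R y⟫ = 0 := fun x y => by
    rw [sa_inner g2.2, z2, inner_zero_right]
  have pyth : ∀ x y, ‖iv P R x + iv R S y‖ ^ 2 = ‖iv P R x‖ ^ 2 + ‖iv R S y‖ ^ 2 := fun x y => by
    have := norm_add_sq_eq_norm_sq_add_norm_sq_of_inner_eq_zero (𝕜 := ℂ) _ _ (g12 x y)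
    simpa only [pow_two] using this
  have hm : ‖iv P S e‖ ^ 2 = ‖iv P R e‖ ^ 2 + ‖iv R S e‖ ^ 2 := by rw [← hadd, pyth]
  set a := iv P R e with ha
  set b := iv R S e with hb
  have V0 : ∀ x, V (iv R S x) = 0 := fun x => by rw [hVs, z1]; simp
  have V0' : ∀ x, V' (iv P R x) = 0 := fun x => by rw [hVs', z2]; simp
  refine ⟨V + V' + (2 : ℂ) • InnerProductSpace.rankOne ℂ a b,
    add_mem (add_mem hV hV') (Submodule.smul_mem _ _ (Submodule.subset_span
      (iv_rank hN hP hR hPR hRS e))), ?_, ?_, ?_⟩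
  · intro x
    have e1 : V x = iv P S (V (iv P S x)) := by
      rw [← hadd x, map_add, V0, add_zero, ← hadd, hVs (iv P R x), z2, add_zero, g1.idem, g1.idem,
        ← hVs]
    have e2 : V' x = iv P S (V' (iv P S x)) := by
      rw [← hadd x, map_add, V0', zero_add, ← hadd, hVs' (iv R S x), z1, zero_add, g2.idem, g2.idem,
        ← hVs']
    have e3 : iv P S a = a := by rw [← hadd, ha, g1.idem, z2, add_zero]
    have e4 : ⟪b, iv P S x⟫ = ⟪b, x⟫ := by
      rw [← hadd, inner_add_right, hb, g21, zero_add, sa_inner g2.2, g2.idem, ← sa_inner g2.2]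
    simp only [add_apply, smul_apply, InnerProductSpace.rankOne_apply, map_add, map_smul, e3, e4]
    rw [← e1, ← e2]
  · intro x
    have e1 : (V + V' + (2 : ℂ) • InnerProductSpace.rankOne ℂ a b) x =
        iv P R (V (iv P R x) + (2 * ⟪b, iv R S x⟫) • a) + iv R S (V' (iv R S x)) := by
      have e4 : ⟪b, iv R S x⟫ = ⟪b, x⟫ := by
        rw [hb, sa_inner g2.2, g2.idem, ← sa_inner g2.2]
      simp only [add_apply, smul_apply, InnerProductSpace.rankOne_apply, map_add, map_smul, e4]
      rw [← hVs, ← hVs', ha, g1.idem, smul_smul]; abel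
    rw [e1, pyth, hm]
    have n1 : ‖iv P R (V (iv P R x) + (2 * ⟪b, iv R S x⟫) • a)‖ ≤
        ‖V (iv P R x)‖ + 2 * (‖b‖ * ‖iv R S x‖) * ‖a‖ := by
      refine (g1.norm_le _).trans ((norm_add_le _ _).trans ?_)
      rw [norm_smul, norm_mul]
      have : ‖(2:ℂ)‖ = 2 := by simp
      rw [this]
      gcongr
      exact norm_inner_le_norm _ _
    have n2 : ‖iv R S (V' (iv R S x))‖ ^ 2 ≤ 2 * (‖b‖ ^ 2) ^ 2 * ‖iv R S x‖ ^ 2 := by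
      refine le_trans ?_ (hVb' _)
      gcongr
      exact g2.norm_le _
    have n3 := uw_ineq (u := ‖V (iv P R x)‖) (w := 2 * (‖b‖ * ‖iv R S x‖) * ‖a‖)
      (A := 2 * (‖a‖ ^ 2) ^ 2) (B := 4 * ‖a‖ ^ 2 * ‖b‖ ^ 2) (a := ‖iv P R x‖) (b := ‖iv R S x‖)
      (by positivity) (by positivity) (hVb _) (le_of_eq (by ring))
    have n4 : ‖iv P R x‖ ^ 2 + ‖iv R S x‖ ^ 2 ≤ ‖x‖ ^ 2 := by
      rw [← pyth, hadd]
      gcongr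
      exact (iv_proj hN hP (hPR.trans hRS)).norm_le x
    have n5 : ‖iv P R (V (iv P R x) + (2 * ⟪b, iv R S x⟫) • a)‖ ^ 2 ≤
        (‖V (iv P R x)‖ + 2 * (‖b‖ * ‖iv R S x‖) * ‖a‖) ^ 2 := by gcongr
    have n6 : 2 * (‖a‖ ^ 2 + ‖b‖ ^ 2) ^ 2 * (‖iv P R x‖ ^ 2 + ‖iv R S x‖ ^ 2) ≤
      2 * (‖a‖ ^ 2 + ‖b‖ ^ 2) ^ 2 * ‖x‖ ^ 2 := by gcongr
    have n7 : 0 ≤ 2 * (‖b‖ ^ 2) ^ 2 * ‖iv P R x‖ ^ 2 := by positivity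
    nlinarith
  · have k1 : ⟪e, a⟫ = ((‖a‖ ^ 2 : ℝ) : ℂ) := by
      rw [ha, ← g1.idem, ← sa_inner g1.2, g1.idem, inner_self_eq_norm_sq_to_K]; norm_cast
    have k2 : ⟪b, e⟫ = ((‖b‖ ^ 2 : ℝ) : ℂ) := by
      rw [hb, sa_inner g2.2, ← g2.idem, ← sa_inner g2.2, g2.idem, inner_self_eq_norm_sq_to_K]
      norm_cast
    simp only [add_apply, smul_apply, InnerProductSpace.rankOne_apply, inner_add_right,
      inner_smul_right, Complex.add_re, k1, k2, ← Complex.ofReal_mul]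
    have : (2 * (((‖b‖ ^ 2 * ‖a‖ ^ 2 : ℝ) : ℂ))).re = 2 * (‖b‖ ^ 2 * ‖a‖ ^ 2) := by
      rw [← Complex.ofReal_ofNat, ← Complex.ofReal_mul, Complex.ofReal_re]
    rw [this, hm]
    nlinarith

lemma sup_approx (hN : IsNest N) {G : Set (Submodule ℂ H)} (hG : G ⊆ N) (hne : G.Nonempty) (e : H)
    {ε : ℝ} (hε : 0 < ε) : ∃ R ∈ G, ‖iv R (sSup G).topologicalClosure e‖ ^ 2 ≤ ε := by
  set S := (sSup G).topologicalClosure with hS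
  have hSN : S ∈ N := (hN.2.2 G hG).2
  have h1 : pr S e ∈ closure ((sSup G : Submodule ℂ H) : Set H) := prN_mem hN hSN e
  obtain ⟨y, hy, hd⟩ := Metric.mem_closure_iff.1 h1 (√ε) (by positivity)
  have hdir : DirectedOn (· ≤ ·) G := fun x hx y hy => by
    rcases hN.2.1.total (hG hx) (hG hy) with h | h
    · exact ⟨y, hy, h, le_rfl⟩
    · exact ⟨x, hx, le_rfl, h⟩
  obtain ⟨R, hR, hyR⟩ := (Submodule.mem_sSup_of_directed hne hdir).1 hy
  refine ⟨R, hR, ?_⟩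
  have hRS : R ≤ S := (le_sSup hR).trans (Submodule.le_topologicalClosure _)
  have e1 : iv R S e = iv R S (pr S e - y) := by
    have : iv R S y = 0 := by
      rw [iv_apply, pr_of_mem' (hRS hyR), pr_of_mem' hyR, sub_self]
    rw [map_sub, this, iv_apply, iv_apply, (isProj_pr S).idem, pr_small hN (hG hR) hRS, sub_zero]
  have h2 : ‖iv R S e‖ ≤ √ε := by
    rw [e1]
    refine ((iv_proj hN (hG hR) hRS).norm_le _).trans ?_
    rw [← dist_eq_norm]; exact hd.le
  calc ‖iv R S e‖ ^ 2 ≤ (√ε) ^ 2 := by gcongr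
    _ = ε := Real.sq_sqrt hε.le

lemma inf_approx (hN : IsNest N) {G : Set (Submodule ℂ H)} (hG : G ⊆ N) (hne : G.Nonempty) (e : H)
    {ε : ℝ} (hε : 0 < ε) : ∃ R ∈ G, ‖iv (sInf G) R e‖ ^ 2 ≤ ε := by
  set S := sInf G with hS
  have hSN : S ∈ N := (hN.2.2 G hG).1
  let G' : Set (Submodule ℂ H) := (fun L => Lᗮ) '' G
  have hW : (sSup G')ᗮ = S := by
    rw [← Submodule.sInf_orthogonal]
    apply le_antisymm
    · refine le_sInf fun L hL => ?_
      refine (iInf₂_le Lᗮ ⟨L, hL, rfl⟩).trans ?_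
      rw [Submodule.orthogonal_orthogonal_eq_closure, cl_eq hN (hG hL)]
    · refine le_iInf₂ ?_
      rintro _ ⟨L, hL, rfl⟩
      exact (sInf_le hL).trans (Submodule.le_orthogonal_orthogonal _)
  have h1 : e - pr S e ∈ closure ((sSup G' : Submodule ℂ H) : Set H) := by
    have : e - pr S e ∈ (sSup G')ᗮᗮ := by
      rw [hW, Submodule.mem_orthogonal']
      intro u hu
      refine pr_orth hu ?_
      rw [map_sub, (isProj_pr S).idem, sub_self]
    rwa [Submodule.orthogonal_orthogonal_eq_closure] at this
  obtain ⟨y, hy, hd⟩ := Metric.mem_closure_iff.1 h1 (√ε) (by positivity)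
  have hdir : DirectedOn (· ≤ ·) G' := by
    rintro _ ⟨x, hx, rfl⟩ _ ⟨y, hy, rfl⟩
    rcases hN.2.1.total (hG hx) (hG hy) with h | h
    · exact ⟨xᗮ, ⟨x, hx, rfl⟩, le_rfl, Submodule.orthogonal_le h⟩
    · exact ⟨yᗮ, ⟨y, hy, rfl⟩, Submodule.orthogonal_le h, le_rfl⟩
  obtain ⟨_, ⟨R, hR, rfl⟩, hyR⟩ := (Submodule.mem_sSup_of_directed (hne.image _) hdir).1 hy
  refine ⟨R, hR, ?_⟩
  have hRS : S ≤ R := sInf_le hR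
  have e1 : iv S R e = pr R (e - pr S e - y) := by
    have : pr R y = 0 := pr_zero fun v hv => hyR v hv
    rw [map_sub, this, map_sub, iv_apply, pr_big hN hSN hRS, sub_zero]
  have h2 : ‖iv S R e‖ ≤ √ε := by
    rw [e1]
    refine ((isProj_pr R).norm_le _).trans ?_
    rw [← dist_eq_norm]; exact hd.le
  calc ‖iv S R e‖ ^ 2 ≤ (√ε) ^ 2 := by gcongr
    _ = ε := Real.sq_sqrt hε.le

lemma good_all (hN : IsNest N) {ε : ℝ} (hε : 0 < ε) {e : H} {P R : Submodule ℂ H} (hP : P ∈ N)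
    (hR : R ∈ N) (hPR : P ≤ R) : Good N ε e P R := by
  let G : Set (Submodule ℂ H) := {Q | Q ∈ N ∧ P ≤ Q ∧ Q ≤ R ∧ Good N ε e P Q}
  have hGN : G ⊆ N := fun Q hQ => hQ.1
  have hPG : P ∈ G := ⟨hP, le_rfl, hPR, good_small (by simp [iv_apply, hε.le])⟩
  set S := (sSup G).topologicalClosure with hS
  have hSN : S ∈ N := (hN.2.2 G hGN).2
  have hle : ∀ Q ∈ G, Q ≤ S := fun Q hQ => (le_sSup hQ).trans (Submodule.le_topologicalClosure _)
  have hSG : S ∈ G := by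
    obtain ⟨Q, hQ, hq⟩ := sup_approx hN hGN ⟨P, hPG⟩ e hε
    refine ⟨hSN, hle P hPG, ?_, good_glue hN hP hQ.1 hQ.2.1 (hle Q hQ) hQ.2.2.2 (good_small hq)⟩
    exact Submodule.topologicalClosure_minimal _ (sSup_le fun Q hQ => hQ.2.2.1) (hN.1 R hR)
  by_contra hcon
  have hSR : S < R := lt_of_le_of_ne hSG.2.2.1 (fun h => hcon (h ▸ hSG.2.2.2))
  let G2 : Set (Submodule ℂ H) := {Q | Q ∈ N ∧ S < Q ∧ Q ≤ R}
  have hG2 : G2 ⊆ N := fun Q hQ => hQ.1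
  have hRG : R ∈ G2 := ⟨hR, hSR, le_rfl⟩
  have hI : sInf G2 ∈ N := (hN.2.2 G2 hG2).1
  have hSI : S ≤ sInf G2 := le_sInf fun Q hQ => hQ.2.1.le
  have add : ∀ Q ∈ N, S < Q → Q ≤ R → Good N ε e S Q → False := fun Q hQ h1 h2 h3 => by
    have : Q ∈ G := ⟨hQ, hSG.2.1.trans h1.le, h2, good_glue hN hP hSN hSG.2.1 h1.le hSG.2.2.2 h3⟩
    exact absurd (hle Q this) (not_le_of_gt h1)
  rcases hSI.eq_or_lt with h | h
  · obtain ⟨Q, hQ, hq⟩ := inf_approx hN hG2 ⟨R, hRG⟩ e hε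
    rw [← h] at hq
    exact add Q hQ.1 hQ.2.1 hQ.2.2 (good_small hq)
  · refine add _ hI h (sInf_le hRG) (good_atom hN hε.le hSN hI hSI fun Q hQ => ?_)
    by_cases h1 : Q ≤ S
    · exact Or.inl h1
    · right
      have h2 : S < Q := by
        rcases hN.2.1.total hQ hSN with h3 | h3
        · exact absurd h3 h1
        · exact lt_of_le_not_ge h3 h1
      rcases hN.2.1.total hQ hR with h3 | h3
      · exact sInf_le ⟨hQ, h2, h3⟩
      · exact (sInf_le hRG).trans h3

end P7
end OS

namespace OS
open ContinuousLinearMap Filter Topology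
set_option linter.unusedSectionVars false
set_option linter.unusedVariables false
set_option linter.style.haveILetI false
section P8
variable {H : Type*}
    [NormedAddCommGroup H] [InnerProductSpace ℂ H] [CompleteSpace H]
    {N : Set (Submodule ℂ H)}

lemma top_mem (hN : IsNest N) : ⊤ ∈ N := by
  have := (hN.2.2 ∅ (empty_subset _)).1
  simpa using this

lemma bot_mem (hN : IsNest N) : ⊥ ∈ N := by
  have := (hN.2.2 ∅ (empty_subset _)).2
  rw [sSup_empty] at this
  rwa [(isClosed_singleton (x := (0 : H))).submodule_topologicalClosure_eq
    (s := (⊥ : Submodule ℂ H))] at this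

lemma pr_top (x : H) : pr (⊤ : Submodule ℂ H) x = x := pr_of_mem' trivial

lemma pr_bot (x : H) : pr (⊥ : Submodule ℂ H) x = 0 := pr_zero fun v hv => by
  rw [(Submodule.mem_bot ℂ).1 hv, inner_zero_left]

lemma pr_comm (hN : IsNest N) {L L'} (hL : L ∈ N) (hL' : L' ∈ N) (x : H) :
    pr L (pr L' x) = pr L' (pr L x) := by
  rcases hN.2.1.total hL hL' with h | h
  · rw [pr_small hN hL h, pr_big hN hL h]
  · rw [pr_small hN hL' h, pr_big hN hL' h]

/-- admissible vectors -/
def Adm (s : Finset (Submodule ℂ H)) (x : H) : Set H :=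
  {u | u = 0 ∨ ∃ S, (S = ⊤ ∨ S ∈ s) ∧ u = pr S x}

lemma F_base (hN : IsNest N) (e : H) {P R : Submodule ℂ H} (hP : P ∈ N) (hR : R ∈ N) (h : P ≤ R) :
    ∃ F ∈ Submodule.span ℂ (RN N), (∀ x, F x = iv P R (F (iv P R x))) ∧
      (∀ x, ‖F x‖ ^ 2 ≤ 8 * ‖x‖ ^ 2) ∧ ⟪iv P R e, F (iv P R e)⟫ = ⟪iv P R e, iv P R e⟫ := by
  by_cases h0 : iv P R e = 0
  · exact ⟨0, zero_mem _, by simp, fun x => by simp, by simp [h0]⟩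
  obtain ⟨m, hm⟩ : ∃ m, m = ‖iv P R e‖ ^ 2 := ⟨_, rfl⟩
  have hmpos : 0 < m := by rw [hm]; positivity
  obtain ⟨V, hV, hs, hb, hd⟩ := good_all hN (ε := m / 2) (by positivity) (e := e) hP hR h
  rw [← hm] at hb hd
  have hg := iv_proj hN hP h
  have hw : ⟪e, V e⟫ = ⟪iv P R e, V (iv P R e)⟫ := by
    rw [hs e, ← sa_inner hg.2]
  set w := ⟪e, V e⟫ with hwd
  have hw1 : m ^ 2 / 2 ≤ ‖w‖ := le_trans (by nlinarith) (Complex.re_le_norm w)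
  have hwpos : 0 < ‖w‖ := lt_of_lt_of_le (by positivity) hw1
  have hw0 : w ≠ 0 := norm_pos_iff.1 hwpos
  refine ⟨((m : ℂ) / w) • V, Submodule.smul_mem _ _ hV, fun x => ?_, fun x => ?_, ?_⟩
  · simp only [smul_apply, map_smul, ← hs]
  · rw [smul_apply, norm_smul, norm_div, Complex.norm_real, Real.norm_of_nonneg hmpos.le, mul_pow,
      div_pow, div_mul_eq_mul_div, div_le_iff₀ (by positivity)]
    have h1 := hb x
    have h2 : (m ^ 2 / 2) ^ 2 ≤ ‖w‖ ^ 2 := by gcongr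
    calc m ^ 2 * ‖V x‖ ^ 2 ≤ m ^ 2 * (2 * m ^ 2 * ‖x‖ ^ 2) := by gcongr
      _ = 8 * ‖x‖ ^ 2 * (m ^ 2 / 2) ^ 2 := by ring
      _ ≤ _ := by gcongr
  · rw [smul_apply, inner_smul_right, ← hw, div_mul_cancel₀ _ hw0, inner_self_eq_norm_sq_to_K, hm]
    norm_cast

lemma F_fin (hN : IsNest N) (e : H) (s : Finset (Submodule ℂ H)) : (∀ S ∈ s, S ∈ N) →
    ∀ P ∈ N, ∀ R ∈ N, P ≤ R →
    ∃ F ∈ Submodule.span ℂ (RN N), (∀ x, F x = iv P R (F (iv P R x))) ∧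
      (∀ x, ‖F x‖ ^ 2 ≤ 8 * ‖x‖ ^ 2) ∧
      ∀ u ∈ Adm s (iv P R e), ∀ v ∈ Adm s (iv P R e), ⟪u, F v⟫ = ⟪u, v⟫ := by
  classical
  induction s using Finset.induction_on with
  | empty =>
    intro _ P hP R hR h
    obtain ⟨F, h1, h2, h3, h4⟩ := F_base hN e hP hR h
    refine ⟨F, h1, h2, h3, ?_⟩
    have : ∀ u ∈ Adm ∅ (iv P R e), u = 0 ∨ u = iv P R e := by
      rintro u (rfl | ⟨S, rfl | hS, rfl⟩)
      · exact Or.inl rfl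
      · right; rw [pr_top]
      · simp at hS
    intro u hu v hv
    rcases this u hu with rfl | rfl
    · simp
    · rcases this v hv with rfl | rfl
      · simp
      · exact h4
  | insert S0 s _ ih =>
    intro hs P hP R hR h
    have hS0 := hs S0 (Finset.mem_insert_self _ _)
    have ih := ih fun S hS => hs S (Finset.mem_insert_of_mem hS)
    have red : ∀ x, pr S0 x ∈ Adm s x → Adm (insert S0 s) x ⊆ Adm s x := by
      rintro x h0 u (rfl | ⟨S, rfl | hS, rfl⟩)
      · exact Or.inl rfl
      · exact Or.inr ⟨⊤, Or.inl rfl, rfl⟩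
      · rcases Finset.mem_insert.1 hS with rfl | hS
        · exact h0
        · exact Or.inr ⟨S, Or.inr hS, rfl⟩
    have triv : pr S0 (iv P R e) ∈ Adm s (iv P R e) → ∃ F ∈ Submodule.span ℂ (RN N),
      (∀ x, F x = iv P R (F (iv P R x))) ∧ (∀ x, ‖F x‖ ^ 2 ≤ 8 * ‖x‖ ^ 2) ∧
      ∀ u ∈ Adm (insert S0 s) (iv P R e), ∀ v ∈ Adm (insert S0 s) (iv P R e),
        ⟪u, F v⟫ = ⟪u, v⟫ := fun h0 => by
      obtain ⟨F, h1, h2, h3, h4⟩ := ih P hP R hR h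
      exact ⟨F, h1, h2, h3, fun u hu v hv => h4 u (red _ h0 hu) v (red _ h0 hv)⟩
    rcases hN.2.1.total hS0 hP with c1 | c1
    · refine triv (Or.inl ?_)
      rw [iv_apply, map_sub, pr_small hN hS0 (c1.trans h), pr_small hN hS0 c1, sub_self]
    rcases hN.2.1.total hR hS0 with c2 | c2
    · refine triv (Or.inr ⟨⊤, Or.inl rfl, ?_⟩)
      rw [pr_top]
      exact pr_of_mem' (c2 (R.sub_mem (prN_mem hN hR e) (h (prN_mem hN hP e))))
    obtain ⟨F, f1, f2, f3, f4⟩ := ih P hP S0 hS0 c1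
    obtain ⟨F', f1', f2', f3', f4'⟩ := ih S0 hS0 R hR c2
    have g1 := iv_proj hN hP c1
    have g2 := iv_proj hN hS0 c2
    have hadd := iv_add P S0 R
    have z1 := iv_mul0 hN hP hS0 c1 c2
    have z2 := iv_mul0' hN hP hS0 c1 c2
    have g12 : ∀ x y, ⟪iv P S0 x, iv S0 R y⟫ = 0 := fun x y => by
      rw [sa_inner g1.2, z1, inner_zero_right]
    have g21 : ∀ x y, ⟪iv S0 R x, iv P S0 y⟫ = 0 := fun x y => by
      rw [sa_inner g2.2, z2, inner_zero_right]
    have pyth : ∀ x y, ‖iv P S0 x + iv S0 R y‖ ^ 2 = ‖iv P S0 x‖ ^ 2 + ‖iv S0 R y‖ ^ 2 :=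
      fun x y => by
      have := norm_add_sq_eq_norm_sq_add_norm_sq_of_inner_eq_zero (𝕜 := ℂ) _ _ (g12 x y)
      simpa only [pow_two] using this
    have F0 : ∀ x, F (iv S0 R x) = 0 := fun x => by rw [f2, z1]; simp
    have F0' : ∀ x, F' (iv P S0 x) = 0 := fun x => by rw [f2', z2]; simp
    have com : ∀ S, (S = ⊤ ∨ S ∈ s) → ∀ A ∈ N, ∀ B ∈ N, ∀ x, iv A B (pr S x) = pr S (iv A B x) := by
      intro S hS A hA B hB x
      have hSN : S ∈ N := by
        rcases hS with rfl | hS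
        · exact top_mem hN
        · exact hs S (Finset.mem_insert_of_mem hS)
      rw [iv_apply, iv_apply, map_sub, pr_comm hN hB hSN, pr_comm hN hA hSN]
    have fix1 : ∀ u ∈ Adm s (iv P S0 e), iv P S0 u = u := by
      rintro u (rfl | ⟨S, hS, rfl⟩)
      · simp
      · rw [com S hS P hP S0 hS0, g1.idem]
    have fix2 : ∀ u ∈ Adm s (iv S0 R e), iv S0 R u = u := by
      rintro u (rfl | ⟨S, hS, rfl⟩)
      · simp
      · rw [com S hS S0 hS0 R hR, g2.idem]
    have dec : ∀ u ∈ Adm (insert S0 s) (iv P R e), ∃ a ∈ Adm s (iv P S0 e), ∃ b ∈ Adm s (iv S0 R e),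
        u = a + b := by
      have old : ∀ S, (S = ⊤ ∨ S ∈ s) → ∃ a ∈ Adm s (iv P S0 e), ∃ b ∈ Adm s (iv S0 R e),
        pr S (iv P R e) = a + b := fun S hS =>
        ⟨_, Or.inr ⟨S, hS, rfl⟩, _, Or.inr ⟨S, hS, rfl⟩, by rw [← hadd, map_add]⟩
      rintro u (rfl | ⟨S, rfl | hS, rfl⟩)
      · exact ⟨0, Or.inl rfl, 0, Or.inl rfl, by simp⟩
      · exact old ⊤ (Or.inl rfl)
      · rcases Finset.mem_insert.1 hS with rfl | hS
        · refine ⟨_, Or.inr ⟨⊤, Or.inl rfl, rfl⟩, 0, Or.inl rfl, ?_⟩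
          rw [pr_top, add_zero, iv_apply, iv_apply, map_sub, pr_small hN hS0 c2, pr_big hN hP c1]
        · exact old S (Or.inr hS)
    refine ⟨F + F', add_mem f1 f1', fun x => ?_, fun x => ?_, ?_⟩
    · have e1 : F x = iv P R (F (iv P R x)) := by
        rw [← hadd x, map_add, F0, add_zero, ← hadd, f2 (iv P S0 x), z2, add_zero, g1.idem, g1.idem,
          ← f2]
      have e2 : F' x = iv P R (F' (iv P R x)) := by
        rw [← hadd x, map_add, F0', zero_add, ← hadd, f2' (iv S0 R x), z1, zero_add, g2.idem,
          g2.idem, ← f2']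
      simp only [add_apply, map_add]
      rw [← e1, ← e2]
    · have e1 : (F + F') x = iv P S0 (F (iv P S0 x)) + iv S0 R (F' (iv S0 R x)) := by
        rw [← f2, ← f2']; rfl
      rw [e1, pyth]
      have n1 : ‖iv P S0 (F (iv P S0 x))‖ ^ 2 ≤ 8 * ‖iv P S0 x‖ ^ 2 := by
        refine le_trans ?_ (f3 _)
        gcongr
        exact g1.norm_le _
      have n2 : ‖iv S0 R (F' (iv S0 R x))‖ ^ 2 ≤ 8 * ‖iv S0 R x‖ ^ 2 := by
        refine le_trans ?_ (f3' _)
        gcongr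
        exact g2.norm_le _
      have n4 : ‖iv P S0 x‖ ^ 2 + ‖iv S0 R x‖ ^ 2 ≤ ‖x‖ ^ 2 := by
        rw [← pyth, hadd]
        gcongr
        exact (iv_proj hN hP h).norm_le x
      linarith
    · intro u hu v hv
      obtain ⟨a, ha, b, hb, rfl⟩ := dec u hu
      obtain ⟨a', ha', b', hb', rfl⟩ := dec v hv
      have k1 := f4 a ha a' ha'
      have k2 := f4' b hb b' hb'
      have q1 : F b' = 0 := by rw [← fix2 b' hb', F0]
      have q2 : F' a' = 0 := by rw [← fix1 a' ha', F0']
      have q3 : ⟪a, F' b'⟫ = 0 := by rw [← fix1 a ha, f2', g12]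
      have q4 : ⟪b, F a'⟫ = 0 := by rw [← fix2 b hb, f2, g21]
      have q5 : ⟪a, b'⟫ = 0 := by rw [← fix1 a ha, ← fix2 b' hb', g12]
      have q6 : ⟪b, a'⟫ = 0 := by rw [← fix1 a' ha', ← fix2 b hb, g21]
      simp only [add_apply, map_add, inner_add_left, inner_add_right, q1, q2, q3, q4, q5, q6, k1, k2,
        inner_zero_right, add_zero, zero_add]

lemma comm_nestAlg {x : H →L[ℂ] H} (hN : IsNest N) (h : ∀ L ∈ N, ∀ z, x (pr L z) = pr L (x z)) :
    x ∈ nestAlg N := fun L hL z hz => by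
  rw [← pr_of_mem' hz, h L hL]; exact prN_mem hN hL _

lemma RN_comp {X x y : H →L[ℂ] H} (hX : X ∈ RN N) (hx : x ∈ nestAlg N) (hy : y ∈ nestAlg N) :
    x ∘L X ∘L y ∈ RN N := by
  obtain ⟨h, a, b, rfl⟩ := hX
  refine ⟨fun L hL z hz => hx L hL _ (h L hL _ (hy L hL z hz)), x a, adjoint y b, ?_⟩
  ext z
  simp only [comp_apply, InnerProductSpace.rankOne_apply, map_smul, adjoint_inner_left]

lemma fe_mem (hN : IsNest N) (e : H) : ∃ f : H →L[ℂ] H, f ∈ bicl (RN N) ∧ IsProj f ∧ f e = e ∧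
    ∀ L ∈ N, ∀ z, f (pr L z) = pr L (f z) := by
  classical
  choose F h1 h2 h3 h4 using fun s : Finset N =>
    F_fin hN e (s.map (Function.Embedding.subtype _)) (by simp only [Finset.mem_map]; rintro _ ⟨x, _, rfl⟩; exact x.2)
      ⊥ (bot_mem hN) ⊤ (top_mem hN) bot_le
  have hiv : iv (⊥ : Submodule ℂ H) ⊤ e = e := by rw [iv_apply, pr_top, pr_bot, sub_zero]
  let u : Ultrafilter (Finset N) := Ultrafilter.of atTop
  have hu : (u : Filter (Finset N)) ≤ atTop := Ultrafilter.of_le _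
  have hc : ∀ s, ‖F s‖ ≤ 3 := fun s => by
    refine opNorm_le_bound _ (by norm_num) fun x => ?_
    refine le_of_sq_le_sq ?_ (by positivity)
    nlinarith [h3 s x, sq_nonneg ‖x‖]
  obtain ⟨G, hG, hlim⟩ := exists_limit u hc
  have hGm : G ∈ bicl (RN N) := bicl_limit hc hlim fun s => by
    rw [← bicl_span]; exact subset_bicl (h1 s)
  have hGi : ∀ S ∈ N, ∀ S' ∈ N, ⟪pr S' e, G (pr S e)⟫ = ⟪pr S' e, pr S e⟫ := by
    intro S hS S' hS'
    refine tendsto_nhds_unique (hlim (pr S e) (pr S' e)) ?_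
    refine tendsto_const_nhds.congr' ?_
    have : ∀ᶠ s in (u : Filter (Finset N)), ({⟨S, hS⟩, ⟨S', hS'⟩} : Finset N) ≤ s :=
      hu (eventually_ge_atTop _)
    filter_upwards [this] with s hs
    have := h4 s (pr S' e) (Or.inr ⟨S', Or.inr ?_, by rw [hiv]⟩)
      (pr S e) (Or.inr ⟨S, Or.inr ?_, by rw [hiv]⟩)
    · exact this.symm
    · rw [Finset.mem_map]; exact ⟨⟨S', hS'⟩, hs (by simp), rfl⟩
    · rw [Finset.mem_map]; exact ⟨⟨S, hS⟩, hs (by simp), rfl⟩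
  let V : Submodule ℂ H := Submodule.span ℂ {z | ∃ L ∈ N, z = pr L e}
  have hVinv : ∀ L ∈ N, ∀ v ∈ V, pr L v ∈ V.topologicalClosure := by
    intro L hL v hv
    refine Submodule.le_topologicalClosure _ ?_
    have : V ≤ V.comap (pr L).toLinearMap := by
      refine Submodule.span_le.2 ?_
      rintro _ ⟨L', hL', rfl⟩
      show pr L (pr L' e) ∈ V
      rcases hN.2.1.total hL hL' with h | h
      · rw [pr_small hN hL h]; exact Submodule.subset_span ⟨L, hL, rfl⟩
      · rw [pr_big hN hL' h]; exact Submodule.subset_span ⟨L', hL', rfl⟩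
    exact this hv
  have hcom : ∀ L ∈ N, ∀ z, pr V (pr L z) = pr L (pr V z) := fun L hL z =>
    congrArg (fun q : H →L[ℂ] H => q z) (pr_intertwine (pr L) V V (hVinv L hL)
      (by rw [isSelfAdjoint_iff'.1 (isProj_pr L).2]; exact hVinv L hL))
  have hf := isProj_pr V
  have hfN := comm_nestAlg hN hcom
  have heV : e ∈ V := Submodule.subset_span ⟨⊤, top_mem hN, (pr_top e).symm⟩
  have key : pr V ∘L G ∘L pr V = pr V := by
    have k0 : ∀ x ∈ V, ∀ y ∈ V, ⟪y, G x - x⟫ = 0 := by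
      intro x hx y hy
      induction hx using Submodule.span_induction with
      | mem x hx =>
        obtain ⟨S, hS, rfl⟩ := hx
        induction hy using Submodule.span_induction with
        | mem y hy =>
          obtain ⟨S', hS', rfl⟩ := hy
          rw [inner_sub_right, hGi S hS S' hS', sub_self]
        | zero => simp
        | add a b _ _ ha hb => rw [inner_add_left, ha, hb, add_zero]
        | smul c a _ ha => rw [inner_smul_left, ha, mul_zero]
      | zero => simp
      | add a b _ _ ha hb =>
        rw [map_add, add_sub_add_comm, inner_add_right, ha, hb, add_zero]
      | smul c a _ ha => rw [map_smul, ← smul_sub, inner_smul_right, ha, mul_zero]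
    have k1 : ∀ x ∈ V.topologicalClosure, pr V (G x - x) = 0 := by
      intro x hx
      have : x ∈ (⊥ : Submodule ℂ H).topologicalClosure.comap
        (pr V ∘L (G - 1)).toLinearMap := by
        refine cl_map (V := V) (pr V ∘L (G - 1)) (fun v hv => ?_) hx
        have : (pr V ∘L (G - 1)) v = 0 := pr_zero fun y hy => k0 v hv y hy
        rw [this]; exact zero_mem _
      rw [(isClosed_singleton (x := (0 : H))).submodule_topologicalClosure_eq
        (s := (⊥ : Submodule ℂ H))] at this
      exact this
    ext z
    have := k1 _ (pr_mem V z)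
    rw [map_sub, sub_eq_zero, hf.idem] at this
    exact this
  refine ⟨pr V, ?_, hf, pr_of_mem' heV, hcom⟩
  rw [← key]
  exact bicl_comp _ _ (fun X hX => subset_bicl (RN_comp hX hfN hfN)) hGm

theorem erdos (hN : IsNest N) : (1 : H →L[ℂ] H) ∈ bicl (RN N) := by
  let J : Set (H →L[ℂ] H) := {x | x ∈ bicl (RN N) ∧ adjoint x ∈ bicl (RN N) ∧
    (∀ L ∈ N, ∀ z, x (pr L z) = pr L (x z)) ∧ ∀ L ∈ N, ∀ z, adjoint x (pr L z) = pr L (adjoint x z)}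
  have one_alg : (1 : H →L[ℂ] H) ∈ nestAlg N := fun L hL z hz => hz
  have mulm : ∀ x y : H →L[ℂ] H, y ∈ bicl (RN N) → (∀ L ∈ N, ∀ z, x (pr L z) = pr L (x z)) →
      x ∘L y ∈ bicl (RN N) := fun x y hy hx => by
    have := bicl_comp x 1 (fun X hX => subset_bicl (RN_comp hX (comm_nestAlg hN hx) one_alg)) hy
    exact this
  refine JR J ?_ ?_ ?_ (T := 1) fun a ha => ha.1
  · rintro x ⟨x1, x2, x3, x4⟩ y ⟨y1, y2, y3, y4⟩
    refine ⟨mulm x y y1 x3, ?_, fun L hL z => ?_, fun L hL z => ?_⟩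
    · rw [adjoint_comp]; exact mulm _ _ x2 y4
    · simp only [comp_apply, y3 L hL, x3 L hL]
    · rw [adjoint_comp]; simp only [comp_apply, y4 L hL, x4 L hL]
  · rintro x ⟨x1, x2, x3, x4⟩
    exact ⟨x2, by rwa [adjoint_adjoint], x4, by rwa [adjoint_adjoint]⟩
  · intro z
    obtain ⟨f, hf, hp, hfz, hc⟩ := fe_mem hN z
    have hsa : adjoint f = f := isSelfAdjoint_iff'.1 hp.2
    refine Submodule.le_topologicalClosure _ (Submodule.subset_span ⟨f, ⟨hf, ?_, hc, ?_⟩, z, hfz.symm⟩)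
    · rwa [hsa]
    · rwa [hsa]

end P8
end OS

namespace OS
open ContinuousLinearMap Filter Topology
set_option linter.unusedSectionVars false
set_option linter.unusedVariables false
set_option linter.style.haveILetI false
section P9
variable {H₁ H₂ : Type*}
    [NormedAddCommGroup H₁] [InnerProductSpace ℂ H₁] [CompleteSpace H₁]
    [NormedAddCommGroup H₂] [InnerProductSpace ℂ H₂] [CompleteSpace H₂]
    {D₁ : StarSubalgebra ℂ (H₁ →L[ℂ] H₁)} {D₂ : StarSubalgebra ℂ (H₂ →L[ℂ] H₂)}

lemma rank_closure {C : Set (H₁ →L[ℂ] H₂)} {V : Submodule ℂ H₂} {b : H₁}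
    (h : ∀ a ∈ V, InnerProductSpace.rankOne ℂ a b ∈ bicl C) {a : H₂}
    (ha : a ∈ V.topologicalClosure) : InnerProductSpace.rankOne ℂ a b ∈ bicl C := by
  obtain ⟨f, hf, hlim⟩ := mem_closure_iff_seq_limit.1 (show a ∈ closure (V : Set H₂) from ha)
  obtain ⟨c, hc⟩ := (Metric.isBounded_range_of_tendsto f hlim).exists_norm_le
  have hc' : ∀ n, ‖f n‖ ≤ c := fun n => hc _ ⟨n, rfl⟩
  refine bicl_limit (l := atTop) (Ti := fun n => InnerProductSpace.rankOne ℂ (f n) b)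
    (c := c * ‖b‖) (fun n => ?_) (fun x y => ?_) fun n => h _ (hf n)
  · refine opNorm_le_bound _ (mul_nonneg ((norm_nonneg _).trans (hc' 0)) (norm_nonneg _)) fun x => ?_
    rw [InnerProductSpace.rankOne_apply, norm_smul]
    calc ‖⟪b, x⟫‖ * ‖f n‖ ≤ (‖b‖ * ‖x‖) * c := by
          gcongr
          · exact norm_inner_le_norm _ _
          · exact hc' n
      _ = _ := by ring
  · simp only [InnerProductSpace.rankOne_apply]
    exact tendsto_const_nhds.inner (hlim.const_smul _)

/-- the span of `C L` -/
def VL (C : Set (H₁ →L[ℂ] H₂)) (L : Submodule ℂ H₁) : Submodule ℂ H₂ :=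
  Submodule.span ℂ {z | ∃ c ∈ C, ∃ x ∈ L, z = c x}

/-- vectors mapped into `VL` -/
def WL (C : Set (H₁ →L[ℂ] H₂)) (L : Submodule ℂ H₁) : Submodule ℂ H₁ where
  carrier := {x | ∀ c ∈ C, c x ∈ (VL C L).topologicalClosure}
  add_mem' := fun hx hy c hc => by rw [map_add]; exact add_mem (hx c hc) (hy c hc)
  zero_mem' := fun c hc => by rw [map_zero]; exact zero_mem _
  smul_mem' := fun r x hx c hc => by rw [map_smul]; exact Submodule.smul_mem _ _ (hx c hc)

lemma le_WL (C : Set (H₁ →L[ℂ] H₂)) (L : Submodule ℂ H₁) : L ≤ WL C L := fun x hx c hc =>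
  Submodule.le_topologicalClosure _ (Submodule.subset_span ⟨c, hc, x, hx, rfl⟩)

lemma C_structure (hD₁ : IsMasa D₁) (hD₂ : IsMasa D₂) {C : Set (H₁ →L[ℂ] H₂)}
    (hC : IsMasaBimodule D₁ D₂ C) (hCn : IsNestBimodule C) : ∃ Λ ⊆ PP D₁ D₂,
    (∀ p ∈ Λ, ∀ X ∈ C, p.2 ∘L X ∘L p.1 = X ∘L p.1) ∧
    (∀ p ∈ Λ, ∀ Y : H₁ →L[ℂ] H₂, p.2 ∘L Y ∘L (1 - p.1) ∈ C) ∧ Itw Λ ⊆ C := by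
  obtain ⟨hcl, N₁, N₂, hN₁, hN₂, hb⟩ := hCn
  have hb1 : ∀ c ∈ C, ∀ A ∈ nestAlg N₁, c ∘L A ∈ C := fun c hc A hA =>
    hb c hc A hA 1 fun L hL x hx => hx
  have hCl : ∀ m ∈ C, ∀ b ∈ D₂, b ∘L m ∈ C := fun m hm b hb => hC.2 m hm 1 (one_mem _) b hb
  have hCr : ∀ m ∈ C, ∀ a ∈ D₁, m ∘L a ∈ C := fun m hm a ha => hC.2 m hm a ha 1 (one_mem _)
  have sub : ∀ (L : Submodule ℂ H₁) (b : H₁),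
      (∀ x ∈ L, InnerProductSpace.rankOne ℂ x b ∈ nestAlg N₁) →
      ∀ a ∈ (VL C L).topologicalClosure, InnerProductSpace.rankOne ℂ a b ∈ bicl C := by
    intro L b h a ha
    refine rank_closure (V := VL C L) (fun a ha => ?_) ha
    induction ha using Submodule.span_induction with
    | mem a ha =>
      obtain ⟨c, hc, x, hx, rfl⟩ := ha
      have : InnerProductSpace.rankOne ℂ (c x) b = c ∘L InnerProductSpace.rankOne ℂ x b := by
        ext z; simp [InnerProductSpace.rankOne_apply]
      rw [this]
      exact subset_bicl (hb1 c hc _ (h x hx))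
    | zero => simp
    | add a a' _ _ h1 h2 => rw [map_add, add_apply]; exact add_mem h1 h2
    | smul r a _ h1 => rw [map_smul, smul_apply]; exact Submodule.smul_mem _ _ h1
  have cW : ∀ L, ∀ c ∈ C, ∀ x, c (pr (WL C L) x) ∈ (VL C L).topologicalClosure := fun L c hc x =>
    cl_map (V := WL C L) c (fun v hv => hv c hc) (pr_mem _ x)
  refine ⟨{p | ∃ L ∈ N₁, p = (pr (WL C L), pr (VL C L))}, ?_, ?_, ?_, ?_⟩
  · rintro _ ⟨L, hL, rfl⟩
    refine ⟨pr_mem_masa hD₁ fun d hd v hv => ?_, pr_mem_masa hD₂ fun d hd v hv => ?_, isProj_pr _,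
      isProj_pr _⟩
    · exact Submodule.le_topologicalClosure _ fun c hc => hv _ (hCr c hc d hd)
    · refine Submodule.le_topologicalClosure _ ?_
      have : VL C L ≤ (VL C L).comap d.toLinearMap := by
        refine Submodule.span_le.2 ?_
        rintro _ ⟨c, hc, x, hx, rfl⟩
        exact Submodule.subset_span ⟨_, hCl c hc d hd, x, hx, rfl⟩
      exact this hv
  · rintro _ ⟨L, hL, rfl⟩ X hX
    ext x
    exact pr_of_mem (cW L X hX x)
  · rintro _ ⟨L, hL, rfl⟩ Y
    refine bicl_closed hC.1 (bicl_comp _ _ ?_ (bicl_rankOne Y))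
    rintro _ ⟨a, b, rfl⟩
    have hp := (isProj_pr (WL C L)).compl
    have : pr (VL C L) ∘L InnerProductSpace.rankOne ℂ a b ∘L (1 - pr (WL C L)) =
        InnerProductSpace.rankOne ℂ (pr (VL C L) a) ((1 - pr (WL C L)) b) := by
      ext z
      simp only [comp_apply, InnerProductSpace.rankOne_apply, map_smul]
      rw [← sa_inner hp.2]
    rw [this]
    refine sub L _ (fun x hx => (mem_RN fun Q hQ => ?_).1) _ (pr_mem _ a)
    rcases hN₁.2.1.total hQ hL with h | h
    · right
      intro y hy
      refine pr_orth (le_WL C L (h hy)) ?_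
      show pr (WL C L) (b - pr (WL C L) b) = 0
      rw [map_sub, (isProj_pr _).idem, sub_self]
    · exact Or.inl (h hx)
  · intro X hX
    refine bicl_closed hC.1 ?_
    have := bicl_comp (G' := C) X 1 ?_ (erdos hN₁)
    · exact this
    rintro _ ⟨hr, a, b, rfl⟩
    have e1 : X ∘L InnerProductSpace.rankOne ℂ a b ∘L 1 = InnerProductSpace.rankOne ℂ (X a) b := by
      ext z
      show X (InnerProductSpace.rankOne ℂ a b z) = _
      simp [InnerProductSpace.rankOne_apply]
    rw [e1]
    let L := sInf {Q | Q ∈ N₁ ∧ a ∈ Q}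
    have hL : L ∈ N₁ := (hN₁.2.2 _ fun Q hQ => hQ.1).1
    have haL : a ∈ L := by
      rw [Submodule.mem_sInf]; exact fun Q hQ => hQ.2
    have hXa : X a ∈ (VL C L).topologicalClosure := by
      have := congrArg (fun q : H₁ →L[ℂ] H₂ => q a) (hX _ ⟨L, hL, rfl⟩)
      have h2 : pr (VL C L) (X a) = X (pr (WL C L) a) := this
      rw [pr_of_mem' (le_WL C L haL)] at h2
      rw [← h2]; exact pr_mem _ _
    refine sub L b (fun x hx => (mem_RN fun Q hQ => ?_).1) _ hXa
    by_cases h : a ∈ Q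
    · left
      exact (sInf_le (show Q ∈ {Q | Q ∈ N₁ ∧ a ∈ Q} from ⟨hQ, h⟩) : L ≤ Q) hx
    · right
      intro y hy
      by_contra hne
      have := hr Q hQ y hy
      rw [InnerProductSpace.rankOne_apply] at this
      exact h ((Q.smul_mem_iff hne).1 this)

end P9
end OS

namespace OS
open ContinuousLinearMap Filter Topology
set_option linter.unusedSectionVars false
set_option linter.unusedVariables false
set_option linter.style.haveILetI false
section P10
variable {H₁ H₂ K₁ K₂ T₁ T₂ : Type*}
    [NormedAddCommGroup H₁] [InnerProductSpace ℂ H₁] [CompleteSpace H₁]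
    [NormedAddCommGroup H₂] [InnerProductSpace ℂ H₂] [CompleteSpace H₂]
    [NormedAddCommGroup K₁] [InnerProductSpace ℂ K₁] [CompleteSpace K₁]
    [NormedAddCommGroup K₂] [InnerProductSpace ℂ K₂] [CompleteSpace K₂]
    [NormedAddCommGroup T₁] [InnerProductSpace ℂ T₁] [CompleteSpace T₁]
    [NormedAddCommGroup T₂] [InnerProductSpace ℂ T₂] [CompleteSpace T₂]
    {t₁ : H₁ → K₁ → T₁} {t₂ : H₂ → K₂ → T₂}

lemma tens_norm (ht₁ : IsTensorEmbedding t₁) (ht₂ : IsTensorEmbedding t₂) (S : H₁ →L[ℂ] H₂)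
    (R : K₁ →L[ℂ] K₂) (ζ : T₁) : ‖tens ht₁ ht₂ S R ζ‖ ≤ ‖S‖ * ‖R‖ * ‖ζ‖ := by
  refine (tL_dense ht₁).induction_on (p := fun ζ => ‖tens ht₁ ht₂ S R ζ‖ ≤ ‖S‖ * ‖R‖ * ‖ζ‖) ζ
    (isClosed_le (by fun_prop) (by fun_prop)) fun x => ?_
  have e : tens ht₁ ht₂ S R (tL ht₁ x) =
      tL ht₂ (TensorProduct.map S.toLinearMap R.toLinearMap x) := by
    induction x with
    | zero => simp
    | tmul a b => simp
    | add a b ha hb => simp [ha, hb]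
  rw [e, tL_norm, tL_norm]
  have : TensorProduct.map S.toLinearMap R.toLinearMap x =
    TensorProduct.map S.toLinearMap LinearMap.id
      (TensorProduct.map LinearMap.id R.toLinearMap x) := by
    rw [← LinearMap.comp_apply, ← TensorProduct.map_comp]; rfl
  rw [this, mul_assoc]
  exact (norm_map_left _ _).trans (by gcongr; exact norm_map_right _ _)

lemma Lx_norm (ht₁ : IsTensorEmbedding t₁) (x : H₁) : ‖Lx ht₁ x‖ ≤ ‖x‖ :=
  opNorm_le_bound _ (norm_nonneg _) fun y => by rw [Lx_apply, t_norm ht₁]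

lemma sl_norm (ht₁ : IsTensorEmbedding t₁) (ht₂ : IsTensorEmbedding t₂) (x : H₁) (y : H₂)
    (T : T₁ →L[ℂ] T₂) : ‖sl ht₁ ht₂ x y T‖ ≤ ‖y‖ * (‖T‖ * ‖x‖) := by
  rw [sl]
  refine (opNorm_comp_le _ _).trans ?_
  rw [LinearIsometryEquiv.norm_map]
  have h1 := opNorm_comp_le T (Lx ht₁ x)
  have h2 := Lx_norm ht₁ x
  have h3 := Lx_norm ht₂ y
  gcongr
  exact h1.trans (by gcongr)

lemma aT_tens (ht₁ : IsTensorEmbedding t₁) (ht₂ : IsTensorEmbedding t₂) (S : H₁ →L[ℂ] H₂)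
    (R : K₁ →L[ℂ] K₂) (B : H₂ →L[ℂ] H₂) (A : H₁ →L[ℂ] H₁) :
    aT ht₂ B ∘L tens ht₁ ht₂ S R ∘L aT ht₁ A = tens ht₁ ht₂ (B ∘L S ∘L A) R :=
  t_ext ht₁ fun x y => by simp

lemma aT_rank (ht₂ : IsTensorEmbedding t₂) (a b : H₂) (w : T₂) :
    aT ht₂ (InnerProductSpace.rankOne ℂ a b) w = t₂ a (adjoint (Lx ht₂ b) w) := by
  have : aT ht₂ (InnerProductSpace.rankOne ℂ a b) = Lx ht₂ a ∘L adjoint (Lx ht₂ b) := by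
    refine t_ext ht₂ fun x y => ?_
    have : adjoint (Lx ht₂ b) (t₂ x y) = ⟪b, x⟫ • y := by
      refine ext_inner_left ℂ fun l => ?_
      rw [adjoint_inner_right, Lx_apply, t_inner ht₂, inner_smul_right]
    simp [this, t_smul_left ht₂, t_smul_right ht₂]
  rw [this]; rfl

lemma Rk_aT (ht₂ : IsTensorEmbedding t₂) (A : H₂ →L[ℂ] H₂) (l : K₂) (w : T₂) :
    adjoint (Rk ht₂ l) (aT ht₂ A w) = A (adjoint (Rk ht₂ l) w) := by
  refine ext_inner_left ℂ fun y => ?_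
  rw [adjoint_inner_right, ← adjoint_inner_left A, adjoint_inner_right, Rk_apply, Rk_apply,
    ← adjoint_inner_left, aT_adjoint, aT_apply]

lemma inner_aT (ht₂ : IsTensorEmbedding t₂) (A : H₂ →L[ℂ] H₂) (y : H₂) (l : K₂) (w : T₂) :
    ⟪t₂ y l, aT ht₂ A w⟫ = ⟪y, A (adjoint (Rk ht₂ l) w)⟫ := by
  rw [← Rk_aT, adjoint_inner_right, Rk_apply]

lemma isProj_aT (ht₂ : IsTensorEmbedding t₂) {p : H₂ →L[ℂ] H₂} (hp : IsProj p) :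
    IsProj (aT ht₂ p) := by
  refine ⟨by rw [← aT_comp, hp.1], ?_⟩
  rw [isSelfAdjoint_iff', aT_adjoint, isSelfAdjoint_iff'.1 hp.2]

lemma pyth {P1 P2 : T₁ →L[ℂ] T₁} (h1 : IsProj P1) (h2 : IsProj P2) (h : P1 ∘L P2 = 0) (a b : T₁) :
    ‖P1 a + P2 b‖ ^ 2 = ‖P1 a‖ ^ 2 + ‖P2 b‖ ^ 2 := by
  have : ⟪P1 a, P2 b⟫ = 0 := by
    rw [sa_inner h1.2, show P1 (P2 b) = 0 from congrArg (fun q : T₁ →L[ℂ] T₁ => q b) h, inner_zero_right]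
  rw [@norm_add_sq ℂ, this]; simp

lemma pyth_le {P1 P2 : T₁ →L[ℂ] T₁} (h1 : IsProj P1) (h2 : IsProj P2) (h : P1 ∘L P2 = 0) (a : T₁) :
    ‖P1 a‖ ^ 2 + ‖P2 a‖ ^ 2 ≤ ‖a‖ ^ 2 := by
  have h' : P2 ∘L P1 = 0 := by
    have := congrArg adjoint h
    rwa [adjoint_comp, isSelfAdjoint_iff'.1 h1.2, isSelfAdjoint_iff'.1 h2.2, map_zero] at this
  have hs : IsProj (P1 + P2) := by
    refine ⟨?_, h1.2.add h2.2⟩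
    rw [comp_add, add_comp, add_comp, h1.1, h2.1, h, h', add_zero, zero_add]
  rw [← pyth h1 h2 h]
  have := hs.norm_le a
  exact pow_le_pow_left₀ (norm_nonneg _) this 2

lemma block_norm {P1 P2 : T₁ →L[ℂ] T₁} {Q1 Q2 : T₂ →L[ℂ] T₂} (h1 : IsProj P1) (h2 : IsProj P2)
    (h : P1 ∘L P2 = 0) (k1 : IsProj Q1) (k2 : IsProj Q2) (k : Q1 ∘L Q2 = 0) {V1 V2 : T₁ →L[ℂ] T₂}
    (e1 : V1 = Q1 ∘L V1 ∘L P1) (e2 : V2 = Q2 ∘L V2 ∘L P2) {c : ℝ}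
    (b1 : ∀ z, ‖V1 z‖ ^ 2 ≤ c ^ 2 * ‖z‖ ^ 2) (b2 : ∀ z, ‖V2 z‖ ^ 2 ≤ c ^ 2 * ‖z‖ ^ 2) (z : T₁) :
    ‖(V1 + V2) z‖ ^ 2 ≤ c ^ 2 * ‖z‖ ^ 2 := by
  have f1 : V1 z = Q1 (V1 (P1 z)) := congrArg (fun q : T₁ →L[ℂ] T₂ => q z) e1
  have f2 : V2 z = Q2 (V2 (P2 z)) := congrArg (fun q : T₁ →L[ℂ] T₂ => q z) e2
  have := pyth k1 k2 k (V1 (P1 z)) (V2 (P2 z))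
  have g1 : ‖Q1 (V1 (P1 z))‖ ^ 2 ≤ ‖V1 (P1 z)‖ ^ 2 := pow_le_pow_left₀ (norm_nonneg _) (k1.norm_le _) 2
  have g2 : ‖Q2 (V2 (P2 z))‖ ^ 2 ≤ ‖V2 (P2 z)‖ ^ 2 := pow_le_pow_left₀ (norm_nonneg _) (k2.norm_le _) 2
  rw [add_apply, f1, f2, this]
  have := pyth_le h1 h2 h z
  have := b1 (P1 z)
  have := b2 (P2 z)
  nlinarith [sq_nonneg c]

/-- good family of pairs -/
structure GP (P : Set ((H₁ →L[ℂ] H₁) × (H₂ →L[ℂ] H₂))) : Prop where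
  p1 : ∀ p ∈ P, IsProj p.1
  p2 : ∀ p ∈ P, IsProj p.2
  one : ((1 : H₁ →L[ℂ] H₁), (1 : H₂ →L[ℂ] H₂)) ∈ P
  mul : ∀ p ∈ P, ∀ q ∈ P, (p.1 ∘L q.1, p.2 ∘L q.2) ∈ P
  cpl : ∀ p ∈ P, (1 - p.1, 1 - p.2) ∈ P
  c1 : ∀ p ∈ P, ∀ q ∈ P, p.1 ∘L q.1 = q.1 ∘L p.1
  c2 : ∀ p ∈ P, ∀ q ∈ P, p.2 ∘L q.2 = q.2 ∘L p.2

/-- amplified intertwining -/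
def AI (ht₁ : IsTensorEmbedding t₁) (ht₂ : IsTensorEmbedding t₂)
    (P : Set ((H₁ →L[ℂ] H₁) × (H₂ →L[ℂ] H₂))) (T : T₁ →L[ℂ] T₂) : Prop :=
  ∀ p ∈ P, aT ht₂ p.2 ∘L T = T ∘L aT ht₁ p.1

/-- the generators -/
def S0 (ht₁ : IsTensorEmbedding t₁) (ht₂ : IsTensorEmbedding t₂)
    (P : Set ((H₁ →L[ℂ] H₁) × (H₂ →L[ℂ] H₂))) (T : T₁ →L[ℂ] T₂) : Set (T₁ →L[ℂ] T₂) :=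
  {W | ∃ A ∈ Itw P, ∃ x y, W = tens ht₁ ht₂ A (sl ht₁ ht₂ x y T)}

lemma AI_slice {ht₁ : IsTensorEmbedding t₁} {ht₂ : IsTensorEmbedding t₂}
    {P : Set ((H₁ →L[ℂ] H₁) × (H₂ →L[ℂ] H₂))} {T : T₁ →L[ℂ] T₂} (h : AI ht₁ ht₂ P T) (k l) :
    adjoint (Rk ht₂ l) ∘L T ∘L Rk ht₁ k ∈ Itw P := by
  intro p hp
  ext x
  have := congrArg (fun q : T₁ →L[ℂ] T₂ => q (t₁ x k)) (h p hp)
  simp only [comp_apply, aT_apply] at this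
  simp only [comp_apply, Rk_apply, ← this, Rk_aT]

lemma AI_of_slice {ht₁ : IsTensorEmbedding t₁} {ht₂ : IsTensorEmbedding t₂}
    {P : Set ((H₁ →L[ℂ] H₁) × (H₂ →L[ℂ] H₂))} {T : T₁ →L[ℂ] T₂}
    (h : ∀ k l, adjoint (Rk ht₂ l) ∘L T ∘L Rk ht₁ k ∈ Itw P) : AI ht₁ ht₂ P T := by
  intro p hp
  refine t_ext ht₁ fun x k => t_inner_ext ht₂ fun y l => ?_
  have := congrArg (fun q : H₁ →L[ℂ] H₂ => q x) (h k l p hp)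
  simp only [comp_apply, Rk_apply] at this
  rw [comp_apply, inner_aT, this, comp_apply, aT_apply, adjoint_inner_right, Rk_apply]

lemma S0_comp (ht₁ : IsTensorEmbedding t₁) (ht₂ : IsTensorEmbedding t₂)
    {P : Set ((H₁ →L[ℂ] H₁) × (H₂ →L[ℂ] H₂))} {T V : T₁ →L[ℂ] T₂} {B : H₂ →L[ℂ] H₂}
    {A : H₁ →L[ℂ] H₁} (hB : ∀ p ∈ P, p.2 ∘L B = B ∘L p.2) (hA : ∀ p ∈ P, p.1 ∘L A = A ∘L p.1)
    (hV : V ∈ bicl (S0 ht₁ ht₂ P T)) : aT ht₂ B ∘L V ∘L aT ht₁ A ∈ bicl (S0 ht₁ ht₂ P T) := by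
  refine bicl_comp _ _ ?_ hV
  rintro _ ⟨S, hS, x, y, rfl⟩
  rw [aT_tens]
  refine subset_bicl ⟨_, fun p hp => ?_, x, y, rfl⟩
  have := hS p hp
  calc p.2 ∘L (B ∘L S ∘L A) = (p.2 ∘L B) ∘L S ∘L A := rfl
    _ = B ∘L (p.2 ∘L S) ∘L A := by rw [hB p hp]; rfl
    _ = B ∘L S ∘L (p.1 ∘L A) := by rw [this]; rfl
    _ = _ := by rw [hA p hp]; rfl

lemma S0_left (ht₁ : IsTensorEmbedding t₁) (ht₂ : IsTensorEmbedding t₂)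
    {P : Set ((H₁ →L[ℂ] H₁) × (H₂ →L[ℂ] H₂))} {T V : T₁ →L[ℂ] T₂} {B : H₂ →L[ℂ] H₂}
    (hB : ∀ p ∈ P, p.2 ∘L B = B ∘L p.2)
    (hV : V ∈ bicl (S0 ht₁ ht₂ P T)) : aT ht₂ B ∘L V ∈ bicl (S0 ht₁ ht₂ P T) := by
  have := S0_comp ht₁ ht₂ hB (A := 1) (fun p _ => rfl) hV
  rw [aT_one] at this; exact this

lemma S0_right (ht₁ : IsTensorEmbedding t₁) (ht₂ : IsTensorEmbedding t₂)
    {P : Set ((H₁ →L[ℂ] H₁) × (H₂ →L[ℂ] H₂))} {T V : T₁ →L[ℂ] T₂}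
    {A : H₁ →L[ℂ] H₁} (hA : ∀ p ∈ P, p.1 ∘L A = A ∘L p.1)
    (hV : V ∈ bicl (S0 ht₁ ht₂ P T)) : V ∘L aT ht₁ A ∈ bicl (S0 ht₁ ht₂ P T) := by
  have := S0_comp ht₁ ht₂ (B := 1) (fun p _ => rfl) hA hV
  rw [aT_one] at this; exact this

lemma ap {E F : Type*} [NormedAddCommGroup E] [NormedSpace ℂ E] [NormedAddCommGroup F]
    [NormedSpace ℂ F] {A B : E →L[ℂ] F} (h : A = B) (x : E) : A x = B x := by rw [h]

/-- finite-stage property -/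
structure Gd (ht₁ : IsTensorEmbedding t₁) (ht₂ : IsTensorEmbedding t₂)
    (P : Set ((H₁ →L[ℂ] H₁) × (H₂ →L[ℂ] H₂))) (T : T₁ →L[ℂ] T₂) (n n' : H₁ →L[ℂ] H₂)
    (f : H₁ →L[ℂ] H₁) (e : H₁) (s : Finset ((H₁ →L[ℂ] H₁) × (H₂ →L[ℂ] H₂)))
    (g : H₁ →L[ℂ] H₁) (g' : H₂ →L[ℂ] H₂) (V : T₁ →L[ℂ] T₂) (φ : H₁ →L[ℂ] H₁) : Prop where
  mem : V ∈ bicl (S0 ht₁ ht₂ P T)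
  Vc : V = aT ht₂ g' ∘L V ∘L aT ht₁ g
  Vb : ∀ z, ‖V z‖ ^ 2 ≤ (‖n‖ * ‖n'‖ * ‖T‖) ^ 2 * ‖z‖ ^ 2
  pc : φ = g ∘L φ ∘L g
  pb : ∀ z, ‖φ z‖ ^ 2 ≤ 1 ^ 2 * ‖z‖ ^ 2
  pf : φ ∘L f = φ
  ad : ∀ z, (z = 1 ∨ ∃ z', (z, z') ∈ s) → φ (z (g e)) = z (g e) ∧
    ∀ k, V (t₁ (z (g e)) k) = aT ht₂ (n ∘L φ ∘L adjoint n') (T (t₁ (z (g e)) k))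

lemma Itw_adj {P : Set ((H₁ →L[ℂ] H₁) × (H₂ →L[ℂ] H₂))} (hP : GP P) {n : H₁ →L[ℂ] H₂}
    (hn : n ∈ Itw P) {p} (hp : p ∈ P) : p.1 ∘L adjoint n = adjoint n ∘L p.2 := by
  have := congrArg adjoint (hn p hp)
  rw [adjoint_comp, adjoint_comp, isSelfAdjoint_iff'.1 (hP.p1 p hp).2,
    isSelfAdjoint_iff'.1 (hP.p2 p hp).2] at this
  exact this.symm

lemma corner_ext {V : T₁ →L[ℂ] T₂} {P P0 : T₁ →L[ℂ] T₁} {Q Q0 : T₂ →L[ℂ] T₂}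
    (h : V = Q ∘L V ∘L P) (hQ : Q0 ∘L Q = Q) (hP : P ∘L P0 = P) : V = Q0 ∘L V ∘L P0 := by
  calc V = Q ∘L V ∘L P := h
    _ = (Q0 ∘L Q) ∘L V ∘L (P ∘L P0) := by rw [hQ, hP]
    _ = Q0 ∘L (Q ∘L V ∘L P) ∘L P0 := rfl
    _ = _ := by rw [← h]

lemma Gd_base (ht₁ : IsTensorEmbedding t₁) (ht₂ : IsTensorEmbedding t₂)
    {P : Set ((H₁ →L[ℂ] H₁) × (H₂ →L[ℂ] H₂))} (hP : GP P) {T : T₁ →L[ℂ] T₂}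
    {n n' : H₁ →L[ℂ] H₂} (hn : n ∈ Itw P) (hn' : n' ∈ Itw P) {f : H₁ →L[ℂ] H₁} (hf : IsProj f)
    {e : H₁} (hfe : ∀ p ∈ P, f (p.1 e) = p.1 e) {p} (hp : p ∈ P) :
    ∃ V φ, Gd ht₁ ht₂ P T n n' f e ∅ p.1 p.2 V φ := by
  by_cases hv : p.1 e = 0
  · refine ⟨0, 0, ⟨Submodule.zero_mem _, by simp, fun z => ?_, by simp, fun z => ?_, by simp, ?_⟩⟩
    · simp; positivity
    · simp
    · intro z _
      rw [hv]
      have : ∀ k, t₁ 0 k = 0 := fun k => (Rk ht₁ k).map_zero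
      simp [this]
  · set v := p.1 e with hvd
    have hgv : p.1 v = v := (hP.p1 p hp).idem e
    have hv0 : (0 : ℝ) < ‖v‖ := norm_pos_iff.2 hv
    set c : ℂ := ((‖v‖ ^ 2 : ℝ) : ℂ)⁻¹ with hc
    have hcn : ‖c‖ = (‖v‖ ^ 2)⁻¹ := by simp [hc]
    have hvv : c * ⟪v, v⟫ = 1 := by
      rw [inner_self_eq_norm_sq_to_K, hc]; push_cast
      exact inv_mul_cancel₀ (pow_ne_zero 2 (by exact_mod_cast hv0.ne'))
    have rk : ∀ x, (c • InnerProductSpace.rankOne ℂ v v) x = (c * ⟪v, x⟫) • v := fun x => by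
      simp [smul_smul]
    have rkv : (c • InnerProductSpace.rankOne ℂ v v) v = v := by rw [rk, hvv, one_smul]
    have hnp := hn p hp
    refine ⟨c • tens ht₁ ht₂ (n ∘L p.1) (sl ht₁ ht₂ v (n' v) T), c • InnerProductSpace.rankOne ℂ v v,
      ⟨?_, ?_, ?_, ?_, ?_, ?_, ?_⟩⟩
    · refine Submodule.smul_mem _ _ (subset_bicl ⟨_, fun q hq => ?_, _, _, rfl⟩)
      calc q.2 ∘L n ∘L p.1 = (q.2 ∘L n) ∘L p.1 := rfl
        _ = n ∘L (q.1 ∘L p.1) := by rw [hn q hq]; rfl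
        _ = _ := by rw [hP.c1 q hq p hp]; rfl
    · rw [smul_comp, comp_smul, aT_tens]
      congr 2
      calc n ∘L p.1 = n ∘L (p.1 ∘L p.1) ∘L p.1 := by rw [(hP.p1 p hp).1, (hP.p1 p hp).1]
        _ = (n ∘L p.1) ∘L p.1 ∘L p.1 := rfl
        _ = (p.2 ∘L n) ∘L p.1 ∘L p.1 := by rw [hnp]
        _ = _ := rfl
    · intro z
      have h1 := tens_norm ht₁ ht₂ (n ∘L p.1) (sl ht₁ ht₂ v (n' v) T) z
      have h2 := sl_norm ht₁ ht₂ v (n' v) T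
      have h3 : ‖n ∘L p.1‖ ≤ ‖n‖ := opNorm_le_bound _ (norm_nonneg _) fun x =>
        (n.le_opNorm _).trans (by gcongr; exact (hP.p1 p hp).norm_le x)
      have h4 := n'.le_opNorm v
      rw [← mul_pow]
      refine pow_le_pow_left₀ (norm_nonneg _) ?_ 2
      rw [smul_apply, norm_smul, hcn]
      calc (‖v‖ ^ 2)⁻¹ * ‖tens ht₁ ht₂ (n ∘L p.1) (sl ht₁ ht₂ v (n' v) T) z‖
          ≤ (‖v‖ ^ 2)⁻¹ * (‖n‖ * ((‖n'‖ * ‖v‖) * (‖T‖ * ‖v‖)) * ‖z‖) := by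
            gcongr
            refine h1.trans ?_
            gcongr
            exact h2.trans (by gcongr)
        _ = _ := by field_simp
    · ext x
      show _ = p.1 ((c • InnerProductSpace.rankOne ℂ v v) (p.1 x))
      rw [rk, rk, map_smul, hgv, ← sa_inner (hP.p1 p hp).2, hgv]
    · intro x
      rw [← mul_pow]
      refine pow_le_pow_left₀ (norm_nonneg _) ?_ 2
      rw [rk, norm_smul, norm_mul, hcn]
      have := norm_inner_le_norm (𝕜 := ℂ) v x
      calc (‖v‖ ^ 2)⁻¹ * ‖⟪v, x⟫‖ * ‖v‖ ≤ (‖v‖ ^ 2)⁻¹ * (‖v‖ * ‖x‖) * ‖v‖ := by gcongr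
        _ = _ := by field_simp
    · ext x
      rw [comp_apply, rk, rk, ← sa_inner hf.2, hfe p hp]
    · rintro z (rfl | ⟨_, h⟩)
      swap
      · simp at h
      refine ⟨rkv, fun k => ?_⟩
      have e1 : n ∘L (c • InnerProductSpace.rankOne ℂ v v) ∘L adjoint n' =
          c • InnerProductSpace.rankOne ℂ (n v) (n' v) := by
        ext x
        simp [adjoint_inner_right]
      rw [e1, aT_smul, smul_apply, smul_apply, aT_rank]
      show c • tens ht₁ ht₂ (n ∘L p.1) (sl ht₁ ht₂ v (n' v) T) (t₁ v k) = _
      rw [tens_apply, comp_apply, hgv]; rfl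

lemma Gd_fin (ht₁ : IsTensorEmbedding t₁) (ht₂ : IsTensorEmbedding t₂)
    {P : Set ((H₁ →L[ℂ] H₁) × (H₂ →L[ℂ] H₂))} (hP : GP P) {T : T₁ →L[ℂ] T₂}
    (hT : AI ht₁ ht₂ P T)
    {n n' : H₁ →L[ℂ] H₂} (hn : n ∈ Itw P) (hn' : n' ∈ Itw P) {f : H₁ →L[ℂ] H₁} (hf : IsProj f)
    {e : H₁} (hfe : ∀ p ∈ P, f (p.1 e) = p.1 e)
    (s : Finset ((H₁ →L[ℂ] H₁) × (H₂ →L[ℂ] H₂))) : (∀ q ∈ s, q ∈ P) → ∀ p ∈ P,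
    ∃ V φ, Gd ht₁ ht₂ P T n n' f e s p.1 p.2 V φ := by
  classical
  induction s using Finset.induction_on with
  | empty => exact fun _ p hp => Gd_base ht₁ ht₂ hP hn hn' hf hfe hp
  | insert q s hqs ih =>
    intro hs p hp
    have hq := hs q (Finset.mem_insert_self _ _)
    have hs' : ∀ r ∈ s, r ∈ P := fun r hr => hs r (Finset.mem_insert_of_mem hr)
    have m1 := hP.mul p hp q hq
    have m2 := hP.mul p hp _ (hP.cpl q hq)
    obtain ⟨V1, φ1, G1⟩ := ih hs' _ m1
    obtain ⟨V2, φ2, G2⟩ := ih hs' _ m2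
    dsimp only at G1 G2
    set g1 := p.1 ∘L q.1 with hg1
    set g2 := p.1 ∘L (1 - q.1) with hg2
    set g1' := p.2 ∘L q.2 with hg1'
    set g2' := p.2 ∘L (1 - q.2) with hg2'
    have z1 : q.1 ∘L (1 - q.1) = 0 := by rw [comp_sub, (hP.p1 q hq).1]; exact sub_self _
    have z2 : q.2 ∘L (1 - q.2) = 0 := by rw [comp_sub, (hP.p2 q hq).1]; exact sub_self _
    have o12 : g1 ∘L g2 = 0 := by
      rw [hg2, hP.c1 p hp _ (hP.cpl q hq), hg1]
      calc (p.1 ∘L q.1) ∘L (1 - q.1) ∘L p.1 = p.1 ∘L (q.1 ∘L (1 - q.1)) ∘L p.1 := rfl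
        _ = 0 := by rw [z1]; simp
    have o12' : g1' ∘L g2' = 0 := by
      rw [hg2', hP.c2 p hp _ (hP.cpl q hq), hg1']
      calc (p.2 ∘L q.2) ∘L (1 - q.2) ∘L p.2 = p.2 ∘L (q.2 ∘L (1 - q.2)) ∘L p.2 := rfl
        _ = 0 := by rw [z2]; simp
    have o21 : g2 ∘L g1 = 0 := by rw [hP.c1 _ m2 _ m1]; exact o12
    have ga : ∀ (x), p.1 x = g1 x + g2 x := fun x => by simp [hg1, hg2]
    have pg1 : p.1 ∘L g1 = g1 := by
      rw [hg1]; calc p.1 ∘L p.1 ∘L q.1 = (p.1 ∘L p.1) ∘L q.1 := rfl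
        _ = _ := by rw [(hP.p1 p hp).1]
    have pg2 : p.1 ∘L g2 = g2 := by
      rw [hg2]; calc p.1 ∘L p.1 ∘L (1 - q.1) = (p.1 ∘L p.1) ∘L (1 - q.1) := rfl
        _ = _ := by rw [(hP.p1 p hp).1]
    have pg1' : p.2 ∘L g1' = g1' := by
      rw [hg1']; calc p.2 ∘L p.2 ∘L q.2 = (p.2 ∘L p.2) ∘L q.2 := rfl
        _ = _ := by rw [(hP.p2 p hp).1]
    have pg2' : p.2 ∘L g2' = g2' := by
      rw [hg2']; calc p.2 ∘L p.2 ∘L (1 - q.2) = (p.2 ∘L p.2) ∘L (1 - q.2) := rfl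
        _ = _ := by rw [(hP.p2 p hp).1]
    have gp1 : g1 ∘L p.1 = g1 := by rw [hP.c1 _ m1 _ hp, pg1]
    have gp2 : g2 ∘L p.1 = g2 := by rw [hP.c1 _ m2 _ hp, pg2]
    have i1 : IsProj g1 := hP.p1 _ m1
    have i2 : IsProj g2 := hP.p1 _ m2
    have i1' : IsProj g1' := hP.p2 _ m1
    have i2' : IsProj g2' := hP.p2 _ m2
    have zcom : ∀ z, (z = 1 ∨ ∃ z', (z, z') ∈ s) → ∀ r ∈ P, r.1 ∘L z = z ∘L r.1 := by
      rintro z (rfl | ⟨z', hz⟩) r hr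
      · rfl
      · exact hP.c1 r hr _ (hs' _ hz)
    have cr : ∀ (r) (hr : r ∈ P) (φ : H₁ →L[ℂ] H₁) (hφ : φ = r.1 ∘L φ ∘L r.1) (u) (hu : r.1 u = 0) (k),
        aT ht₂ (n ∘L φ ∘L adjoint n') (T (t₁ u k)) = 0 := by
      intro r hr φ hφ u hu k
      have h1 : n ∘L φ ∘L adjoint n' = (n ∘L φ ∘L adjoint n') ∘L r.2 := by
        have h0 : φ = φ ∘L r.1 := by
          calc φ = r.1 ∘L φ ∘L r.1 := hφ
            _ = r.1 ∘L φ ∘L (r.1 ∘L r.1) := by rw [(hP.p1 r hr).1]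
            _ = (r.1 ∘L φ ∘L r.1) ∘L r.1 := rfl
            _ = _ := by rw [← hφ]
        calc n ∘L φ ∘L adjoint n' = n ∘L (φ ∘L r.1) ∘L adjoint n' := by rw [← h0]
          _ = n ∘L φ ∘L (r.1 ∘L adjoint n') := rfl
          _ = _ := by rw [Itw_adj hP hn' hr]; rfl
      rw [h1, aT_comp, comp_apply]
      have h2 := ap (hT r hr) (t₁ u k)
      rw [comp_apply, comp_apply, aT_apply, hu] at h2
      rw [h2, show t₁ 0 k = 0 from (Rk ht₁ k).map_zero, map_zero, map_zero]
    have ad' : ∀ z, (z = 1 ∨ ∃ z', (z, z') ∈ insert q s) → ∃ u1 u2, z (p.1 e) = u1 + u2 ∧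
        g1 u1 = u1 ∧ g2 u2 = u2 ∧ φ1 u1 = u1 ∧ φ2 u2 = u2 ∧
        (∀ k, V1 (t₁ u1 k) = aT ht₂ (n ∘L φ1 ∘L adjoint n') (T (t₁ u1 k))) ∧
        (∀ k, V2 (t₁ u2 k) = aT ht₂ (n ∘L φ2 ∘L adjoint n') (T (t₁ u2 k))) := by
      have main : ∀ z, (z = 1 ∨ ∃ z', (z, z') ∈ s) → ∃ u1 u2, z (p.1 e) = u1 + u2 ∧
          g1 u1 = u1 ∧ g2 u2 = u2 ∧ φ1 u1 = u1 ∧ φ2 u2 = u2 ∧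
          (∀ k, V1 (t₁ u1 k) = aT ht₂ (n ∘L φ1 ∘L adjoint n') (T (t₁ u1 k))) ∧
          (∀ k, V2 (t₁ u2 k) = aT ht₂ (n ∘L φ2 ∘L adjoint n') (T (t₁ u2 k))) := by
        intro z hz
        have a1 := ap (zcom z hz _ m1) (g1 e)
        have a2 := ap (zcom z hz _ m2) (g2 e)
        refine ⟨z (g1 e), z (g2 e), by rw [ga, map_add], ?_, ?_, (G1.ad z hz).1, (G2.ad z hz).1,
          (G1.ad z hz).2, (G2.ad z hz).2⟩
        · exact a1.trans (congrArg z (i1.idem e))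
        · exact a2.trans (congrArg z (i2.idem e))
      rintro z (rfl | ⟨z', hz⟩)
      · exact main 1 (Or.inl rfl)
      · rcases Finset.mem_insert.1 hz with rfl | hz
        · have hk : ∀ k, t₁ 0 k = 0 := fun k => (Rk ht₁ k).map_zero
          refine ⟨g1 e, 0, ?_, i1.idem e, map_zero _, (G1.ad 1 (Or.inl rfl)).1, map_zero _,
            (G1.ad 1 (Or.inl rfl)).2, fun k => by simp [hk]⟩
          rw [add_zero]
          exact ap (hP.c1 _ hq _ hp) e
        · exact main z (Or.inr ⟨z', hz⟩)
    have amp12 : aT ht₁ g1 ∘L aT ht₁ g2 = 0 := by rw [← aT_comp, o12, aT_zero]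
    have amp12' : aT ht₂ g1' ∘L aT ht₂ g2' = 0 := by rw [← aT_comp, o12', aT_zero]
    refine ⟨V1 + V2, φ1 + φ2, ⟨Submodule.add_mem _ G1.mem G2.mem, ?_, ?_, ?_, ?_, ?_, ?_⟩⟩
    · rw [add_comp, comp_add]
      congr 1
      · exact corner_ext G1.Vc (by rw [← aT_comp, pg1']) (by rw [← aT_comp, gp1])
      · exact corner_ext G2.Vc (by rw [← aT_comp, pg2']) (by rw [← aT_comp, gp2])
    · exact block_norm (isProj_aT ht₁ i1) (isProj_aT ht₁ i2) amp12 (isProj_aT ht₂ i1')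
        (isProj_aT ht₂ i2') amp12' G1.Vc G2.Vc G1.Vb G2.Vb
    · rw [add_comp, comp_add]
      congr 1
      · exact corner_ext G1.pc pg1 gp1
      · exact corner_ext G2.pc pg2 gp2
    · exact block_norm i1 i2 o12 i1 i2 o12 G1.pc G2.pc G1.pb G2.pb
    · rw [add_comp, G1.pf, G2.pf]
    · intro z hz
      obtain ⟨u1, u2, hu, h1, h2, h3, h4, h5, h6⟩ := ad' z hz
      have k12 : g1 u2 = 0 := by rw [← h2]; exact ap o12 u2
      have k21 : g2 u1 = 0 := by rw [← h1]; exact ap o21 u1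
      have f1 : φ1 u2 = 0 := by
        rw [ap G1.pc u2]; show g1 (φ1 (g1 u2)) = 0; rw [k12, map_zero, map_zero]
      have f2 : φ2 u1 = 0 := by
        rw [ap G2.pc u1]; show g2 (φ2 (g2 u1)) = 0; rw [k21, map_zero, map_zero]
      rw [hu]
      refine ⟨by simp [h3, h4, f1, f2], fun k => ?_⟩
      have v1 : V1 (t₁ u2 k) = 0 := by
        rw [ap G1.Vc]; show aT ht₂ g1' (V1 (aT ht₁ g1 (t₁ u2 k))) = 0
        rw [aT_apply, k12, show t₁ 0 k = 0 from (Rk ht₁ k).map_zero, map_zero, map_zero]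
      have v2 : V2 (t₁ u1 k) = 0 := by
        rw [ap G2.Vc]; show aT ht₂ g2' (V2 (aT ht₁ g2 (t₁ u1 k))) = 0
        rw [aT_apply, k21, show t₁ 0 k = 0 from (Rk ht₁ k).map_zero, map_zero, map_zero]
      have c1 := cr _ m1 φ1 G1.pc u2 k12 k
      have c2 := cr _ m2 φ2 G2.pc u1 k21 k
      rw [t_add_left ht₁, map_add, map_add, map_add, add_comp, comp_add, aT_add]
      simp only [add_apply]
      rw [v1, v2, c1, c2, h5, h6]

lemma cyc_ext {F : Type*} [NormedAddCommGroup F] [NormedSpace ℂ F]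
    {P : Set ((H₁ →L[ℂ] H₁) × (H₂ →L[ℂ] H₂))} {e : H₁} {W : Submodule ℂ H₁}
    (hW : W = Submodule.span ℂ {z | ∃ p ∈ P, z = p.1 e}) (A B : H₁ →L[ℂ] F)
    (h : ∀ p ∈ P, A (p.1 e) = B (p.1 e)) (x) : A (pr W x) = B (pr W x) := by
  have h1 : W.topologicalClosure ≤ LinearMap.eqLocus A.toLinearMap B.toLinearMap := by
    refine Submodule.topologicalClosure_minimal _ ?_ (isClosed_eq A.continuous B.continuous)
    rw [hW]
    refine Submodule.span_le.2 ?_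
    rintro _ ⟨p, hp, rfl⟩
    exact h p hp
  exact h1 (pr_mem W x)

lemma cyc_corner (ht₁ : IsTensorEmbedding t₁) (ht₂ : IsTensorEmbedding t₂)
    {P : Set ((H₁ →L[ℂ] H₁) × (H₂ →L[ℂ] H₂))} (hP : GP P) {T : T₁ →L[ℂ] T₂}
    (hT : AI ht₁ ht₂ P T)
    {n n' : H₁ →L[ℂ] H₂} (hn : n ∈ Itw P) (hn' : n' ∈ Itw P) (e : H₁) (W : Submodule ℂ H₁)
    (hW : W = Submodule.span ℂ {z | ∃ p ∈ P, z = p.1 e})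
    (hcom : ∀ p ∈ P, p.1 ∘L pr W = pr W ∘L p.1) :
    aT ht₂ (n ∘L pr W ∘L adjoint n') ∘L T ∘L aT ht₁ (pr W) ∈ bicl (S0 ht₁ ht₂ P T) := by
  classical
  have hfe : ∀ p ∈ P, pr W (p.1 e) = p.1 e := fun p hp =>
    pr_of_mem' (by rw [hW]; exact Submodule.subset_span ⟨p, hp, rfl⟩)
  choose V φ hG using fun s : Finset P =>
    Gd_fin ht₁ ht₂ hP hT hn hn' (isProj_pr W) hfe (s.map (Function.Embedding.subtype _))
      (by simp only [Finset.mem_map]; rintro _ ⟨x, _, rfl⟩; exact x.2) _ hP.one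
  dsimp only at hG
  let u : Ultrafilter (Finset P) := Ultrafilter.of atTop
  have hu : (u : Filter (Finset P)) ≤ atTop := Ultrafilter.of_le _
  have hcV : ∀ s, ‖V s‖ ≤ ‖n‖ * ‖n'‖ * ‖T‖ := fun s => by
    refine opNorm_le_bound _ (by positivity) fun x => ?_
    refine le_of_sq_le_sq ?_ (by positivity)
    rw [mul_pow]; exact (hG s).Vb x
  have hcφ : ∀ s, ‖φ s‖ ≤ 1 := fun s => by
    refine opNorm_le_bound _ (by positivity) fun x => ?_
    refine le_of_sq_le_sq ?_ (by positivity)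
    rw [mul_pow]; exact (hG s).pb x
  obtain ⟨Vi, -, hVl⟩ := exists_limit u hcV
  obtain ⟨φi, -, hφl⟩ := exists_limit u hcφ
  have hVm : Vi ∈ bicl (S0 ht₁ ht₂ P T) := bicl_limit hcV hVl fun s => (hG s).mem
  have hev : ∀ p ∈ P, ∀ᶠ s in (u : Filter (Finset P)), φ s (p.1 e) = p.1 e ∧
      ∀ k, V s (t₁ (p.1 e) k) = aT ht₂ (n ∘L φ s ∘L adjoint n') (T (t₁ (p.1 e) k)) := by
    intro p hp
    have : ∀ᶠ s in (u : Filter (Finset P)), ({⟨p, hp⟩} : Finset P) ≤ s :=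
      hu (eventually_ge_atTop _)
    filter_upwards [this] with s hs
    exact (hG s).ad p.1 (Or.inr ⟨p.2, by
      rw [Finset.mem_map]; exact ⟨⟨p, hp⟩, hs (by simp), rfl⟩⟩)
  have hφe : ∀ p ∈ P, φi (p.1 e) = p.1 e := by
    intro p hp
    refine ext_inner_left ℂ fun y => tendsto_nhds_unique (hφl _ y) ?_
    refine tendsto_const_nhds.congr' ?_
    filter_upwards [hev p hp] with s hs
    rw [hs.1]
  have hφf : ∀ x, φi (pr W x) = φi x := by
    intro x
    refine ext_inner_left ℂ fun y => tendsto_nhds_unique (hφl _ y) ?_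
    refine (hφl x y).congr fun s => ?_
    rw [← ap (hG s).pf x]; rfl
  have hφ : φi = pr W := by
    ext x
    rw [← hφf]; exact cyc_ext hW φi 1 hφe x
  have hVe : ∀ p ∈ P, ∀ k, Vi (t₁ (p.1 e) k) =
      aT ht₂ (n ∘L pr W ∘L adjoint n') (T (t₁ (p.1 e) k)) := by
    intro p hp k
    refine t_inner_ext ht₂ fun y l => tendsto_nhds_unique (hVl _ _) ?_
    rw [inner_aT]
    have h1 : Tendsto (fun s => ⟪t₂ y l, aT ht₂ (n ∘L φ s ∘L adjoint n') (T (t₁ (p.1 e) k))⟫) u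
        (𝓝 ⟪y, (n ∘L pr W ∘L adjoint n') (adjoint (Rk ht₂ l) (T (t₁ (p.1 e) k)))⟫) := by
      simp only [inner_aT, comp_apply, ← adjoint_inner_left n]
      rw [← hφ]; exact hφl _ _
    refine h1.congr' ?_
    filter_upwards [hev p hp] with s hs
    rw [hs.2]
  have e1 : aT ht₂ (n ∘L pr W ∘L adjoint n') ∘L T ∘L aT ht₁ (pr W) = Vi ∘L aT ht₁ (pr W) := by
    refine t_ext ht₁ fun x k => ?_
    have := cyc_ext hW (Vi ∘L Rk ht₁ k) (aT ht₂ (n ∘L pr W ∘L adjoint n') ∘L T ∘L Rk ht₁ k)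
      (fun p hp => hVe p hp k) x
    simp only [comp_apply, aT_apply]
    exact this.symm
  rw [e1]
  exact S0_right ht₁ ht₂ hcom hVm

lemma T_cyc (ht₁ : IsTensorEmbedding t₁) (ht₂ : IsTensorEmbedding t₂)
    {P : Set ((H₁ →L[ℂ] H₁) × (H₂ →L[ℂ] H₂))} (hP : GP P) {T : T₁ →L[ℂ] T₂}
    (hT : AI ht₁ ht₂ P T) (e : H₁) (W : Submodule ℂ H₁)
    (hW : W = Submodule.span ℂ {z | ∃ p ∈ P, z = p.1 e})
    (hcom : ∀ p ∈ P, p.1 ∘L pr W = pr W ∘L p.1) :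
    T ∘L aT ht₁ (pr W) ∈ bicl (S0 ht₁ ht₂ P T) := by
  set T' := T ∘L aT ht₁ (pr W) with hT'
  set f := pr W with hf
  have hfp : IsProj f := isProj_pr W
  let J : Set (T₂ →L[ℂ] T₂) := {B | ∃ a : H₂ →L[ℂ] H₂, B = aT ht₂ a ∧ (∀ p ∈ P, p.2 ∘L a = a ∘L p.2) ∧
    aT ht₂ a ∘L T' ∈ bicl (S0 ht₁ ht₂ P T) ∧ aT ht₂ (adjoint a) ∘L T' ∈ bicl (S0 ht₁ ht₂ P T)}
  have adjc : ∀ a : H₂ →L[ℂ] H₂, (∀ p ∈ P, p.2 ∘L a = a ∘L p.2) →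
      ∀ p ∈ P, p.2 ∘L adjoint a = adjoint a ∘L p.2 := by
    intro a ha p hp
    have := congrArg adjoint (ha p hp)
    rw [adjoint_comp, adjoint_comp, isSelfAdjoint_iff'.1 (hP.p2 p hp).2] at this
    exact this.symm
  have nJ : ∀ n ∈ Itw P, aT ht₂ (n ∘L f ∘L adjoint n) ∈ J := by
    intro n hn
    refine ⟨_, rfl, fun p hp => ?_, cyc_corner ht₁ ht₂ hP hT hn hn e W hW hcom, ?_⟩
    · calc p.2 ∘L n ∘L f ∘L adjoint n = (p.2 ∘L n) ∘L f ∘L adjoint n := rfl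
        _ = n ∘L (p.1 ∘L f) ∘L adjoint n := by rw [hn p hp]; rfl
        _ = n ∘L f ∘L (p.1 ∘L adjoint n) := by rw [hcom p hp]; rfl
        _ = _ := by rw [Itw_adj hP hn hp]; rfl
    · rw [adjoint_comp, adjoint_comp, adjoint_adjoint, isSelfAdjoint_iff'.1 hfp.2]
      exact cyc_corner ht₁ ht₂ hP hT hn hn e W hW hcom
  refine JL J ?_ ?_ ?_ ?_
  · rintro _ ⟨a, rfl, ha, ha1, ha2⟩ _ ⟨b, rfl, hb, hb1, hb2⟩
    refine ⟨a ∘L b, (aT_comp _ _ _).symm, fun p hp => ?_, ?_, ?_⟩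
    · calc p.2 ∘L a ∘L b = (p.2 ∘L a) ∘L b := rfl
        _ = a ∘L (p.2 ∘L b) := by rw [ha p hp]; rfl
        _ = _ := by rw [hb p hp]; rfl
    · rw [aT_comp, comp_assoc]; exact S0_left ht₁ ht₂ ha hb1
    · rw [adjoint_comp, aT_comp, comp_assoc]; exact S0_left ht₁ ht₂ (adjc b hb) ha2
  · rintro _ ⟨a, rfl, ha, ha1, ha2⟩
    exact ⟨adjoint a, aT_adjoint _ _, adjc a ha, ha2, by rwa [adjoint_adjoint]⟩
  · intro z
    rw [← Submodule.orthogonal_orthogonal_eq_closure, Submodule.mem_orthogonal]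
    intro w hw
    rw [Submodule.mem_orthogonal'] at hw
    have hwl : ∀ n ∈ Itw P, ∀ l x, ⟪n (f x), adjoint (Rk ht₂ l) w⟫ = 0 := by
      intro n hn l x
      set wl := adjoint (Rk ht₂ l) w with hwld
      have h1 := hw _ (Submodule.subset_span ⟨_, nJ n hn, t₂ wl l, rfl⟩)
      rw [aT_apply, ← Rk_apply ht₂, ← adjoint_inner_left, ← hwld, comp_apply, comp_apply,
        ← adjoint_inner_left, ← hfp.idem, ← sa_inner hfp.2, inner_self_eq_zero] at h1
      rw [← adjoint_inner_right, sa_inner hfp.2, h1, inner_zero_right]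
    let E : Submodule ℂ H₂ := Submodule.span ℂ {y | ∃ n ∈ Itw P, ∃ x, y = n (f x)}
    have q1 : aT ht₂ (pr E) w = 0 := by
      refine t_inner_ext ht₂ fun y l => ?_
      rw [inner_aT, pr_zero, inner_zero_right, inner_zero_right]
      intro v hv
      have : E ≤ (ℂ ∙ (adjoint (Rk ht₂ l) w))ᗮ := by
        refine Submodule.span_le.2 ?_
        rintro _ ⟨n, hn, x, rfl⟩
        exact Submodule.mem_orthogonal_singleton_iff_inner_left.2 (hwl n hn l x)
      exact Submodule.mem_orthogonal_singleton_iff_inner_left.1 (this hv)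
    have q2 : aT ht₂ (pr E) ∘L T' = T' := by
      refine t_ext ht₁ fun x k => t_inner_ext ht₂ fun y l => ?_
      rw [comp_apply, inner_aT, hT', comp_apply, aT_apply]
      have := AI_slice hT k l
      rw [pr_of_mem', adjoint_inner_right, Rk_apply]
      exact Submodule.subset_span ⟨_, this, x, rfl⟩
    rw [← q2, comp_apply, ← sa_inner (isProj_aT ht₂ (isProj_pr E)).2, q1, inner_zero_left]
  · rintro _ ⟨a, rfl, ha, ha1, ha2⟩
    exact ha1

/-- the key lemma -/
theorem T_mem_S0 (ht₁ : IsTensorEmbedding t₁) (ht₂ : IsTensorEmbedding t₂)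
    {P : Set ((H₁ →L[ℂ] H₁) × (H₂ →L[ℂ] H₂))} (hP : GP P) {T : T₁ →L[ℂ] T₂}
    (hT : AI ht₁ ht₂ P T) : T ∈ bicl (S0 ht₁ ht₂ P T) := by
  let J : Set (T₁ →L[ℂ] T₁) := {B | ∃ a : H₁ →L[ℂ] H₁, B = aT ht₁ a ∧ (∀ p ∈ P, p.1 ∘L a = a ∘L p.1) ∧
    T ∘L aT ht₁ a ∈ bicl (S0 ht₁ ht₂ P T) ∧ T ∘L aT ht₁ (adjoint a) ∈ bicl (S0 ht₁ ht₂ P T)}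
  have adjc : ∀ a : H₁ →L[ℂ] H₁, (∀ p ∈ P, p.1 ∘L a = a ∘L p.1) →
      ∀ p ∈ P, p.1 ∘L adjoint a = adjoint a ∘L p.1 := by
    intro a ha p hp
    have := congrArg adjoint (ha p hp)
    rw [adjoint_comp, adjoint_comp, isSelfAdjoint_iff'.1 (hP.p1 p hp).2] at this
    exact this.symm
  refine JR J ?_ ?_ ?_ ?_
  · rintro _ ⟨a, rfl, ha, ha1, ha2⟩ _ ⟨b, rfl, hb, hb1, hb2⟩
    refine ⟨a ∘L b, (aT_comp _ _ _).symm, fun p hp => ?_, ?_, ?_⟩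
    · calc p.1 ∘L a ∘L b = (p.1 ∘L a) ∘L b := rfl
        _ = a ∘L (p.1 ∘L b) := by rw [ha p hp]; rfl
        _ = _ := by rw [hb p hp]; rfl
    · rw [aT_comp, ← comp_assoc]; exact S0_right ht₁ ht₂ hb ha1
    · rw [adjoint_comp, aT_comp, ← comp_assoc]; exact S0_right ht₁ ht₂ (adjc a ha) hb2
  · rintro _ ⟨a, rfl, ha, ha1, ha2⟩
    exact ⟨adjoint a, aT_adjoint _ _, adjc a ha, ha2, by rwa [adjoint_adjoint]⟩
  · intro z
    have hs : (Submodule.span ℂ { z | ∃ x y, z = t₁ x y }).topologicalClosure = ⊤ :=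
      ht₁.2.2.2.2.2
    have hz : z ∈ (Submodule.span ℂ { z | ∃ x y, z = t₁ x y }).topologicalClosure := by
      rw [hs]; trivial
    refine Submodule.topologicalClosure_mono ?_ hz
    refine Submodule.span_mono ?_
    rintro _ ⟨e, k, rfl⟩
    let W := Submodule.span ℂ {z | ∃ p ∈ P, z = p.1 e}
    have hinv : ∀ p ∈ P, ∀ v ∈ W, p.1 v ∈ W.topologicalClosure := by
      intro p hp v hv
      refine Submodule.le_topologicalClosure _ ?_
      have : W ≤ W.comap p.1.toLinearMap := by
        refine Submodule.span_le.2 ?_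
        rintro _ ⟨q, hq, rfl⟩
        exact Submodule.subset_span ⟨_, hP.mul p hp q hq, rfl⟩
      exact this hv
    have hcom : ∀ p ∈ P, p.1 ∘L pr W = pr W ∘L p.1 := fun p hp =>
      (pr_intertwine p.1 W W (hinv p hp)
        (by rw [isSelfAdjoint_iff'.1 (hP.p1 p hp).2]; exact hinv p hp)).symm
    have hm := T_cyc ht₁ ht₂ hP hT e W rfl hcom
    refine ⟨aT ht₁ (pr W), ⟨pr W, rfl, hcom, hm, ?_⟩, t₁ e k, ?_⟩
    · rwa [isSelfAdjoint_iff'.1 (isProj_pr W).2]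
    · rw [aT_apply, pr_of_mem']
      exact Submodule.subset_span ⟨_, hP.one, rfl⟩
  · rintro _ ⟨a, rfl, ha, ha1, ha2⟩
    exact ha1

variable {D₁ : StarSubalgebra ℂ (H₁ →L[ℂ] H₁)} {D₂ : StarSubalgebra ℂ (H₂ →L[ℂ] H₂)}

lemma PP_one : ((1 : H₁ →L[ℂ] H₁), (1 : H₂ →L[ℂ] H₂)) ∈ PP D₁ D₂ :=
  ⟨one_mem _, one_mem _, isProj_one, isProj_one⟩

lemma PP_c1 (hD₁ : IsMasa D₁) {p q} (hp : p ∈ PP D₁ D₂) (hq : q ∈ PP D₁ D₂) :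
    p.1 ∘L q.1 = q.1 ∘L p.1 := hD₁.1 _ hp.1 _ hq.1

lemma PP_c2 (hD₂ : IsMasa D₂) {p q} (hp : p ∈ PP D₁ D₂) (hq : q ∈ PP D₁ D₂) :
    p.2 ∘L q.2 = q.2 ∘L p.2 := hD₂.1 _ hp.2.1 _ hq.2.1

lemma GP_LM (hD₁ : IsMasa D₁) (hD₂ : IsMasa D₂) (N : Set (H₁ →L[ℂ] H₂)) : GP (LM D₁ D₂ N) where
  p1 := fun p hp => hp.1.2.2.1
  p2 := fun p hp => hp.1.2.2.2
  one := ⟨PP_one, fun X _ => rfl⟩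
  mul := fun p hp q hq => ⟨⟨mul_mem hp.1.1 hq.1.1, mul_mem hp.1.2.1 hq.1.2.1,
    hp.1.2.2.1.comp hq.1.2.2.1 (PP_c1 hD₁ hp.1 hq.1), hp.1.2.2.2.comp hq.1.2.2.2 (PP_c2 hD₂ hp.1 hq.1)⟩,
    fun X hX => by
      calc (p.2 ∘L q.2) ∘L X = p.2 ∘L (q.2 ∘L X) := rfl
        _ = (p.2 ∘L X) ∘L q.1 := by rw [hq.2 X hX]; rfl
        _ = _ := by rw [hp.2 X hX]; rfl⟩
  cpl := fun p hp => ⟨⟨sub_mem (one_mem _) hp.1.1, sub_mem (one_mem _) hp.1.2.1, hp.1.2.2.1.compl,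
    hp.1.2.2.2.compl⟩, fun X hX => by
      show (1 - p.2) ∘L X = X ∘L (1 - p.1)
      rw [sub_comp, comp_sub, hp.2 X hX]; rfl⟩
  c1 := fun p hp q hq => PP_c1 hD₁ hp.1 hq.1
  c2 := fun p hp q hq => PP_c2 hD₂ hp.1 hq.1

lemma key_S (ht₁ : IsTensorEmbedding t₁) (ht₂ : IsTensorEmbedding t₂)
    (hD₁ : IsMasa D₁) (hD₂ : IsMasa D₂)
    {P : Set ((H₁ →L[ℂ] H₁) × (H₂ →L[ℂ] H₂))} (hP : P ⊆ PP D₁ D₂) {T : T₁ →L[ℂ] T₂}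
    (hT : AI ht₁ ht₂ P T) : T ∈ bicl (S0 ht₁ ht₂ P T) := by
  have h1 : AI ht₁ ht₂ (LM D₁ D₂ (Itw P)) T :=
    AI_of_slice fun k l p hp => hp.2 _ (AI_slice hT k l)
  refine bicl_mono ?_ (T_mem_S0 ht₁ ht₂ (GP_LM hD₁ hD₂ (Itw P)) h1)
  rintro _ ⟨A, hA, x, y, rfl⟩
  exact ⟨A, fun p hp => hA p ⟨hP hp, fun X hX => hX p hp⟩, x, y, rfl⟩

lemma AI_corner {ht₁ : IsTensorEmbedding t₁} {ht₂ : IsTensorEmbedding t₂}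
    {P : Set ((H₁ →L[ℂ] H₁) × (H₂ →L[ℂ] H₂))} {X : T₁ →L[ℂ] T₂} (hX : AI ht₁ ht₂ P X)
    {B : H₂ →L[ℂ] H₂} {A : H₁ →L[ℂ] H₁} (hB : ∀ p ∈ P, p.2 ∘L B = B ∘L p.2)
    (hA : ∀ p ∈ P, p.1 ∘L A = A ∘L p.1) : AI ht₁ ht₂ P (aT ht₂ B ∘L X ∘L aT ht₁ A) := by
  intro p hp
  calc aT ht₂ p.2 ∘L aT ht₂ B ∘L X ∘L aT ht₁ A = (aT ht₂ p.2 ∘L aT ht₂ B) ∘L X ∘L aT ht₁ A := rfl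
    _ = (aT ht₂ B ∘L aT ht₂ p.2) ∘L X ∘L aT ht₁ A := by rw [← aT_comp, hB p hp, aT_comp]
    _ = aT ht₂ B ∘L (aT ht₂ p.2 ∘L X) ∘L aT ht₁ A := rfl
    _ = aT ht₂ B ∘L X ∘L (aT ht₁ p.1 ∘L aT ht₁ A) := by rw [hX p hp]; rfl
    _ = aT ht₂ B ∘L X ∘L (aT ht₁ A ∘L aT ht₁ p.1) := by rw [← aT_comp, hA p hp, aT_comp]
    _ = _ := rfl

lemma AI_add {ht₁ : IsTensorEmbedding t₁} {ht₂ : IsTensorEmbedding t₂}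
    {P : Set ((H₁ →L[ℂ] H₁) × (H₂ →L[ℂ] H₂))} {X Y : T₁ →L[ℂ] T₂} (hX : AI ht₁ ht₂ P X)
    (hY : AI ht₁ ht₂ P Y) : AI ht₁ ht₂ P (X + Y) := fun p hp => by
  rw [comp_add, add_comp, hX p hp, hY p hp]

lemma proj_compl_zero {p : H₁ →L[ℂ] H₁} (hp : IsProj p) : p ∘L (1 - p) = 0 := by
  rw [comp_sub, hp.1]; exact sub_self _

lemma proj_compl_zero' {p : H₁ →L[ℂ] H₁} (hp : IsProj p) : (1 - p) ∘L p = 0 := by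
  rw [sub_comp, hp.1]; exact sub_self _

lemma AI_block (ht₁ : IsTensorEmbedding t₁) (ht₂ : IsTensorEmbedding t₂) {p : H₁ →L[ℂ] H₁}
    {q : H₂ →L[ℂ] H₂} (hp : IsProj p) (hq : IsProj q) (X : T₁ →L[ℂ] T₂) :
    AI ht₁ ht₂ {(p, q)} (aT ht₂ q ∘L X ∘L aT ht₁ p + aT ht₂ (1 - q) ∘L X ∘L aT ht₁ (1 - p)) := by
  rintro _ rfl
  dsimp only
  rw [comp_add, add_comp]
  have h1 : aT ht₂ q ∘L aT ht₂ q = aT ht₂ q := (isProj_aT ht₂ hq).1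
  have h2 : aT ht₁ p ∘L aT ht₁ p = aT ht₁ p := (isProj_aT ht₁ hp).1
  have h3 : aT ht₂ q ∘L aT ht₂ (1 - q) = 0 := by rw [← aT_comp, proj_compl_zero hq, aT_zero]
  have h4 : aT ht₁ (1 - p) ∘L aT ht₁ p = 0 := by rw [← aT_comp, proj_compl_zero' hp, aT_zero]
  rw [← comp_assoc (aT ht₂ q) (aT ht₂ q), h1, ← comp_assoc (aT ht₂ q) (aT ht₂ (1 - q)), h3, zero_comp,
    comp_assoc, comp_assoc, h2, comp_assoc, comp_assoc, h4]
  simp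

lemma pinch_fin (ht₁ : IsTensorEmbedding t₁) (ht₂ : IsTensorEmbedding t₂)
    (hD₁ : IsMasa D₁) (hD₂ : IsMasa D₂) {G : Set (T₁ →L[ℂ] T₂)}
    {P Q : Set ((H₁ →L[ℂ] H₁) × (H₂ →L[ℂ] H₂))} (hP : P ⊆ PP D₁ D₂) (hQ : Q ⊆ PP D₁ D₂)
    {T : T₁ →L[ℂ] T₂} (hT : AI ht₁ ht₂ P T)
    (h : ∀ X, T - X ∈ bicl G → AI ht₁ ht₂ P X → ∀ p ∈ Q,
      aT ht₂ p.2 ∘L X ∘L aT ht₁ (1 - p.1) ∈ bicl G ∧ aT ht₂ (1 - p.2) ∘L X ∘L aT ht₁ p.1 ∈ bicl G)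
    (s : Finset ((H₁ →L[ℂ] H₁) × (H₂ →L[ℂ] H₂))) : (∀ p ∈ s, p ∈ Q) →
    ∃ X, T - X ∈ bicl G ∧ AI ht₁ ht₂ P X ∧ AI ht₁ ht₂ s X ∧ ∀ z, ‖X z‖ ^ 2 ≤ ‖T‖ ^ 2 * ‖z‖ ^ 2 := by
  classical
  induction s using Finset.induction_on with
  | empty =>
    refine fun _ => ⟨T, by rw [sub_self]; exact Submodule.zero_mem _, hT, fun p hp => ?_, fun z => ?_⟩
    · simp at hp
    · rw [← mul_pow]; exact pow_le_pow_left₀ (norm_nonneg _) (T.le_opNorm z) 2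
  | insert q s hqs ih =>
    intro hs
    have hq := hQ (hs q (Finset.mem_insert_self _ _))
    obtain ⟨X, hX1, hX2, hX3, hX4⟩ := ih fun p hp => hs p (Finset.mem_insert_of_mem hp)
    have hsP : ∀ p ∈ (s : Set _), p ∈ PP D₁ D₂ := fun p hp => hQ (hs p (Finset.mem_insert_of_mem hp))
    have hqc : ((1 - q.1, 1 - q.2) : (H₁ →L[ℂ] H₁) × (H₂ →L[ℂ] H₂)) ∈ PP D₁ D₂ :=
      ⟨sub_mem (one_mem _) hq.1, sub_mem (one_mem _) hq.2.1, hq.2.2.1.compl, hq.2.2.2.compl⟩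
    have pres : ∀ R : Set ((H₁ →L[ℂ] H₁) × (H₂ →L[ℂ] H₂)), R ⊆ PP D₁ D₂ → AI ht₁ ht₂ R X →
        AI ht₁ ht₂ R (aT ht₂ q.2 ∘L X ∘L aT ht₁ q.1 + aT ht₂ (1 - q.2) ∘L X ∘L aT ht₁ (1 - q.1)) := by
      intro R hR hX
      refine AI_add (AI_corner hX (fun p hp => PP_c2 hD₂ (hR hp) hq) fun p hp => PP_c1 hD₁ (hR hp) hq)
        (AI_corner hX (fun p hp => PP_c2 hD₂ (hR hp) hqc) fun p hp => PP_c1 hD₁ (hR hp) hqc)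
    have i1 := isProj_aT ht₁ hq.2.2.1
    have i2 := isProj_aT ht₁ hq.2.2.1.compl
    have j1 := isProj_aT ht₂ hq.2.2.2
    have j2 := isProj_aT ht₂ hq.2.2.2.compl
    refine ⟨_, ?_, pres P hP hX2, ?_, block_norm i1 i2 (by rw [← aT_comp, proj_compl_zero hq.2.2.1, aT_zero])
      j1 j2 (by rw [← aT_comp, proj_compl_zero hq.2.2.2, aT_zero]) ?_ ?_ (c := ‖T‖) ?_ ?_⟩
    · have e : T - (aT ht₂ q.2 ∘L X ∘L aT ht₁ q.1 + aT ht₂ (1 - q.2) ∘L X ∘L aT ht₁ (1 - q.1)) =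
          (T - X) + (aT ht₂ q.2 ∘L X ∘L aT ht₁ (1 - q.1) + aT ht₂ (1 - q.2) ∘L X ∘L aT ht₁ q.1) := by
        rw [aT_sub, aT_sub, aT_one, aT_one]
        ext z
        simp
        abel
      rw [e]
      have := h X hX1 hX2 q (hs q (Finset.mem_insert_self _ _))
      exact Submodule.add_mem _ hX1 (Submodule.add_mem _ this.1 this.2)
    · intro p hp
      rw [Finset.coe_insert] at hp
      rcases hp with rfl | hp
      · exact AI_block ht₁ ht₂ hq.2.2.1 hq.2.2.2 X _ rfl
      · exact pres _ hsP hX3 p hp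
    · conv_lhs => rw [← i1.1, ← j1.1]
      rfl
    · conv_lhs => rw [← i2.1, ← j2.1]
      rfl
    · intro z
      refine le_trans (pow_le_pow_left₀ (norm_nonneg _) (j1.norm_le _) 2) ((hX4 _).trans ?_)
      have := i1.norm_le z
      gcongr; exact this
    · intro z
      refine le_trans (pow_le_pow_left₀ (norm_nonneg _) (j2.norm_le _) 2) ((hX4 _).trans ?_)
      have := i2.norm_le z
      gcongr; exact this

lemma pinch (ht₁ : IsTensorEmbedding t₁) (ht₂ : IsTensorEmbedding t₂)
    (hD₁ : IsMasa D₁) (hD₂ : IsMasa D₂) {G : Set (T₁ →L[ℂ] T₂)}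
    {P Q : Set ((H₁ →L[ℂ] H₁) × (H₂ →L[ℂ] H₂))} (hP : P ⊆ PP D₁ D₂) (hQ : Q ⊆ PP D₁ D₂)
    {T : T₁ →L[ℂ] T₂} (hT : AI ht₁ ht₂ P T)
    (h : ∀ X, T - X ∈ bicl G → AI ht₁ ht₂ P X → ∀ p ∈ Q,
      aT ht₂ p.2 ∘L X ∘L aT ht₁ (1 - p.1) ∈ bicl G ∧ aT ht₂ (1 - p.2) ∘L X ∘L aT ht₁ p.1 ∈ bicl G) :
    ∃ X, T - X ∈ bicl G ∧ AI ht₁ ht₂ (P ∪ Q) X := by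
  classical
  choose V h1 h2 h3 h4 using fun s : Finset Q =>
    pinch_fin ht₁ ht₂ hD₁ hD₂ hP hQ hT h (s.map (Function.Embedding.subtype _))
      (by simp only [Finset.mem_map]; rintro _ ⟨x, _, rfl⟩; exact x.2)
  let u : Ultrafilter (Finset Q) := Ultrafilter.of atTop
  have hu : (u : Filter (Finset Q)) ≤ atTop := Ultrafilter.of_le _
  have hc : ∀ s, ‖V s‖ ≤ ‖T‖ := fun s => by
    refine opNorm_le_bound _ (by positivity) fun x => ?_
    refine le_of_sq_le_sq ?_ (by positivity)
    rw [mul_pow]; exact h4 s x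
  obtain ⟨X, -, hl⟩ := exists_limit u hc
  refine ⟨X, ?_, ?_⟩
  · refine bicl_limit (l := (u : Filter (Finset Q))) (Ti := fun s => T - V s) (c := ‖T‖ + ‖T‖)
      (fun s => (norm_sub_le _ _).trans (by gcongr; exact hc s)) ?_ h1
    intro x y
    simp only [sub_apply, inner_sub_right]
    exact tendsto_const_nhds.sub (hl x y)
  · intro p hp
    have hpp : p ∈ PP D₁ D₂ := (union_subset hP hQ) hp
    have hev : ∀ᶠ s in (u : Filter (Finset Q)), aT ht₂ p.2 ∘L V s = V s ∘L aT ht₁ p.1 := by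
      rcases hp with hp | hp
      · exact Eventually.of_forall fun s => h2 s p hp
      · have : ∀ᶠ s in (u : Filter (Finset Q)), ({⟨p, hp⟩} : Finset Q) ≤ s :=
          hu (eventually_ge_atTop _)
        filter_upwards [this] with s hs
        refine h3 s p ?_
        rw [Finset.mem_coe, Finset.mem_map]; exact ⟨⟨p, hp⟩, hs (by simp), rfl⟩
    ext x
    refine ext_inner_left ℂ fun y => ?_
    have a1 := hl x (aT ht₂ p.2 y)
    have a2 := hl (aT ht₁ p.1 x) y
    rw [comp_apply, comp_apply, ← sa_inner (isProj_aT ht₂ hpp.2.2.2).2]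
    refine tendsto_nhds_unique a1 (a2.congr' ?_)
    filter_upwards [hev] with s hs
    rw [sa_inner (isProj_aT ht₂ hpp.2.2.2).2]
    exact congrArg _ (ap hs x).symm

/-- membership of a set of operators is stable under multiplication by the masas -/
def Bim (D₁ : StarSubalgebra ℂ (H₁ →L[ℂ] H₁)) (D₂ : StarSubalgebra ℂ (H₂ →L[ℂ] H₂))
    (V : Set (H₁ →L[ℂ] H₂)) : Prop := ∀ X ∈ V, ∀ A ∈ D₁, ∀ B ∈ D₂, B ∘L X ∘L A ∈ V

/-- a set is decided by a family of pairs -/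
def Dec (Λ : Set ((H₁ →L[ℂ] H₁) × (H₂ →L[ℂ] H₂))) (V : Set (H₁ →L[ℂ] H₂)) : Prop :=
  Itw Λ ⊆ V ∨ ∃ P Q, ((1 : H₁ →L[ℂ] H₁), Q) ∈ Λ ∧ (P, (1 : H₂ →L[ℂ] H₂)) ∈ Λ ∧
    ∀ X ∈ V, Q ∘L X ∘L P = 0

lemma Dec.mono {Λ Λ' : Set ((H₁ →L[ℂ] H₁) × (H₂ →L[ℂ] H₂))} {V : Set (H₁ →L[ℂ] H₂)}
    (h : Dec Λ V) (hs : Λ ⊆ Λ') : Dec Λ' V := by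
  rcases h with h | ⟨P, Q, h1, h2, h3⟩
  · exact Or.inl fun X hX => h fun p hp => hX p (hs hp)
  · exact Or.inr ⟨P, Q, hs h1, hs h2, h3⟩

lemma tens_zero (ht₁ : IsTensorEmbedding t₁) (ht₂ : IsTensorEmbedding t₂) (R : K₁ →L[ℂ] K₂) :
    tens ht₁ ht₂ (0 : H₁ →L[ℂ] H₂) R = 0 := by
  have := aT_tens ht₁ ht₂ (0 : H₁ →L[ℂ] H₂) R 0 0
  rw [zero_comp] at this
  rw [← this, aT_zero, zero_comp]

lemma AI_piece (ht₁ : IsTensorEmbedding t₁) (ht₂ : IsTensorEmbedding t₂) (hD₁ : IsMasa D₁)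
    (hD₂ : IsMasa D₂) {Λ : Set ((H₁ →L[ℂ] H₁) × (H₂ →L[ℂ] H₂))} (hΛ : Λ ⊆ PP D₁ D₂)
    {X : T₁ →L[ℂ] T₂} (hX : AI ht₁ ht₂ Λ X) {p q} (hp : (p, q) ∈ PP D₁ D₂) :
    AI ht₁ ht₂ (Λ ∪ {(1, q), (p, 1)}) (aT ht₂ q ∘L X ∘L aT ht₁ p) := by
  rintro s (hs | rfl | rfl)
  · exact AI_corner hX (fun r hr => PP_c2 hD₂ (hΛ hr) hp) (fun r hr => PP_c1 hD₁ (hΛ hr) hp) s hs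
  · have h1 : aT ht₂ q ∘L aT ht₂ q = aT ht₂ q := (isProj_aT ht₂ hp.2.2.2).1
    dsimp only
    rw [← comp_assoc, h1, aT_one]
    rfl
  · have h2 : aT ht₁ p ∘L aT ht₁ p = aT ht₁ p := (isProj_aT ht₁ hp.2.2.1).1
    dsimp only
    rw [comp_assoc, comp_assoc, h2, aT_one]
    rfl

lemma AI_comp {ht₁ : IsTensorEmbedding t₁} {ht₂ : IsTensorEmbedding t₂}
    {Λ : Set ((H₁ →L[ℂ] H₁) × (H₂ →L[ℂ] H₂))}
    {T : T₁ →L[ℂ] T₂} (hT : AI ht₁ ht₂ Λ T) {p q} (h1 : (1, q) ∈ Λ) (h2 : (p, 1) ∈ Λ) :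
    aT ht₂ q ∘L T ∘L aT ht₁ p = T := by
  have a1 := hT _ h1
  have a2 := hT _ h2
  dsimp only at a1 a2
  rw [aT_one] at a1 a2
  rw [← a2, ← comp_assoc]
  exact a1

lemma comp_gen {ι : Type*} (ht₁ : IsTensorEmbedding t₁) (ht₂ : IsTensorEmbedding t₂)
    {V : ι → Set (H₁ →L[ℂ] H₂)} {Uf : ι → Set (K₁ →L[ℂ] K₂)} (hV : ∀ i, Bim D₁ D₂ (V i))
    {T : T₁ →L[ℂ] T₂} (hT : T ∈ bicl (⋃ i, Es ht₁ ht₂ (V i) (Uf i))) {p q} (hp : p ∈ D₁)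
    (hq : q ∈ D₂) : aT ht₂ q ∘L T ∘L aT ht₁ p ∈ bicl (⋃ i, Es ht₁ ht₂ (V i) (Uf i)) := by
  refine bicl_comp _ _ ?_ hT
  intro X hX
  obtain ⟨i, S, hS, R, hR, rfl⟩ := mem_iUnion.1 hX
  rw [aT_tens]
  exact subset_bicl (mem_iUnion.2 ⟨i, _, hV i _ hS _ hp _ hq, R, hR, rfl⟩)

lemma drop {ι : Type*} (ht₁ : IsTensorEmbedding t₁) (ht₂ : IsTensorEmbedding t₂)
    {Λ : Set ((H₁ →L[ℂ] H₁) × (H₂ →L[ℂ] H₂))} (hΛ : Λ ⊆ PP D₁ D₂)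
    {V : ι → Set (H₁ →L[ℂ] H₂)} {Uf : ι → Set (K₁ →L[ℂ] K₂)} (hV : ∀ i, Bim D₁ D₂ (V i))
    {T : T₁ →L[ℂ] T₂} (hA : AI ht₁ ht₂ Λ T) (hT : T ∈ bicl (⋃ i, Es ht₁ ht₂ (V i) (Uf i)))
    (hd : ∀ i, Dec Λ (V i)) (s : Finset ι) :
    T ∈ bicl {W | ∃ i, (i ∈ s → Itw Λ ⊆ V i) ∧ W ∈ Es ht₁ ht₂ (V i) (Uf i)} := by
  classical
  induction s using Finset.induction_on with
  | empty =>
    refine bicl_mono ?_ hT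
    intro W hW
    obtain ⟨i, hi⟩ := mem_iUnion.1 hW
    exact ⟨i, by simp, hi⟩
  | insert a s ha ih =>
    rcases hd a with h | ⟨P, Q, h1, h2, h3⟩
    · refine bicl_mono ?_ ih
      rintro W ⟨i, hi, hW⟩
      refine ⟨i, fun his => ?_, hW⟩
      rcases Finset.mem_insert.1 his with rfl | h'
      · exact h
      · exact hi h'
    · rw [← AI_comp hA h1 h2]
      refine bicl_comp _ _ ?_ ih
      rintro _ ⟨i, hi, S, hS, R, hR, rfl⟩
      rw [aT_tens]
      by_cases hia : i = a
      · subst hia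
        rw [h3 S hS, tens_zero]
        exact Submodule.zero_mem _
      · refine subset_bicl ⟨i, fun his => hi ?_, _, hV i _ hS _ (hΛ h2).1 _ (hΛ h1).2.1, R, hR, rfl⟩
        exact (Finset.mem_insert.1 his).resolve_left hia

lemma base {ι : Type*} [Finite ι] [TopologicalSpace.SeparableSpace H₁]
    (ht₁ : IsTensorEmbedding t₁) (ht₂ : IsTensorEmbedding t₂)
    (hD₁ : IsMasa D₁) (hD₂ : IsMasa D₂)
    {Λ : Set ((H₁ →L[ℂ] H₁) × (H₂ →L[ℂ] H₂))} (hΛ : Λ ⊆ PP D₁ D₂)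
    {V : ι → Set (H₁ →L[ℂ] H₂)} {Uf : ι → Set (K₁ →L[ℂ] K₂)} (hV : ∀ i, Bim D₁ D₂ (V i))
    {M : Set (H₁ →L[ℂ] H₂)} (hM : Itw Λ ⊆ M) {G : Set (T₁ →L[ℂ] T₂)}
    (hG : ∀ i, Es ht₁ ht₂ (M ∩ V i) (Uf i) ⊆ G)
    {T : T₁ →L[ℂ] T₂} (hA : AI ht₁ ht₂ Λ T) (hT : T ∈ bicl (⋃ i, Es ht₁ ht₂ (V i) (Uf i)))
    (hd : ∀ i, Dec Λ (V i)) : T ∈ bicl G := by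
  classical
  haveI := Fintype.ofFinite ι
  have h := drop ht₁ ht₂ hΛ hV hA hT hd Finset.univ
  refine bicl_le ?_ (key_S ht₁ ht₂ hD₁ hD₂ hΛ hA)
  rintro _ ⟨A, hAA, x, y, rfl⟩
  refine slice_mem ht₁ ht₂ A x y ?_ h
  rintro _ ⟨i, hi, S, hS, R, hR, rfl⟩
  exact ⟨S, R, rfl, subset_bicl (hG i ⟨A, ⟨hM hAA, hi (Finset.mem_univ _) hAA⟩, R, hR, rfl⟩)⟩

lemma PP_pair {p q} (hp : (p, q) ∈ PP D₁ D₂) :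
    ({((1 : H₁ →L[ℂ] H₁), q), (p, (1 : H₂ →L[ℂ] H₂))} : Set _) ⊆ PP D₁ D₂ := by
  rintro s (rfl | rfl)
  · exact ⟨one_mem _, hp.2.1, isProj_one, hp.2.2.2⟩
  · exact ⟨hp.1, one_mem _, hp.2.2.1, isProj_one⟩

lemma main {ι : Type*} [Finite ι] [TopologicalSpace.SeparableSpace H₁]
    (ht₁ : IsTensorEmbedding t₁) (ht₂ : IsTensorEmbedding t₂)
    (hD₁ : IsMasa D₁) (hD₂ : IsMasa D₂)
    {V : ι → Set (H₁ →L[ℂ] H₂)} {Uf : ι → Set (K₁ →L[ℂ] K₂)} (hV : ∀ i, Bim D₁ D₂ (V i))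
    (F : ι → Set (Set (H₁ →L[ℂ] H₂))) (hF : ∀ i, V i = ⋂₀ F i)
    {M : Set (H₁ →L[ℂ] H₂)} {G : Set (T₁ →L[ℂ] T₂)}
    (hG : ∀ i, Es ht₁ ht₂ (M ∩ V i) (Uf i) ⊆ G) (hG2 : G ⊆ ⋃ i, Es ht₁ ht₂ (V i) (Uf i))
    (L : List (Set (H₁ →L[ℂ] H₂))) (hL : ∀ c ∈ L, IsMasaBimodule D₁ D₂ c ∧ IsNestBimodule c) :
    ∀ Λ ⊆ PP D₁ D₂, Itw Λ ⊆ M → ∀ T : T₁ →L[ℂ] T₂, AI ht₁ ht₂ Λ T →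
      T ∈ bicl (⋃ i, Es ht₁ ht₂ (V i) (Uf i)) → (∀ i, ∀ c ∈ F i, Dec Λ c ∨ c ∈ L) →
      T ∈ bicl G := by
  induction L with
  | nil =>
    intro Λ hΛ hM T hA hT hd
    refine base ht₁ ht₂ hD₁ hD₂ hΛ hV hM hG hA hT fun i => ?_
    by_cases h : ∃ c ∈ F i, ¬ Itw Λ ⊆ c
    · obtain ⟨c, hc, hn⟩ := h
      have := (hd i c hc).resolve_right (by simp)
      obtain ⟨P, Q, h1, h2, h3⟩ := this.resolve_left hn
      refine Or.inr ⟨P, Q, h1, h2, fun X hX => h3 X ?_⟩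
      rw [hF i] at hX
      exact hX c hc
    · push Not at h
      left
      rw [hF i]
      exact subset_sInter h
  | cons c L ih =>
    intro Λ hΛ hM T hA hT hd
    have ih := ih fun c hc => hL c (List.mem_cons_of_mem _ hc)
    obtain ⟨hcb, hcn⟩ := hL c List.mem_cons_self
    obtain ⟨Λc, hΛc, c1, c2, c3⟩ := C_structure hD₁ hD₂ hcb hcn
    have step : ∀ Λ', Λ' ⊆ PP D₁ D₂ → Dec (Λ ∪ Λ') c → ∀ X : T₁ →L[ℂ] T₂,
        AI ht₁ ht₂ (Λ ∪ Λ') X → X ∈ bicl (⋃ i, Es ht₁ ht₂ (V i) (Uf i)) → X ∈ bicl G := by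
      intro Λ' hΛ' hdc X hX hX2
      refine ih (Λ ∪ Λ') (union_subset hΛ hΛ') (fun Y hY => hM fun p hp => hY p (Or.inl hp)) X hX hX2 ?_
      intro i d hdF
      rcases hd i d hdF with h | h
      · exact Or.inl (h.mono subset_union_left)
      · rcases List.mem_cons.1 h with rfl | h
        · exact Or.inl hdc
        · exact Or.inr h
    have back : ∀ X, T - X ∈ bicl G → X ∈ bicl (⋃ i, Es ht₁ ht₂ (V i) (Uf i)) := by
      intro X hX
      have := Submodule.sub_mem _ hT (bicl_mono hG2 hX)
      rwa [sub_sub_cancel] at this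
    obtain ⟨X, hX1, hX2⟩ := pinch ht₁ ht₂ hD₁ hD₂ (G := G) hΛ hΛc hA (by
      intro X hX1 hX2 p hp
      have hpp := hΛc hp
      have q1 : (1 - p.1, p.2) ∈ PP D₁ D₂ :=
        ⟨sub_mem (one_mem _) hpp.1, hpp.2.1, hpp.2.2.1.compl, hpp.2.2.2⟩
      have q2 : (p.1, 1 - p.2) ∈ PP D₁ D₂ :=
        ⟨hpp.1, sub_mem (one_mem _) hpp.2.1, hpp.2.2.1, hpp.2.2.2.compl⟩
      have hb := back X hX1
      constructor
      · refine step _ (PP_pair q1) (Or.inl ?_) _ (AI_piece ht₁ ht₂ hD₁ hD₂ hΛ hX2 q1)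
          (comp_gen ht₁ ht₂ hV hb q1.1 q1.2.1)
        intro Y hY
        have a1 := hY (1, p.2) (Or.inr (Or.inl rfl))
        have a2 := hY (1 - p.1, 1) (Or.inr (Or.inr rfl))
        have : p.2 ∘L Y ∘L (1 - p.1) = Y := by
          have b2 : Y ∘L (1 - p.1) = Y := a2.symm
          rw [b2]; exact a1
        rw [← this]
        exact c2 p hp Y
      · refine step _ (PP_pair q2) (Or.inr ?_) _ (AI_piece ht₁ ht₂ hD₁ hD₂ hΛ hX2 q2)
          (comp_gen ht₁ ht₂ hV hb q2.1 q2.2.1)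
        refine ⟨p.1, 1 - p.2, Or.inr (Or.inl rfl), Or.inr (Or.inr rfl), fun Y hY => ?_⟩
        rw [sub_comp, c1 p hp Y hY]
        exact sub_self _)
    have hXG := step Λc hΛc (Or.inl fun Y hY => c3 fun p hp => hY p (Or.inr hp)) X hX2 (back X hX1)
    have := Submodule.add_mem _ hX1 hXG
    rwa [sub_add_cancel] at this

lemma final [TopologicalSpace.SeparableSpace H₁]
    (hD₁ : IsMasa D₁) (hD₂ : IsMasa D₂)
    {r : ℕ} (Bs : Fin r → Set (H₁ →L[ℂ] H₂))
    (hBs : ∀ i, HasFiniteWidth D₁ D₂ (Bs i))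
    (U : Set (K₁ →L[ℂ] K₂)) (Us : Fin r → Set (K₁ →L[ℂ] K₂))
    (ht₁ : IsTensorEmbedding t₁) (ht₂ : IsTensorEmbedding t₂)
    (M C : Set (H₁ →L[ℂ] H₂))
    (hM : IsMasaBimodule D₁ D₂ M) (hMter : IsTernary M)
    (hC : IsMasaBimodule D₁ D₂ C) (hCnest : IsNestBimodule C) {T : T₁ →L[ℂ] T₂}
    (h1 : T ∈ bicl (Es ht₁ ht₂ M U ∪ ⋃ j, Es ht₁ ht₂ (Bs j) (Us j)))
    (h2 : T ∈ bicl (Es ht₁ ht₂ C U ∪ ⋃ j, Es ht₁ ht₂ (Bs j) (Us j))) :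
    T ∈ bicl (Es ht₁ ht₂ (M ∩ C) U ∪ ⋃ j, Es ht₁ ht₂ (Bs j) (Us j)) := by
  choose k Vs hVs hB using hBs
  have hBim : ∀ j, Bim D₁ D₂ (Bs j) := by
    intro j X hX A hA B hB'
    rw [hB j] at hX ⊢
    exact mem_iInter.2 fun i => (hVs j i).1.2 X (mem_iInter.1 hX i) A hA B hB'
  set G := Es ht₁ ht₂ (M ∩ C) U ∪ ⋃ j, Es ht₁ ht₂ (Bs j) (Us j) with hGdef
  have sM : G ⊆ Es ht₁ ht₂ M U ∪ ⋃ j, Es ht₁ ht₂ (Bs j) (Us j) := by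
    refine union_subset_union_left _ ?_
    rintro _ ⟨S, hS, R, hR, rfl⟩; exact ⟨S, hS.1, R, hR, rfl⟩
  have sC : G ⊆ Es ht₁ ht₂ C U ∪ ⋃ j, Es ht₁ ht₂ (Bs j) (Us j) := by
    refine union_subset_union_left _ ?_
    rintro _ ⟨S, hS, R, hR, rfl⟩; exact ⟨S, hS.2, R, hR, rfl⟩
  have killM : ∀ X ∈ bicl (Es ht₁ ht₂ M U ∪ ⋃ j, Es ht₁ ht₂ (Bs j) (Us j)),
      ∀ p ∈ D₁, ∀ q ∈ D₂, (∀ S ∈ M, q ∘L S ∘L p = 0) → aT ht₂ q ∘L X ∘L aT ht₁ p ∈ bicl G := by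
    intro X hX p hp q hq h0
    refine bicl_comp _ _ ?_ hX
    rintro Y (⟨S, hS, R, hR, rfl⟩ | hY)
    · rw [aT_tens, h0 S hS, tens_zero]
      exact Submodule.zero_mem _
    · obtain ⟨j, S, hS, R, hR, rfl⟩ := mem_iUnion.1 hY
      rw [aT_tens]
      exact subset_bicl (Or.inr (mem_iUnion.2 ⟨j, _, hBim j S hS p hp q hq, R, hR, rfl⟩))
  have hLM : LM D₁ D₂ M ⊆ PP D₁ D₂ := fun p hp => hp.1
  obtain ⟨X, hX1, hX2⟩ := pinch ht₁ ht₂ hD₁ hD₂ (G := G) (P := ∅) (empty_subset _) hLM (T := T)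
    (fun p hp => hp.elim) (by
      intro X hX1 _ p hp
      have hX : X ∈ bicl (Es ht₁ ht₂ M U ∪ ⋃ j, Es ht₁ ht₂ (Bs j) (Us j)) := by
        have := Submodule.sub_mem _ h1 (bicl_mono sM hX1)
        rwa [sub_sub_cancel] at this
      constructor
      · refine killM X hX _ (sub_mem (one_mem _) hp.1.1) _ hp.1.2.1 fun S hS => ?_
        rw [← comp_assoc, hp.2 S hS, comp_assoc, proj_compl_zero hp.1.2.2.1, comp_zero]
      · refine killM X hX _ hp.1.1 _ (sub_mem (one_mem _) hp.1.2.1) fun S hS => ?_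
        rw [← hp.2 S hS, ← comp_assoc, proj_compl_zero' hp.1.2.2.2, zero_comp])
  rw [empty_union] at hX2
  have hXC : X ∈ bicl (Es ht₁ ht₂ C U ∪ ⋃ j, Es ht₁ ht₂ (Bs j) (Us j)) := by
    have := Submodule.sub_mem _ h2 (bicl_mono sC hX1)
    rwa [sub_sub_cancel] at this
  let V : Option (Fin r) → Set (H₁ →L[ℂ] H₂) := fun o => o.elim C Bs
  let Uf : Option (Fin r) → Set (K₁ →L[ℂ] K₂) := fun o => o.elim U Us
  let F : Option (Fin r) → Set (Set (H₁ →L[ℂ] H₂)) := fun o => o.elim {C} fun j => range (Vs j)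
  have hU : (⋃ i, Es ht₁ ht₂ (V i) (Uf i)) = Es ht₁ ht₂ C U ∪ ⋃ j, Es ht₁ ht₂ (Bs j) (Us j) := by
    rw [iUnion_option]; rfl
  let L : List (Set (H₁ →L[ℂ] H₂)) :=
    C :: (List.finRange r).flatMap fun j => List.ofFn (Vs j)
  have hXG : X ∈ bicl G := by
    refine main ht₁ ht₂ hD₁ hD₂ (V := V) (Uf := Uf) ?_ F ?_ (M := M) ?_ ?_ L ?_ (LM D₁ D₂ M) hLM
      (M_structure hD₁ hD₂ hM hMter) X hX2 (by rw [hU]; exact hXC) ?_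
    · rintro (_ | j)
      · exact hC.2
      · exact hBim j
    · rintro (_ | j)
      · exact (sInter_singleton _).symm
      · exact (hB j).trans (sInter_range _).symm
    · rintro (_ | j)
      · exact subset_union_left
      · rintro _ ⟨S, hS, R, hR, rfl⟩
        exact Or.inr (mem_iUnion.2 ⟨j, S, hS.2, R, hR, rfl⟩)
    · rw [hU]; exact sC
    · intro c hc
      rcases List.mem_cons.1 hc with rfl | hc
      · exact ⟨hC, hCnest⟩
      · obtain ⟨j, -, hj⟩ := List.mem_flatMap.1 hc
        obtain ⟨i, rfl⟩ := (List.mem_ofFn' _ _).1 hj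
        exact hVs j i
    · rintro (_ | j) c hc
      · right
        have : c = C := hc
        rw [this]; exact List.mem_cons_self
      · right
        refine List.mem_cons_of_mem _ (List.mem_flatMap.2 ⟨j, List.mem_finRange j, ?_⟩)
        exact (List.mem_ofFn' _ _).2 hc
  have := Submodule.add_mem _ hX1 hXG
  rwa [sub_add_cancel] at this

end P10
end OS

/-- Proposition `gama`. -/
theorem statement8
    {H₁ H₂ K₁ K₂ T₁ T₂ : Type*}
    [NormedAddCommGroup H₁] [InnerProductSpace ℂ H₁] [CompleteSpace H₁]
    [NormedAddCommGroup H₂] [InnerProductSpace ℂ H₂] [CompleteSpace H₂]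
    [NormedAddCommGroup K₁] [InnerProductSpace ℂ K₁] [CompleteSpace K₁]
    [NormedAddCommGroup K₂] [InnerProductSpace ℂ K₂] [CompleteSpace K₂]
    [NormedAddCommGroup T₁] [InnerProductSpace ℂ T₁] [CompleteSpace T₁]
    [NormedAddCommGroup T₂] [InnerProductSpace ℂ T₂] [CompleteSpace T₂]
    [TopologicalSpace.SeparableSpace H₁] [TopologicalSpace.SeparableSpace H₂]
    (D₁ : StarSubalgebra ℂ (H₁ →L[ℂ] H₁)) (D₂ : StarSubalgebra ℂ (H₂ →L[ℂ] H₂))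
    (hD₁ : IsMasa D₁) (hD₂ : IsMasa D₂)
    {r : ℕ} (Bs : Fin r → Set (H₁ →L[ℂ] H₂))
    (hBs : ∀ i, HasFiniteWidth D₁ D₂ (Bs i))
    (U : Set (K₁ →L[ℂ] K₂)) (Us : Fin r → Set (K₁ →L[ℂ] K₂))
    (hU : IsWkClosedSubspace U) (hUs : ∀ i, IsWkClosedSubspace (Us i))
    (t₁ : H₁ → K₁ → T₁) (t₂ : H₂ → K₂ → T₂)
    (ht₁ : IsTensorEmbedding t₁) (ht₂ : IsTensorEmbedding t₂)
    (M C : Set (H₁ →L[ℂ] H₂))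
    (hM : IsMasaBimodule D₁ D₂ M) (hMter : IsTernary M)
    (hC : IsMasaBimodule D₁ D₂ C) (hCnest : IsNestBimodule C) :
    wkClosure (wTensor t₁ t₂ M U + setSum fun j => wTensor t₁ t₂ (Bs j) (Us j)) ∩
      wkClosure (wTensor t₁ t₂ C U + setSum fun j => wTensor t₁ t₂ (Bs j) (Us j)) =
    wkClosure (wTensor t₁ t₂ (M ∩ C) U +
      setSum fun j => wTensor t₁ t₂ (Bs j) (Us j)) := by
  rw [OS.sum_eq ht₁ ht₂, OS.sum_eq ht₁ ht₂, OS.sum_eq ht₁ ht₂]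
  refine Subset.antisymm ?_ ?_
  · rintro T ⟨h1, h2⟩
    exact OS.final hD₁ hD₂ Bs hBs U Us ht₁ ht₂ M C hM hMter hC hCnest h1 h2
  · intro T hT
    refine ⟨OS.bicl_mono (union_subset_union_left _ ?_) hT,
      OS.bicl_mono (union_subset_union_left _ ?_) hT⟩
    · rintro _ ⟨S, hS, R, hR, rfl⟩
      exact ⟨S, hS.1, R, hR, rfl⟩
    · rintro _ ⟨S, hS, R, hR, rfl⟩
      exact ⟨S, hS.2, R, hR, rfl⟩
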